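/- Let U ⊆ ℝⁿ be open and convex, and let u : U → ℝ be locally strongly convex. Then for every ε₀ > 0 and every continuous function ε : U → (0,1] there exists a locally strongly convex function v ∈ C²(U) such that: (a) the Lebesgue measure of {x ∈ U : u(x) ≠ v(x)} is less than ε₀; (b) |u(x) − v(x)| < ε(x) for all x ∈ U; (c) the n-dimensional Hausdorff measure of the symmetric difference of the graphs of u and v (as subsets of ℝⁿ⁺¹) is less than ε₀. Moreover, if u is η-strongly convex on U for some η > 0, then for every η̃ ∈ (0, η) such a function v can be chosen to be η̃-strongly convex on U. -/

import Mathlib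

open MeasureTheory Metric Set Filter
open scoped ENNReal

/-- `u` is `η`-strongly convex on `s`: `x ↦ u x - (η/2)‖x‖²` is convex on `s`. -/
def StronglyConvexOnWith {n : ℕ} (η : ℝ) (s : Set (EuclideanSpace ℝ (Fin n)))
    (u : EuclideanSpace ℝ (Fin n) → ℝ) : Prop :=
  ConvexOn ℝ s (fun x => u x - η / 2 * ‖x‖ ^ 2)

/-- `u` is locally strongly convex on the open set `U`: around every point of `U`
there is a ball contained in `U` on which `u` is strongly convex. -/
def LocallyStronglyConvexOn {n : ℕ} (U : Set (EuclideanSpace ℝ (Fin n)))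
    (u : EuclideanSpace ℝ (Fin n) → ℝ) : Prop :=
  ∀ x ∈ U, ∃ r > (0 : ℝ), ball x r ⊆ U ∧ ∃ η > (0 : ℝ), StronglyConvexOnWith η (ball x r) u

/-- The graph `𝒢_u = {(x, u x) : x ∈ U}` of `u : U → ℝ`, as a subset of `ℝ^{n+1}`. -/
noncomputable def graphSet {n : ℕ} (U : Set (EuclideanSpace ℝ (Fin n)))
    (u : EuclideanSpace ℝ (Fin n) → ℝ) : Set (EuclideanSpace ℝ (Fin (n + 1))) :=
  (fun x => (WithLp.equiv 2 (Fin (n + 1) → ℝ)).symm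
    (Fin.snoc (WithLp.equiv 2 (Fin n → ℝ) x) (u x))) '' U

namespace LusinC2

open scoped Topology

set_option linter.unusedSectionVars false

section Convexity

variable {E : Type*} [NormedAddCommGroup E] [InnerProductSpace ℝ E]

/-- A function that is convex near every point of an open convex set is convex. -/
theorem convexOn_of_forall_ball [FiniteDimensional ℝ E] {U : Set E} (hU : Convex ℝ U) {f : E → ℝ}
    (h : ∀ x ∈ U, ∃ r > 0, ConvexOn ℝ (ball x r) f) : ConvexOn ℝ U f := by
  refine ⟨hU, fun x hx y hy a b ha hb hab => ?_⟩
  set z : ℝ → E := fun t => x + t • (y - x) with hz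
  have hzc : Continuous z := by fun_prop
  have hzU : ∀ t ∈ Icc (0:ℝ) 1, z t ∈ U := fun t ht => hU.add_smul_sub_mem hx hy ht
  have hfc : ∀ t ∈ Icc (0:ℝ) 1, ContinuousAt f (z t) := by
    intro t ht
    obtain ⟨r, hr, hc⟩ := h _ (hzU t ht)
    exact (hc.continuousOn isOpen_ball).continuousAt (ball_mem_nhds _ hr)
  set g : ℝ → ℝ := fun t => f (z t) - (1 - t) * f x - t * f y with hg
  have hgc : ContinuousOn g (Icc 0 1) := by
    intro t ht
    have : ContinuousAt (fun t => f (z t)) t := (hfc t ht).comp hzc.continuousAt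
    exact ((this.sub (by fun_prop)).sub (by fun_prop)).continuousWithinAt
  have hg0 : g 0 = 0 := by simp [hg, hz]
  have hg1 : g 1 = 0 := by simp [hg, hz]
  have key : ∀ t ∈ Icc (0:ℝ) 1, g t ≤ 0 := by
    by_contra hcon
    push Not at hcon
    obtain ⟨t₀, ht₀, hpos⟩ := hcon
    obtain ⟨m, hm, hmax⟩ := isCompact_Icc.exists_isMaxOn ⟨t₀, ht₀⟩ hgc
    have hM : 0 < g m := lt_of_lt_of_le hpos (hmax ht₀)
    set S := Icc (0:ℝ) 1 ∩ g ⁻¹' {g m} with hS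
    have hSc : IsClosed S := hgc.preimage_isClosed_of_isClosed isClosed_Icc isClosed_singleton
    have hSb : BddBelow S := ⟨0, fun t ht => ht.1.1⟩
    have hmem := hSc.csInf_mem ⟨m, hm, rfl⟩ hSb
    set τ := sInf S with hτ
    have hτM : g τ = g m := hmem.2
    have h0 : 0 < τ := by
      rcases hmem.1.1.lt_or_eq with h | h
      · exact h
      · rw [← h, hg0] at hτM; linarith
    have h1 : τ < 1 := by
      rcases hmem.1.2.lt_or_eq with h | h
      · exact h
      · rw [h, hg1] at hτM; linarith
    obtain ⟨r, hr, hc⟩ := h _ (hzU τ hmem.1)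
    obtain ⟨d, hd, hball⟩ := Metric.continuousAt_iff.1 (hzc.continuousAt (x := τ)) r hr
    set s := min (d / 2) (min (τ / 2) ((1 - τ) / 2)) with hs
    have hs0 : 0 < s := by
      rw [hs]; refine lt_min (by linarith) (lt_min (by linarith) (by linarith))
    have hsd : s ≤ d / 2 := min_le_left _ _
    have hsτ : s ≤ τ / 2 := (min_le_right _ _).trans (min_le_left _ _)
    have hs1 : s ≤ (1 - τ) / 2 := (min_le_right _ _).trans (min_le_right _ _)
    have e1 : z (τ - s) ∈ ball (z τ) r :=
      hball (by rw [Real.dist_eq, sub_sub_cancel_left, abs_neg, abs_of_pos hs0]; linarith)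
    have e2 : z (τ + s) ∈ ball (z τ) r :=
      hball (by rw [Real.dist_eq, add_sub_cancel_left, abs_of_pos hs0]; linarith)
    have hcv := hc.2 e1 e2 (by norm_num : (0:ℝ) ≤ 1/2) (by norm_num : (0:ℝ) ≤ 1/2) (by norm_num)
    have hmid : (1/2 : ℝ) • z (τ - s) + (1/2 : ℝ) • z (τ + s) = z τ := by
      simp only [hz]; module
    rw [hmid] at hcv
    have l1 : g (τ - s) < g m := by
      refine lt_of_le_of_ne (hmax ⟨by linarith, by linarith⟩) fun hne => ?_
      have : τ ≤ τ - s := csInf_le hSb ⟨⟨by linarith, by linarith⟩, hne⟩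
      linarith
    have l2 : g (τ + s) ≤ g m := hmax ⟨by linarith, by linarith⟩
    simp only [smul_eq_mul] at hcv
    have : g τ ≤ 1/2 * g (τ - s) + 1/2 * g (τ + s) := by
      simp only [hg]; linarith
    linarith
  have hb1 : b ∈ Icc (0:ℝ) 1 := ⟨hb, by linarith⟩
  have := key b hb1
  have ea : a • x + b • y = z b := by
    simp only [hz]; rw [show a = 1 - b by linarith]; module
  rw [ea]
  simp only [hg, smul_eq_mul] at this ⊢
  rw [show a = 1 - b by linarith]; linarith

theorem strongConvexOn_of_forall_ball [FiniteDimensional ℝ E] {U : Set E} (hU : Convex ℝ U)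
    {f : E → ℝ} {η : ℝ} (h : ∀ x ∈ U, ∃ r > 0, StrongConvexOn (ball x r) η f) :
    StrongConvexOn U η f := by
  rw [strongConvexOn_iff_convex]
  refine convexOn_of_forall_ball hU fun x hx => ?_
  obtain ⟨r, hr, hc⟩ := h x hx
  exact ⟨r, hr, strongConvexOn_iff_convex.1 hc⟩

theorem _root_.StrongConvexOn.subset {s t : Set E} {f : E → ℝ} {η : ℝ} (h : StrongConvexOn t η f)
    (hst : s ⊆ t) (hs : Convex ℝ s) : StrongConvexOn s η f :=
  ⟨hs, fun _ hx _ hy => h.2 (hst hx) (hst hy)⟩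

theorem _root_.StrongConvexOn.congr {s : Set E} {f g : E → ℝ} {η : ℝ} (h : StrongConvexOn s η f)
    (hfg : EqOn f g s) : StrongConvexOn s η g := by
  refine ⟨h.1, fun x hx y hy a b ha hb hab => ?_⟩
  rw [← hfg hx, ← hfg hy, ← hfg (h.1 hx hy ha hb hab)]
  exact h.2 hx hy ha hb hab

/-- `f` is `η`-strongly convex in some ball around `x`. -/
def StrongConvexAt (η : ℝ) (f : E → ℝ) (x : E) : Prop :=
  ∃ r > 0, StrongConvexOn (ball x r) η f

theorem StrongConvexAt.congr {f g : E → ℝ} {η : ℝ} {x : E} (h : StrongConvexAt η f x)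
    (hfg : f =ᶠ[𝓝 x] g) : StrongConvexAt η g x := by
  obtain ⟨r, hr, hc⟩ := h
  obtain ⟨r', hr', he⟩ := Metric.eventually_nhds_iff_ball.1 hfg
  refine ⟨min r r', lt_min hr hr', ?_⟩
  exact (hc.subset (ball_subset_ball (min_le_left _ _)) (convex_ball _ _)).congr
    fun y hy => he y (ball_subset_ball (min_le_right _ _) hy)

theorem StrongConvexAt.mono {f : E → ℝ} {η η' : ℝ} {x : E} (h : StrongConvexAt η f x)
    (hη : η' ≤ η) : StrongConvexAt η' f x := by
  obtain ⟨r, hr, hc⟩ := h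
  exact ⟨r, hr, hc.mono hη⟩

theorem StrongConvexOn.strongConvexAt {s : Set E} {f : E → ℝ} {η : ℝ} (h : StrongConvexOn s η f)
    {x : E} (hx : s ∈ 𝓝 x) : StrongConvexAt η f x := by
  obtain ⟨r, hr, hs⟩ := Metric.mem_nhds_iff.1 hx
  exact ⟨r, hr, h.subset hs (convex_ball _ _)⟩

end Convexity

section SmoothMax

theorem hasDerivAt_posPart_pow (k : ℕ) (t : ℝ) :
    HasDerivAt (fun t : ℝ => max t 0 ^ (k + 2)) ((k + 2) * max t 0 ^ (k + 1)) t := by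
  rcases lt_trichotomy t 0 with h | h | h
  · have : (fun t : ℝ => max t 0 ^ (k + 2)) =ᶠ[𝓝 t] fun _ => 0 := by
      filter_upwards [gt_mem_nhds h] with s hs
      rw [max_eq_right hs.le]; simp
    rw [max_eq_right h.le]
    simpa using (hasDerivAt_const t (0:ℝ)).congr_of_eventuallyEq this
  · subst h
    simp only [max_self, ne_eq, Nat.add_eq_zero_iff, one_ne_zero, and_false, not_false_eq_true,
      zero_pow, mul_zero]
    rw [hasDerivAt_iff_isLittleO_nhds_zero]
    simp only [zero_add, max_self, ne_eq, Nat.add_eq_zero_iff, OfNat.ofNat_ne_zero, and_false,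
      not_false_eq_true, zero_pow, sub_zero, smul_zero]
    have h1 : (fun h : ℝ => max h 0 ^ (k + 2)) =O[𝓝 0] fun h : ℝ => h ^ (k + 2) := by
      refine Asymptotics.IsBigO.of_bound 1 (Eventually.of_forall fun h => ?_)
      rw [one_mul, norm_pow, norm_pow]
      refine pow_le_pow_left₀ (norm_nonneg _) ?_ _
      rw [Real.norm_eq_abs, Real.norm_eq_abs, abs_of_nonneg (le_max_right _ _)]
      exact max_le (le_abs_self _) (abs_nonneg _)
    exact h1.trans_isLittleO (by
      simpa using Asymptotics.isLittleO_pow_id (𝕜 := ℝ) (n := k + 2) (by omega))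
  · have : (fun t : ℝ => max t 0 ^ (k + 2)) =ᶠ[𝓝 t] fun t => t ^ (k + 2) := by
      filter_upwards [lt_mem_nhds h] with s hs
      rw [max_eq_left hs.le]
    rw [max_eq_left h.le]
    simpa using (hasDerivAt_pow (k + 2) t).congr_of_eventuallyEq this

theorem contDiff_posPart_cube : ContDiff ℝ 2 (fun t : ℝ => max t 0 ^ 3) := by
  have h2 : ContDiff ℝ 1 (fun t : ℝ => max t 0 ^ 2) := by
    rw [contDiff_one_iff_deriv]
    refine ⟨fun t => (hasDerivAt_posPart_pow 0 t).differentiableAt, ?_⟩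
    rw [show deriv (fun t : ℝ => max t 0 ^ 2) = fun t => 2 * max t 0 from
      funext fun t => by simpa using (hasDerivAt_posPart_pow 0 t).deriv]
    fun_prop
  rw [show (2 : WithTop ℕ∞) = 1 + 1 by norm_num, contDiff_succ_iff_deriv]
  refine ⟨fun t => (hasDerivAt_posPart_pow 1 t).differentiableAt, by simp, ?_⟩
  rw [show deriv (fun t : ℝ => max t 0 ^ 3) = fun t => 3 * max t 0 ^ 2 from
    funext fun t => by
      have := (hasDerivAt_posPart_pow 1 t).deriv
      norm_num at this; exact this]
  exact contDiff_const.mul h2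

/-- A `C²` convex regularization of `t ↦ max t 0`. -/
noncomputable def ramp (t : ℝ) : ℝ :=
  (max (t + 1) 0 ^ 3 - 2 * max t 0 ^ 3 + max (t - 1) 0 ^ 3) / 6

theorem contDiff_ramp : ContDiff ℝ 2 ramp := by
  have h := contDiff_posPart_cube
  have h1 : ContDiff ℝ 2 (fun t : ℝ => max (t + 1) 0 ^ 3) :=
    h.comp (contDiff_id.add contDiff_const)
  have h3 : ContDiff ℝ 2 (fun t : ℝ => max (t - 1) 0 ^ 3) :=
    h.comp (contDiff_id.sub contDiff_const)
  exact ((h1.sub (contDiff_const.mul h)).add h3).div_const _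

noncomputable def rampDeriv (t : ℝ) : ℝ :=
  (max (t + 1) 0 ^ 2 - 2 * max t 0 ^ 2 + max (t - 1) 0 ^ 2) / 2

theorem hasDerivAt_ramp (t : ℝ) : HasDerivAt ramp (rampDeriv t) t := by
  have h := hasDerivAt_posPart_pow 1
  have h1 : HasDerivAt (fun t : ℝ => max (t + 1) 0 ^ 3) _ t := (h (t + 1)).comp_add_const t 1
  have h3 : HasDerivAt (fun t : ℝ => max (t - 1) 0 ^ 3) _ t := (h (t - 1)).comp_sub_const t 1
  have := ((h1.sub ((h t).const_mul 2)).add h3).div_const 6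
  exact this.congr_deriv (by simp only [rampDeriv]; push_cast; ring)

theorem ramp_of_le {t : ℝ} (h : t ≤ -1) : ramp t = 0 := by
  simp only [ramp]
  rw [max_eq_right (by linarith), max_eq_right (by linarith), max_eq_right (by linarith)]; ring

theorem ramp_of_ge {t : ℝ} (h : 1 ≤ t) : ramp t = t := by
  simp only [ramp]
  rw [max_eq_left (by linarith), max_eq_left (by linarith), max_eq_left (by linarith)]; ring

theorem rampDeriv_nonneg (t : ℝ) : 0 ≤ rampDeriv t := by
  simp only [rampDeriv]
  rcases le_total t (-1) with h | h
  · rw [max_eq_right (by linarith), max_eq_right (by linarith), max_eq_right (by linarith)]; simp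
  rw [max_eq_left (a := t + 1) (by linarith)]
  rcases le_total t 0 with h0 | h0
  · rw [max_eq_right h0, max_eq_right (by linarith)]; nlinarith [sq_nonneg (t + 1)]
  rw [max_eq_left h0]
  rcases le_total t 1 with h1 | h1
  · rw [max_eq_right (by linarith)]; nlinarith
  · rw [max_eq_left (by linarith)]; nlinarith

theorem rampDeriv_le_one (t : ℝ) : rampDeriv t ≤ 1 := by
  simp only [rampDeriv]
  rcases le_total t (-1) with h | h
  · rw [max_eq_right (by linarith), max_eq_right (by linarith), max_eq_right (by linarith)]; simp
  rw [max_eq_left (a := t + 1) (by linarith)]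
  rcases le_total t 0 with h0 | h0
  · rw [max_eq_right h0, max_eq_right (by linarith)]; nlinarith
  rw [max_eq_left h0]
  rcases le_total t 1 with h1 | h1
  · rw [max_eq_right (by linarith)]; nlinarith [sq_nonneg (t - 1)]
  · rw [max_eq_left (by linarith)]; nlinarith

theorem rampDeriv_monotone : Monotone rampDeriv := by
  have hd : ∀ t, HasDerivAt rampDeriv (max (t + 1) 0 - 2 * max t 0 + max (t - 1) 0) t := by
    intro t
    have h := hasDerivAt_posPart_pow 0
    have h1 : HasDerivAt (fun t : ℝ => max (t + 1) 0 ^ 2) _ t := (h (t + 1)).comp_add_const t 1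
    have h3 : HasDerivAt (fun t : ℝ => max (t - 1) 0 ^ 2) _ t := (h (t - 1)).comp_sub_const t 1
    have := ((h1.sub ((h t).const_mul 2)).add h3).div_const 2
    exact this.congr_deriv (by push_cast; ring)
  refine monotone_of_deriv_nonneg (fun t => (hd t).differentiableAt) fun t => ?_
  rw [(hd t).deriv]
  rcases le_total t (-1) with h | h
  · rw [max_eq_right (by linarith), max_eq_right (by linarith), max_eq_right (by linarith)]; simp
  rw [max_eq_left (a := t + 1) (by linarith)]
  rcases le_total t 0 with h0 | h0
  · rw [max_eq_right h0, max_eq_right (by linarith)]; linarith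
  rw [max_eq_left h0]
  rcases le_total t 1 with h1 | h1
  · rw [max_eq_right (by linarith)]; linarith
  · rw [max_eq_left (by linarith)]; linarith

theorem deriv_ramp : deriv ramp = rampDeriv := funext fun t => (hasDerivAt_ramp t).deriv

theorem convexOn_ramp : ConvexOn ℝ univ ramp := by
  refine MonotoneOn.convexOn_of_deriv convex_univ contDiff_ramp.continuous.continuousOn ?_ ?_
  · exact (contDiff_ramp.differentiable (by norm_num)).differentiableOn
  · rw [deriv_ramp]; exact rampDeriv_monotone.monotoneOn _

theorem ramp_monotone : Monotone ramp :=
  monotone_of_deriv_nonneg (contDiff_ramp.differentiable (by norm_num)) fun t => by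
    rw [deriv_ramp]; exact rampDeriv_nonneg t

theorem sub_ramp_monotone : Monotone fun t => t - ramp t := by
  have hd : ∀ t, HasDerivAt (fun t => t - ramp t) (1 - rampDeriv t) t := fun t =>
    (hasDerivAt_id t).sub (hasDerivAt_ramp t)
  refine monotone_of_deriv_nonneg (fun t => (hd t).differentiableAt) fun t => ?_
  rw [(hd t).deriv]; linarith [rampDeriv_le_one t]

/-- The regularized maximum of two numbers, with smoothing scale `δ`. -/
noncomputable def smax (δ a b : ℝ) : ℝ := b + δ * ramp ((a - b) / δ)

variable {δ : ℝ}

theorem smax_of_ge (hδ : 0 < δ) {a b : ℝ} (h : b + δ ≤ a) : smax δ a b = a := by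
  rw [smax, ramp_of_ge ((one_le_div hδ).2 (by linarith)), mul_div_cancel₀ _ hδ.ne']; ring

theorem smax_of_le (hδ : 0 < δ) {a b : ℝ} (h : a + δ ≤ b) : smax δ a b = b := by
  rw [smax, ramp_of_le (by rw [div_le_iff₀ hδ]; linarith)]; ring

theorem smax_mono (hδ : 0 < δ) {a b a' b' : ℝ} (ha : a ≤ a') (hb : b ≤ b') :
    smax δ a b ≤ smax δ a' b' := by
  have h1 : smax δ a b ≤ smax δ a' b := by
    simp only [smax]; gcongr; exact ramp_monotone (by gcongr)
  have h2 : smax δ a' b ≤ smax δ a' b' := by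
    have h := sub_ramp_monotone (show (a' - b') / δ ≤ (a' - b) / δ by gcongr)
    have h' := mul_le_mul_of_nonneg_left h hδ.le
    simp only [mul_sub, mul_div_cancel₀ _ hδ.ne'] at h'
    simp only [smax]; linarith
  exact h1.trans h2

theorem smax_sub (δ a b c : ℝ) : smax δ (a - c) (b - c) = smax δ a b - c := by
  simp only [smax, sub_sub_sub_cancel_right]; ring

theorem smax_convex (hδ : 0 < δ) {a b a' b' s t : ℝ} (hs : 0 ≤ s) (ht : 0 ≤ t) (hst : s + t = 1) :
    smax δ (s * a + t * a') (s * b + t * b') ≤ s * smax δ a b + t * smax δ a' b' := by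
  have h := convexOn_ramp.2 (mem_univ ((a - b) / δ)) (mem_univ ((a' - b') / δ)) hs ht hst
  simp only [smul_eq_mul] at h
  have h' := mul_le_mul_of_nonneg_left h hδ.le
  simp only [smax]
  rw [show (s * a + t * a' - (s * b + t * b')) / δ =
      s * ((a - b) / δ) + t * ((a' - b') / δ) by ring]
  nlinarith

theorem left_le_smax (hδ : 0 < δ) (a b : ℝ) : a ≤ smax δ a b := by
  by_cases h : b + δ ≤ a
  · rw [smax_of_ge hδ h]
  · have h1 : smax δ a (a - δ) = a := smax_of_ge hδ (by linarith)
    rw [← h1]; exact smax_mono hδ h1.ge (by linarith)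

theorem smax_le (hδ : 0 < δ) (a b : ℝ) : smax δ a b ≤ max a b + δ := by
  have h1 : smax δ (max a b + δ) (max a b) = max a b + δ := smax_of_ge hδ le_rfl
  rw [← h1]
  exact smax_mono hδ (by linarith [le_max_left a b]) (le_max_right _ _)

theorem contDiffAt_smax {E : Type*} [NormedAddCommGroup E] [NormedSpace ℝ E]
    {f g : E → ℝ} {x : E} (hf : ContDiffAt ℝ 2 f x)
    (hg : ContDiffAt ℝ 2 g x) : ContDiffAt ℝ 2 (fun y => smax δ (f y) (g y)) x := by
  have : ContDiffAt ℝ 2 (fun y => ramp ((f y - g y) / δ)) x :=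
    contDiff_ramp.contDiffAt.comp x ((hf.sub hg).div_const δ)
  exact hg.add (contDiffAt_const.mul this)

theorem strongConvexOn_smax {E : Type*} [NormedAddCommGroup E] [InnerProductSpace ℝ E]
    (hδ : 0 < δ) {s : Set E} {f g : E → ℝ} {η : ℝ} (hf : StrongConvexOn s η f)
    (hg : StrongConvexOn s η g) : StrongConvexOn s η (fun y => smax δ (f y) (g y)) := by
  refine ⟨hf.1, fun x hx y hy a b ha hb hab => ?_⟩
  have h1 := hf.2 hx hy ha hb hab
  have h2 := hg.2 hx hy ha hb hab
  simp only [smul_eq_mul] at h1 h2 ⊢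
  refine (smax_mono hδ h1 h2).trans ?_
  rw [smax_sub]
  linarith [smax_convex hδ (a := f x) (b := g x) (a' := f y) (b' := g y) ha hb hab]

theorem StrongConvexAt.smax {E : Type*} [NormedAddCommGroup E] [InnerProductSpace ℝ E]
    (hδ : 0 < δ) {f g : E → ℝ} {η : ℝ} {x : E} (hf : StrongConvexAt η f x)
    (hg : StrongConvexAt η g x) : StrongConvexAt η (fun y => smax δ (f y) (g y)) x := by
  obtain ⟨r, hr, h⟩ := hf
  obtain ⟨r', hr', h'⟩ := hg
  exact ⟨min r r', lt_min hr hr', strongConvexOn_smax hδ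
    (h.subset (ball_subset_ball (min_le_left _ _)) (convex_ball _ _))
    (h'.subset (ball_subset_ball (min_le_right _ _)) (convex_ball _ _))⟩

end SmoothMax

section Mollifier

variable {E : Type*} [NormedAddCommGroup E] [InnerProductSpace ℝ E] [FiniteDimensional ℝ E]
  [MeasurableSpace E] [BorelSpace E]

open scoped Convolution
open ContinuousLinearMap (lsmul)

/-- The standard bump function supported in the unit ball. -/
noncomputable def stdBump (E : Type*) [NormedAddCommGroup E] [InnerProductSpace ℝ E]
    [FiniteDimensional ℝ E] : ContDiffBump (0 : E) :=
  ⟨1 / 2, 1, by norm_num, by norm_num⟩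

/-- A smooth even probability density supported in the unit ball. -/
noncomputable def kern (E : Type*) [NormedAddCommGroup E] [InnerProductSpace ℝ E]
    [FiniteDimensional ℝ E] [MeasurableSpace E] [BorelSpace E] (x : E) : ℝ :=
  (stdBump E).normed volume x

theorem contDiff_kern {n : ℕ∞} : ContDiff ℝ n (kern E) := (stdBump E).contDiff_normed

theorem kern_nonneg (x : E) : 0 ≤ kern E x := (stdBump E).nonneg_normed x

theorem kern_neg (x : E) : kern E (-x) = kern E x := (stdBump E).normed_neg x

theorem integral_kern : ∫ x, kern E x = 1 := (stdBump E).integral_normed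

theorem integrable_kern : Integrable (kern E) := (stdBump E).integrable_normed

theorem hasCompactSupport_kern : HasCompactSupport (kern E) := (stdBump E).hasCompactSupport_normed

theorem tsupport_kern : tsupport (kern E) = closedBall 0 1 := (stdBump E).tsupport_normed_eq

theorem kern_eq_zero {x : E} (hx : 1 < ‖x‖) : kern E x = 0 := by
  by_contra h
  have := subset_tsupport _ (Function.mem_support.2 h : x ∈ Function.support (kern E))
  rw [tsupport_kern, mem_closedBall_zero_iff] at this
  linarith

/-- Mollification of `f` at scale `s`. -/
noncomputable def mol (s : ℝ) (f : E → ℝ) (x : E) : ℝ := ∫ y, kern E y * f (x - s • y)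

theorem mol_eq_convolution {s : ℝ} (hs : s ≠ 0) (f : E → ℝ) (x : E) :
    mol s f x = (kern E ⋆[lsmul ℝ ℝ] fun z => f (s • z)) (s⁻¹ • x) := by
  simp only [mol, convolution_def, ContinuousLinearMap.lsmul_apply, smul_eq_mul, smul_sub,
    smul_inv_smul₀ hs]

theorem locallyIntegrable_comp_smul {s : ℝ} (hs : s ≠ 0) {f : E → ℝ} (hf : LocallyIntegrable f) :
    LocallyIntegrable fun z : E => f (s • z) := by
  rw [locallyIntegrable_iff] at hf ⊢
  intro K hK
  have h1 := hf _ (hK.image (continuous_const_smul s))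
  rw [← integrable_indicator_iff hK.measurableSet]
  rw [← integrable_indicator_iff (hK.image (continuous_const_smul s)).measurableSet] at h1
  have := h1.comp_smul hs
  refine this.congr (Eventually.of_forall fun z => ?_)
  by_cases hz : z ∈ K
  · rw [indicator_of_mem hz]
    exact indicator_of_mem (mem_image_of_mem (fun x => s • x) hz) f
  · have : s • z ∉ (fun x => s • x) '' K := by
      rintro ⟨w, hw, e⟩
      exact hz (smul_right_injective E hs e ▸ hw)
    simp only [indicator, hz, this, if_false]

theorem contDiff_mol {s : ℝ} (hs : s ≠ 0) {f : E → ℝ} (hf : LocallyIntegrable f) {n : ℕ∞} :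
    ContDiff ℝ n (mol s f) := by
  have h1 : ContDiff ℝ n (kern E ⋆[lsmul ℝ ℝ] fun z => f (s • z)) :=
    hasCompactSupport_kern.contDiff_convolution_left _ contDiff_kern
      (locallyIntegrable_comp_smul hs hf)
  have h2 : mol s f = fun x => (kern E ⋆[lsmul ℝ ℝ] fun z => f (s • z)) (s⁻¹ • x) :=
    funext fun x => mol_eq_convolution hs f x
  rw [h2]
  exact h1.comp (contDiff_const_smul _)

theorem integrable_kern_mul {s : ℝ} (hs : s ≠ 0) {f : E → ℝ} (hf : LocallyIntegrable f) (x : E) :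
    Integrable fun y => kern E y * f (x - s • y) := by
  have := (hasCompactSupport_kern (E := E)).convolutionExists_left (lsmul ℝ ℝ)
    (contDiff_kern (n := 0)).continuous (locallyIntegrable_comp_smul hs hf) (s⁻¹ • x)
  refine Integrable.congr this (Eventually.of_forall fun y => ?_)
  simp [smul_sub, smul_inv_smul₀ hs]

theorem mol_sub {s : ℝ} (hs : s ≠ 0) {f g : E → ℝ} (hf : LocallyIntegrable f)
    (hg : LocallyIntegrable g) (x : E) : mol s (fun y => f y - g y) x = mol s f x - mol s g x := by
  simp only [mol, mul_sub]
  exact integral_sub (integrable_kern_mul hs hf x) (integrable_kern_mul hs hg x)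

theorem abs_mol_sub_le {s : ℝ} (hs : 0 < s) {f : E → ℝ} (hf : LocallyIntegrable f) {x : E} {c B : ℝ}
    (h : ∀ y ∈ closedBall x s, |f y - c| ≤ B) : |mol s f x - c| ≤ B := by
  have e : mol s f x - c = ∫ y, kern E y * (f (x - s • y) - c) := by
    simp only [mol, mul_sub]
    rw [integral_sub (integrable_kern_mul hs.ne' hf x) (integrable_kern.mul_const c),
      integral_mul_const, integral_kern, one_mul]
  have : ‖∫ y, kern E y * (f (x - s • y) - c)‖ ≤ ∫ y, kern E y * B := by
    refine norm_integral_le_of_norm_le (integrable_kern.mul_const B)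
      (Eventually.of_forall fun y => ?_)
    rw [norm_mul, Real.norm_eq_abs, abs_of_nonneg (kern_nonneg y)]
    by_cases hy : 1 < ‖y‖
    · simp [kern_eq_zero hy]
    · refine mul_le_mul_of_nonneg_left (h _ ?_) (kern_nonneg y)
      rw [mem_closedBall, dist_eq_norm, sub_sub_cancel_left, norm_neg, norm_smul,
        Real.norm_eq_abs, abs_of_pos hs]
      nlinarith
  rw [e, ← Real.norm_eq_abs]
  simpa [integral_mul_const, integral_kern] using this

theorem norm_convolution_le {F G : Type*} [NormedAddCommGroup F] [NormedSpace ℝ F]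
    [NormedAddCommGroup G] [NormedSpace ℝ G] {k : E → F} {h : E → ℝ} {L : F →L[ℝ] ℝ →L[ℝ] G}
    (hk : Integrable k) (hsupp : Function.support k ⊆ closedBall 0 1) {z : E} {B : ℝ}
    (hB : ∀ y ∈ closedBall z 1, |h y| ≤ B) : ‖(k ⋆[L] h) z‖ ≤ ‖L‖ * (∫ y, ‖k y‖) * B := by
  rw [convolution_def]
  have : ‖∫ t, L (k t) (h (z - t))‖ ≤ ∫ t, ‖L‖ * ‖k t‖ * B := by
    refine norm_integral_le_of_norm_le ((hk.norm.const_mul _).mul_const B)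
      (Eventually.of_forall fun y => ?_)
    by_cases hy : k y = 0
    · simp [hy]
    · have hy1 : y ∈ closedBall (0 : E) 1 := hsupp hy
      refine (L.le_opNorm₂ _ _).trans ?_
      refine mul_le_mul_of_nonneg_left (hB _ ?_) (by positivity)
      rw [mem_closedBall, dist_eq_norm, sub_sub_cancel_left, norm_neg]
      simpa using hy1
  rwa [integral_mul_const, integral_const_mul] at this

set_option maxSynthPendingDepth 3 in
theorem exists_norm_iteratedFDeriv_convolution_le :
    ∃ C : ℝ, 1 ≤ C ∧ ∀ (h : E → ℝ), LocallyIntegrable h → ∀ (z : E) (B : ℝ), 0 ≤ B →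
      (∀ y ∈ closedBall z 1, |h y| ≤ B) →
      ∀ i ≤ 2, ‖iteratedFDeriv ℝ i (kern E ⋆[lsmul ℝ ℝ] h) z‖ ≤ C * B := by
  set k := kern E with hk
  have c1 : HasCompactSupport (fderiv ℝ k) := hasCompactSupport_kern.fderiv (𝕜 := ℝ)
  have c2 : HasCompactSupport (fderiv ℝ (fderiv ℝ k)) := c1.fderiv (𝕜 := ℝ)
  have d0 : ContDiff ℝ 2 k := contDiff_kern
  have d1 : ContDiff ℝ 1 (fderiv ℝ k) := d0.fderiv_right (by norm_num)
  have d2 : ContDiff ℝ 0 (fderiv ℝ (fderiv ℝ k)) := d1.fderiv_right (by norm_num)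
  have s0 : Function.support k ⊆ closedBall 0 1 := tsupport_kern (E := E) ▸ subset_tsupport _
  have s1 : Function.support (fderiv ℝ k) ⊆ closedBall 0 1 :=
    tsupport_kern (E := E) ▸ support_fderiv_subset ℝ
  have s2 : Function.support (fderiv ℝ (fderiv ℝ k)) ⊆ closedBall 0 1 :=
    (support_fderiv_subset ℝ).trans
      ((closure_mono s1).trans isClosed_closedBall.closure_subset)
  set L0 : ℝ →L[ℝ] ℝ →L[ℝ] ℝ := lsmul ℝ ℝ with hL0
  set L1 := L0.precompL E with hL1
  set L2 := L1.precompL E with hL2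
  set a0 := ‖L0‖ * ∫ y, ‖k y‖
  set a1 := ‖L1‖ * ∫ y, ‖fderiv ℝ k y‖
  set a2 := ‖L2‖ * ∫ y, ‖fderiv ℝ (fderiv ℝ k) y‖
  have p0 : 0 ≤ a0 := by positivity
  have p1 : 0 ≤ a1 := by positivity
  have p2 : 0 ≤ a2 := by positivity
  refine ⟨1 + a0 + a1 + a2, by linarith, fun h hh z B hB0 hB i hi => ?_⟩
  have f1 : fderiv ℝ (k ⋆[L0] h) = (fderiv ℝ k ⋆[L1] h) := funext fun x =>
    (hasCompactSupport_kern.hasFDerivAt_convolution_left L0 (d0.of_le (by norm_num)) hh x).fderiv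
  have f2 : fderiv ℝ (fderiv ℝ k ⋆[L1] h) = (fderiv ℝ (fderiv ℝ k) ⋆[L2] h) := funext fun x =>
    (c1.hasFDerivAt_convolution_left L1 d1 hh x).fderiv
  have i0 := norm_convolution_le (L := L0) integrable_kern s0 hB
  have i1 := norm_convolution_le (L := L1) (d1.continuous.integrable_of_hasCompactSupport c1) s1 hB
  have i2 := norm_convolution_le (L := L2) (d2.continuous.integrable_of_hasCompactSupport c2) s2 hB
  have q0 : 0 ≤ a0 * B := by positivity
  have q1 : 0 ≤ a1 * B := by positivity
  have q2 : 0 ≤ a2 * B := by positivity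
  have e : (1 + a0 + a1 + a2) * B = B + a0 * B + a1 * B + a2 * B := by ring
  rw [e]
  interval_cases i
  · rw [norm_iteratedFDeriv_zero]; linarith
  · rw [norm_iteratedFDeriv_one, f1]; linarith
  · rw [← norm_iteratedFDeriv_fderiv, norm_iteratedFDeriv_one, f1, f2]; linarith

theorem exists_norm_iteratedFDeriv_mol_le (E : Type*) [NormedAddCommGroup E]
    [InnerProductSpace ℝ E] [FiniteDimensional ℝ E] [MeasurableSpace E] [BorelSpace E] :
    ∃ C : ℝ, 1 ≤ C ∧ ∀ (f : E → ℝ), LocallyIntegrable f → ∀ (x : E) (s : ℝ), 0 < s → ∀ (B : ℝ),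
      0 ≤ B → (∀ y ∈ closedBall x s, |f y| ≤ B) →
      ∀ i ≤ 2, ‖iteratedFDeriv ℝ i (mol s f) x‖ ≤ C * B / s ^ i := by
  obtain ⟨C, hC, H⟩ := exists_norm_iteratedFDeriv_convolution_le (E := E)
  refine ⟨C, hC, fun f hf x s hs B hB0 hB i hi => ?_⟩
  have hli := locallyIntegrable_comp_smul hs.ne' hf
  have e : mol s f = fun x => (kern E ⋆[lsmul ℝ ℝ] fun z => f (s • z)) (s⁻¹ • x) :=
    funext fun x => mol_eq_convolution hs.ne' f x
  have hcd : ContDiff ℝ i (kern E ⋆[lsmul ℝ ℝ] fun z => f (s • z)) :=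
    hasCompactSupport_kern.contDiff_convolution_left _ (contDiff_kern (n := i)) hli
  rw [e, iteratedFDeriv_comp_const_smul _ hcd, norm_smul, norm_pow, norm_inv, Real.norm_eq_abs,
    abs_of_pos hs, inv_pow, inv_mul_eq_div]
  refine div_le_div_of_nonneg_right (H _ hli _ B hB0 (fun y hy => hB _ ?_) i hi) (by positivity)
  rw [mem_closedBall, dist_eq_norm] at hy ⊢
  have : s • y - x = s • (y - s⁻¹ • x) := by rw [smul_sub, smul_inv_smul₀ hs.ne']
  rw [this, norm_smul, Real.norm_eq_abs, abs_of_pos hs]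
  nlinarith

end Mollifier

section MollifierConvexity

variable {E : Type*} [NormedAddCommGroup E] [InnerProductSpace ℝ E] [FiniteDimensional ℝ E]
  [MeasurableSpace E] [BorelSpace E]

theorem integral_kern_mul_linear (ℓ : E →L[ℝ] ℝ) : ∫ y, kern E y * ℓ y = 0 := by
  have h := integral_neg_eq_self (fun y => kern E y * ℓ y) (volume : Measure E)
  simp only [kern_neg, map_neg, mul_neg, integral_neg] at h
  linarith

/-- The quadratic polynomial with value `c`, slope `p` and second order part `A` at `a`. -/
def quad (a : E) (c : ℝ) (p : E) (A : E →L[ℝ] E) (y : E) : ℝ :=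
  c + inner ℝ p (y - a) + inner ℝ (A (y - a)) (y - a)

theorem contDiff_quad (a : E) (c : ℝ) (p : E) (A : E →L[ℝ] E) {n : WithTop ℕ∞} :
    ContDiff ℝ n (quad a c p A) := by
  unfold quad
  have : ContDiff ℝ n fun y => A (y - a) := A.contDiff.comp (contDiff_id.sub contDiff_const)
  exact (contDiff_const.add (contDiff_const.inner ℝ (contDiff_id.sub contDiff_const))).add
    (this.inner ℝ (contDiff_id.sub contDiff_const))

theorem integrable_kern_mul_continuous {g : E → ℝ} (hg : Continuous g) :
    Integrable fun y => kern E y * g y :=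
  ((contDiff_kern (n := 0)).continuous.mul hg).integrable_of_hasCompactSupport
    hasCompactSupport_kern.mul_right

theorem mol_quad {s : ℝ} (a : E) (c : ℝ) (p : E) (A : E →L[ℝ] E) :
    ∃ d : ℝ, |d| ≤ ‖A‖ * s ^ 2 ∧ ∀ x, mol s (quad a c p A) x = quad a c p A x + d := by
  refine ⟨s ^ 2 * ∫ y, kern E y * inner ℝ (A y) y, ?_, fun x => ?_⟩
  · have : ‖∫ y, kern E y * inner ℝ (A y) y‖ ≤ ∫ y, kern E y * ‖A‖ := by
      refine norm_integral_le_of_norm_le (integrable_kern.mul_const _)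
        (Eventually.of_forall fun y => ?_)
      rw [norm_mul, Real.norm_eq_abs, abs_of_nonneg (kern_nonneg y)]
      by_cases hy : 1 < ‖y‖
      · simp [kern_eq_zero hy]
      · refine mul_le_mul_of_nonneg_left ?_ (kern_nonneg y)
        calc ‖inner ℝ (A y) y‖ ≤ ‖A y‖ * ‖y‖ := norm_inner_le_norm _ _
          _ ≤ ‖A‖ * ‖y‖ * ‖y‖ := by gcongr; exact A.le_opNorm y
          _ ≤ ‖A‖ * 1 * 1 := by gcongr <;> linarith
          _ = ‖A‖ := by ring
    rw [integral_mul_const, integral_kern, one_mul, Real.norm_eq_abs] at this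
    rw [abs_mul, abs_of_nonneg (sq_nonneg s), mul_comm]
    gcongr
  · set ℓ : E →L[ℝ] ℝ := innerSL ℝ p + innerSL ℝ (A (x - a)) + (innerSL ℝ (x - a)).comp A with hℓ
    have hℓy : ∀ y, ℓ y = inner ℝ p y + inner ℝ (A (x - a)) y + inner ℝ (A y) (x - a) := by
      intro y
      simp only [hℓ, add_apply, ContinuousLinearMap.comp_apply,
        innerSL_apply_apply, real_inner_comm (A y)]
    have e : ∀ y, kern E y * quad a c p A (x - s • y) =
        kern E y * quad a c p A x - s * (kern E y * ℓ y)
          + s ^ 2 * (kern E y * inner ℝ (A y) y) := by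
      intro y
      rw [hℓy]
      simp only [quad]
      rw [show x - s • y - a = (x - a) - s • y by abel]
      simp only [map_sub, map_smul, inner_sub_left, inner_sub_right, inner_smul_left,
        inner_smul_right, RCLike.conj_to_real]
      ring
    simp only [mol, e]
    rw [integral_add, integral_sub, integral_mul_const, integral_kern, integral_const_mul,
      integral_const_mul, integral_kern_mul_linear]
    · ring
    · exact integrable_kern.mul_const _
    · exact (integrable_kern_mul_continuous ℓ.continuous).const_mul _
    · exact (integrable_kern.mul_const _).sub
        ((integrable_kern_mul_continuous ℓ.continuous).const_mul _)
    · exact (integrable_kern_mul_continuous (by fun_prop)).const_mul _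

theorem strongConvexOn_mol {s t η : ℝ} (hs : 0 < s) {f : E → ℝ} (hf : LocallyIntegrable f) {x₀ : E}
    (hc : StrongConvexOn (ball x₀ (t + s)) η f) : StrongConvexOn (ball x₀ t) η (mol s f) := by
  refine ⟨convex_ball _ _, fun x hx y hy a b ha hb hab => ?_⟩
  have i1 := integrable_kern_mul hs.ne' hf x
  have i2 := integrable_kern_mul hs.ne' hf y
  have i3 := integrable_kern_mul hs.ne' hf (a • x + b • y)
  set c := a * b * (η / 2 * ‖x - y‖ ^ 2) with hcdef
  have hmain : ∀ z, kern E z * f (a • x + b • y - s • z) ≤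
      a * (kern E z * f (x - s • z)) + b * (kern E z * f (y - s • z)) - kern E z * c := by
    intro z
    by_cases hz : 1 < ‖z‖
    · simp [kern_eq_zero hz]
    have hm : ∀ w ∈ ball x₀ t, w - s • z ∈ ball x₀ (t + s) := by
      intro w hw
      rw [mem_ball, dist_eq_norm] at hw ⊢
      calc ‖w - s • z - x₀‖ = ‖(w - x₀) - s • z‖ := by congr 1; abel
        _ ≤ ‖w - x₀‖ + ‖s • z‖ := norm_sub_le _ _
        _ < t + s := by
          rw [norm_smul, Real.norm_eq_abs, abs_of_pos hs]
          nlinarith [not_lt.1 hz]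
    have := hc.2 (hm x hx) (hm y hy) ha hb hab
    have e1 : a • (x - s • z) + b • (y - s • z) = a • x + b • y - s • z := by
      rw [show b = 1 - a by linarith]; module
    have e2 : x - s • z - (y - s • z) = x - y := by abel
    rw [e1, e2] at this
    simp only [smul_eq_mul] at this
    have := mul_le_mul_of_nonneg_left this (kern_nonneg z)
    rw [← hcdef] at this
    linarith
  have i4 : Integrable fun z => a * (kern E z * f (x - s • z)) + b * (kern E z * f (y - s • z)) :=
    (i1.const_mul a).add (i2.const_mul b)
  have := integral_mono i3 (i4.sub (integrable_kern.mul_const c)) hmain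
  simp only [Pi.sub_apply] at this
  rw [integral_sub i4 (integrable_kern.mul_const c),
    integral_add (i1.const_mul a) (i2.const_mul b), integral_const_mul, integral_const_mul,
    integral_mul_const, integral_kern, one_mul] at this
  simpa only [smul_eq_mul, mol] using this

/-- A `C²` function whose second derivative is bounded by `l` is `-l`-strongly convex. -/
theorem strongConvexOn_of_norm_iteratedFDeriv_le {s : Set E} (hs : Convex ℝ s)
    {h : E → ℝ} {l : ℝ} (hh : ∀ x ∈ s, ContDiffAt ℝ 2 h x)
    (hl : ∀ x ∈ s, ‖iteratedFDeriv ℝ 2 h x‖ ≤ l) : StrongConvexOn s (-l) h := by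
  rw [strongConvexOn_iff_convex]
  refine ⟨hs, fun x hx y hy a b ha hb hab => ?_⟩
  set v := y - x with hv
  have hmem : ∀ t ∈ Icc (0:ℝ) 1, x + t • v ∈ s := fun t ht => hs.add_smul_sub_mem hx hy ht
  have hz : ∀ t : ℝ, HasDerivAt (fun t : ℝ => x + t • v) v t := fun t => by
    simpa using ((hasDerivAt_id t).smul_const v).const_add x
  set g : ℝ → ℝ := fun t => h (x + t • v) + l / 2 * ‖x + t • v‖ ^ 2 with hg
  set g' : ℝ → ℝ := fun t => fderiv ℝ h (x + t • v) v + l * inner ℝ (x + t • v) v with hg'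
  set g'' : ℝ → ℝ := fun t => fderiv ℝ (fderiv ℝ h) (x + t • v) v v + l * inner ℝ v v with hg''
  have d1 : ∀ t ∈ Icc (0:ℝ) 1, HasDerivAt g (g' t) t := by
    intro t ht
    have e0 := ((hh _ (hmem t ht)).differentiableAt (by norm_num)).hasFDerivAt
    have e1 : HasDerivAt (fun t : ℝ => h (x + t • v)) (fderiv ℝ h (x + t • v) v) t :=
      e0.comp_hasDerivAt t (hz t)
    have e2 : HasDerivAt (fun t : ℝ => l / 2 * ‖x + t • v‖ ^ 2)
        (l / 2 * (2 * inner ℝ (x + t • v) v)) t := ((hz t).norm_sq).const_mul (l / 2)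
    exact (e1.add e2).congr_deriv (by simp only [hg']; ring)
  have d2 : ∀ t ∈ Icc (0:ℝ) 1, HasDerivAt g' (g'' t) t := by
    intro t ht
    have hd : DifferentiableAt ℝ (fderiv ℝ h) (x + t • v) :=
      ((hh _ (hmem t ht)).fderiv_right (m := 1) (by norm_num)).differentiableAt (by norm_num)
    have e0 : HasDerivAt (fun t : ℝ => fderiv ℝ h (x + t • v))
        (fderiv ℝ (fderiv ℝ h) (x + t • v) v) t :=
      hd.hasFDerivAt.comp_hasDerivAt t (hz t)
    have e1 : HasDerivAt (fun t : ℝ => fderiv ℝ h (x + t • v) v)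
        (fderiv ℝ (fderiv ℝ h) (x + t • v) v v) t := by
      simpa using e0.clm_apply (hasDerivAt_const t v)
    have e2 : HasDerivAt (fun t : ℝ => l * inner ℝ (x + t • v) v) (l * inner ℝ v v) t := by
      simpa using ((hz t).inner ℝ (hasDerivAt_const t v)).const_mul l
    exact e1.add e2
  have hcv : ConvexOn ℝ (Icc 0 1) g := by
    refine MonotoneOn.convexOn_of_deriv (convex_Icc 0 1)
      (fun t ht => (d1 t ht).continuousAt.continuousWithinAt)
      (fun t ht => (d1 t (interior_subset ht)).differentiableAt.differentiableWithinAt) ?_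
    have hm : MonotoneOn g' (Icc 0 1) := by
      refine monotoneOn_of_deriv_nonneg (convex_Icc 0 1)
        (fun t ht => (d2 t ht).continuousAt.continuousWithinAt)
        (fun t ht => (d2 t (interior_subset ht)).differentiableAt.differentiableWithinAt)
        fun t ht => ?_
      have ht := interior_subset ht
      rw [(d2 t ht).deriv]
      have h1 : ‖fderiv ℝ (fderiv ℝ h) (x + t • v)‖ ≤ l := by
        have := hl _ (hmem t ht)
        rwa [← norm_iteratedFDeriv_fderiv, norm_iteratedFDeriv_one] at this
      have h2 : ‖fderiv ℝ (fderiv ℝ h) (x + t • v) v v‖ ≤ l * ‖v‖ * ‖v‖ :=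
        ((fderiv ℝ (fderiv ℝ h) (x + t • v)).le_opNorm₂ v v).trans (by gcongr)
      have h3 := (abs_le.1 h2).1
      simp only [hg'', real_inner_self_eq_norm_sq]
      nlinarith
    intro t ht t' ht' htt
    have := hm (interior_subset ht) (interior_subset ht') htt
    rwa [(d1 t (interior_subset ht)).deriv, (d1 t' (interior_subset ht')).deriv]
  have := hcv.2 (left_mem_Icc.2 zero_le_one) (right_mem_Icc.2 zero_le_one) ha hb hab
  have e : a • x + b • y = x + b • v := by rw [hv, show a = 1 - b by linarith]; module
  rw [e]
  have e2 : x + v = y := by rw [hv]; abel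
  simp only [hg, smul_eq_mul, mul_zero, mul_one, zero_add, zero_smul, add_zero, one_smul,
    e2] at this
  simp only [smul_eq_mul]
  linarith

theorem StrongConvexAt.add_contDiffAt {f h : E → ℝ} {x : E} {η l : ℝ} (hf : StrongConvexAt η f x)
    {W : Set E} (hW : W ∈ 𝓝 x) (hh : ∀ y ∈ W, ContDiffAt ℝ 2 h y)
    (hl : ∀ y ∈ W, ‖iteratedFDeriv ℝ 2 h y‖ ≤ l) :
    StrongConvexAt (η - l) (fun y => f y + h y) x := by
  obtain ⟨r, hr, hc⟩ := hf
  obtain ⟨r', hr', hW'⟩ := Metric.mem_nhds_iff.1 hW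
  have hs1 : ball x (min r r') ⊆ ball x r := ball_subset_ball (min_le_left _ _)
  have hs2 : ball x (min r r') ⊆ W := (ball_subset_ball (min_le_right _ _)).trans hW'
  refine ⟨min r r', lt_min hr hr', ?_⟩
  have h1 := strongConvexOn_iff_convex.1 (hc.subset hs1 (convex_ball _ _))
  have h2 := strongConvexOn_iff_convex.1 (strongConvexOn_of_norm_iteratedFDeriv_le
    (convex_ball x (min r r')) (fun y hy => hh y (hs2 hy)) (fun y hy => hl y (hs2 hy)))
  rw [strongConvexOn_iff_convex]
  refine (h1.add h2).congr fun y _ => ?_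
  simp only [Pi.add_apply]
  ring

end MollifierConvexity

section Gluing

variable {E : Type*} [NormedAddCommGroup E] [InnerProductSpace ℝ E] [FiniteDimensional ℝ E]
  [MeasurableSpace E] [BorelSpace E]

/-- `f` is strongly convex near every point of `U`, with a modulus depending on the point. -/
def LocStrongConvex (U : Set E) (f : E → ℝ) : Prop := ∀ x ∈ U, ∃ η > 0, StrongConvexAt η f x

theorem StrongConvexAt.eventually {f : E → ℝ} {x : E} {η : ℝ} (h : StrongConvexAt η f x) :
    ∀ᶠ y in 𝓝 x, StrongConvexAt η f y := by
  obtain ⟨r, hr, hc⟩ := h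
  filter_upwards [ball_mem_nhds x hr] with y hy
  exact StrongConvexOn.strongConvexAt hc (isOpen_ball.mem_nhds hy)

theorem StrongConvexAt.continuousAt {f : E → ℝ} {x : E} {η : ℝ} (h : StrongConvexAt η f x) :
    ContinuousAt f x := by
  obtain ⟨r, hr, hc⟩ := h
  have h1 := (strongConvexOn_iff_convex.1 hc).continuousOn isOpen_ball
  have h2 : ContinuousOn (fun y => (f y - η / 2 * ‖y‖ ^ 2) + η / 2 * ‖y‖ ^ 2) (ball x r) :=
    h1.add (by fun_prop)
  simp only [sub_add_cancel] at h2
  exact h2.continuousAt (ball_mem_nhds x hr)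

theorem LocStrongConvex.continuousOn {U : Set E} {f : E → ℝ} (h : LocStrongConvex U f) :
    ContinuousOn f U := fun x hx => by
  obtain ⟨η, -, hη⟩ := h x hx
  exact hη.continuousAt.continuousWithinAt

theorem LocStrongConvex.exists_modulus {U K : Set E} {f : E → ℝ} (h : LocStrongConvex U f)
    (hK : IsCompact K) (hKU : K ⊆ U) : ∃ η > 0, ∀ x ∈ K, StrongConvexAt η f x := by
  rcases K.eq_empty_or_nonempty with rfl | hne
  · exact ⟨1, one_pos, fun x hx => hx.elim⟩
  obtain ⟨n, hn⟩ := hK.elim_directed_cover (fun n : ℕ => {x | StrongConvexAt (1 / (n + 1) : ℝ) f x})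
    (fun n => isOpen_iff_mem_nhds.2 fun x hx => StrongConvexAt.eventually hx)
    (fun x hx => by
      obtain ⟨η, hη, hs⟩ := h x (hKU hx)
      obtain ⟨n, hn⟩ := exists_nat_one_div_lt hη
      exact mem_iUnion.2 ⟨n, hs.mono hn.le⟩)
    (Monotone.directed_le fun m n hmn x hx => StrongConvexAt.mono hx
      (Nat.one_div_le_one_div hmn))
  exact ⟨_, Nat.one_div_pos_of_nat, fun x hx => hn hx⟩

/-- The smooth maximum of `a` and `h` on `N`, extended by `a`. -/
noncomputable def glue (N : Set E) (δ : ℝ) (a h : E → ℝ) (x : E) : ℝ :=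
  open Classical in if x ∈ N then smax δ (a x) (h x) else a x

theorem glue_of_mem {N : Set E} {δ : ℝ} {a h : E → ℝ} {x : E} (hx : x ∈ N) :
    glue N δ a h x = smax δ (a x) (h x) := if_pos hx

theorem glue_of_notMem {N : Set E} {δ : ℝ} {a h : E → ℝ} {x : E} (hx : x ∉ N) :
    glue N δ a h x = a x := if_neg hx

theorem glue_eventuallyEq {N : Set E} (hN : IsOpen N) {δ : ℝ} {a h : E → ℝ} {x : E} (hx : x ∈ N) :
    glue N δ a h =ᶠ[𝓝 x] fun y => smax δ (a y) (h y) := by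
  filter_upwards [hN.mem_nhds hx] with y hy using glue_of_mem hy

theorem glue_eq_left {N Q : Set E} {δ : ℝ} (hδ : 0 < δ) {a h : E → ℝ}
    (H : ∀ x ∈ N \ Q, h x + δ ≤ a x) {x : E} (hx : x ∉ Q) : glue N δ a h x = a x := by
  by_cases hN : x ∈ N
  · rw [glue_of_mem hN, smax_of_ge hδ (H x ⟨hN, hx⟩)]
  · exact glue_of_notMem hN

theorem glue_eventuallyEq_left {N Q : Set E} (hQ : IsClosed Q) {δ : ℝ} (hδ : 0 < δ) {a h : E → ℝ}
    (H : ∀ x ∈ N \ Q, h x + δ ≤ a x) {x : E} (hx : x ∉ Q) : glue N δ a h =ᶠ[𝓝 x] a := by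
  filter_upwards [hQ.isOpen_compl.mem_nhds hx] with y hy using glue_eq_left hδ H hy

theorem le_glue {N : Set E} {δ : ℝ} (hδ : 0 < δ) {a h : E → ℝ} (x : E) :
    a x ≤ glue N δ a h x := by
  by_cases hN : x ∈ N
  · rw [glue_of_mem hN]; exact left_le_smax hδ _ _
  · rw [glue_of_notMem hN]

theorem contDiffAt_glue {N Q : Set E} (hN : IsOpen N) (hQ : IsClosed Q) (hQN : Q ⊆ N) {δ : ℝ}
    (hδ : 0 < δ) {a h : E → ℝ} (H : ∀ x ∈ N \ Q, h x + δ ≤ a x) {x : E}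
    (ha : ContDiffAt ℝ 2 a x) (hh : x ∈ N → ContDiffAt ℝ 2 h x) :
    ContDiffAt ℝ 2 (glue N δ a h) x := by
  by_cases hx : x ∈ N
  · exact (contDiffAt_smax ha (hh hx)).congr_of_eventuallyEq (glue_eventuallyEq hN hx)
  · exact ha.congr_of_eventuallyEq (glue_eventuallyEq_left hQ hδ H fun h => hx (hQN h))

theorem strongConvexAt_glue {N Q : Set E} (hN : IsOpen N) (hQ : IsClosed Q) (hQN : Q ⊆ N) {δ : ℝ}
    (hδ : 0 < δ) {a h : E → ℝ} (H : ∀ x ∈ N \ Q, h x + δ ≤ a x) {x : E} {η : ℝ}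
    (ha : StrongConvexAt η a x) (hh : x ∈ N → StrongConvexAt η h x) :
    StrongConvexAt η (glue N δ a h) x := by
  by_cases hx : x ∈ N
  · exact (StrongConvexAt.smax hδ ha (hh hx)).congr (glue_eventuallyEq hN hx).symm
  · exact ha.congr (glue_eventuallyEq_left hQ hδ H fun h => hx (hQN h)).symm

/-- Smooth cutoff functions with the expected derivative bounds. -/
theorem exists_cutoff (E : Type*) [NormedAddCommGroup E] [InnerProductSpace ℝ E]
    [FiniteDimensional ℝ E] [MeasurableSpace E] [BorelSpace E] :
    ∃ C : ℝ, 1 ≤ C ∧ ∀ (K : Set E) (r : ℝ), 0 < r → ∃ χ : E → ℝ,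
      ContDiff ℝ 2 χ ∧ (∀ x, χ x ∈ Icc (0:ℝ) 1) ∧ (∀ x ∈ thickening (r / 4) K, χ x = 1) ∧
      (∀ x, x ∉ thickening r K → χ x = 0) ∧
      ∀ x, ∀ i ≤ 2, ‖iteratedFDeriv ℝ i χ x‖ ≤ C / r ^ i := by
  obtain ⟨C, hC, H⟩ := exists_norm_iteratedFDeriv_mol_le E
  refine ⟨16 * C, by linarith, fun K r hr => ?_⟩
  set A := cthickening (r / 2) K with hA
  have hAm : MeasurableSet A := isClosed_cthickening.measurableSet
  set f : E → ℝ := A.indicator fun _ => 1 with hf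
  have hli : LocallyIntegrable f := by
    refine (locallyIntegrable_const (1:ℝ)).indicator hAm
  have hf01 : ∀ y, f y ∈ Icc (0:ℝ) 1 := fun y => by
    by_cases hy : y ∈ A
    · simp [hf, hy]
    · simp [hf, hy]
  have hr4 : 0 < r / 4 := by linarith
  refine ⟨mol (r / 4) f, contDiff_mol hr4.ne' hli (n := 2), fun x => ?_, fun x hx => ?_,
    fun x hx => ?_, fun x i hi => ?_⟩
  · have := abs_le.1 (abs_mol_sub_le hr4 hli (x := x) (c := 1 / 2) (B := 1 / 2) fun y _ => by
      rw [abs_le]; constructor <;> linarith [(hf01 y).1, (hf01 y).2])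
    constructor <;> linarith [this.1, this.2]
  · have : |mol (r / 4) f x - 1| ≤ 0 := abs_mol_sub_le hr4 hli fun y hy => by
      have : y ∈ A := by
        rw [mem_thickening_iff] at hx
        obtain ⟨z, hz, hxz⟩ := hx
        refine mem_cthickening_of_dist_le y z _ _ hz ?_
        have := dist_triangle y x z
        rw [mem_closedBall] at hy
        linarith
      simp [hf, this]
    exact sub_eq_zero.1 (abs_nonpos_iff.1 this)
  · have : |mol (r / 4) f x - 0| ≤ 0 := abs_mol_sub_le hr4 hli fun y hy => by
      have : y ∉ A := by
        intro hyA
        apply hx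
        have h1 : y ∈ thickening (r / 2 + r / 8) K :=
          cthickening_subset_thickening' (by positivity) (by linarith) K hyA
        rw [mem_thickening_iff] at h1 ⊢
        obtain ⟨z, hz, hyz⟩ := h1
        refine ⟨z, hz, ?_⟩
        have := dist_triangle x y z
        rw [mem_closedBall, dist_comm] at hy
        linarith
      simp [hf, this]
    simpa using abs_nonpos_iff.1 this
  · refine (H f hli x (r / 4) hr4 1 zero_le_one (fun y _ => ?_) i hi).trans ?_
    · rw [abs_le]; constructor <;> linarith [(hf01 y).1, (hf01 y).2]
    · interval_cases i
      · simp; linarith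
      · rw [div_le_div_iff₀ (by positivity) (by positivity)]; nlinarith
      · rw [div_le_div_iff₀ (by positivity) (by positivity)]; nlinarith [sq_nonneg r]

theorem locallyIntegrable_indicator {K : Set E} (hK : IsCompact K) {f : E → ℝ}
    (hf : ContinuousOn f K) : LocallyIntegrable (K.indicator f) :=
  ((integrable_indicator_iff hK.measurableSet).2 (hf.integrableOn_compact hK)).locallyIntegrable

end Gluing

section Background

variable {E : Type*} [NormedAddCommGroup E] [InnerProductSpace ℝ E] [FiniteDimensional ℝ E]
  [MeasurableSpace E] [BorelSpace E]

theorem norm_iteratedFDeriv_const_mul (a : ℝ) {f : E → ℝ} {x : E} (hf : ContDiffAt ℝ 2 f x)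
    {i : ℕ} (hi : i ≤ 2) :
    ‖iteratedFDeriv ℝ i (fun y => a * f y) x‖ = |a| * ‖iteratedFDeriv ℝ i f x‖ := by
  have h := iteratedFDeriv_const_smul_apply' (𝕜 := ℝ) (i := i) (a := a)
    (hf.of_le (by exact_mod_cast hi))
  simp only [smul_eq_mul] at h
  rw [h, norm_smul, Real.norm_eq_abs]

theorem norm_iteratedFDeriv_sub_le {f g : E → ℝ} {x : E} (hf : ContDiffAt ℝ 2 f x)
    (hg : ContDiffAt ℝ 2 g x) {i : ℕ} (hi : i ≤ 2) :
    ‖iteratedFDeriv ℝ i (fun y => f y - g y) x‖ ≤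
      ‖iteratedFDeriv ℝ i f x‖ + ‖iteratedFDeriv ℝ i g x‖ := by
  rw [fun_iteratedFDeriv_sub_apply (hf.of_le (by exact_mod_cast hi))
    (hg.of_le (by exact_mod_cast hi))]
  exact norm_sub_le _ _

theorem norm_iteratedFDeriv_add_le {f g : E → ℝ} {x : E} (hf : ContDiffAt ℝ 2 f x)
    (hg : ContDiffAt ℝ 2 g x) {i : ℕ} (hi : i ≤ 2) :
    ‖iteratedFDeriv ℝ i (fun y => f y + g y) x‖ ≤
      ‖iteratedFDeriv ℝ i f x‖ + ‖iteratedFDeriv ℝ i g x‖ := by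
  rw [fun_iteratedFDeriv_add_apply (hf.of_le (by exact_mod_cast hi))
    (hg.of_le (by exact_mod_cast hi))]
  exact norm_add_le _ _

theorem strongConvexAt_mol {s t η : ℝ} (hs : 0 < s) (hst : s < t) {f g : E → ℝ}
    (hg : LocallyIntegrable g) {x : E} (hfg : EqOn f g (ball x t))
    (hf : ∀ y ∈ ball x t, StrongConvexAt η f y) : StrongConvexAt η (mol s g) x := by
  have h1 : StrongConvexOn (ball x (t - s + s)) η f := by
    rw [sub_add_cancel]
    exact strongConvexOn_of_forall_ball (convex_ball _ _) hf
  have h2 : StrongConvexOn (ball x (t - s + s)) η g :=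
    h1.congr (by rwa [sub_add_cancel])
  exact ⟨t - s, by linarith, strongConvexOn_mol hs hg h2⟩

theorem exists_mol_approx {U K : Set E} (hU : IsOpen U) {v : E → ℝ} (hv : ContinuousOn v U)
    (hK : IsCompact K) (hKU : K ⊆ U) {c : ℝ} (hc : 0 < c) :
    ∃ h : E → ℝ, ContDiff ℝ 2 h ∧ (∀ x ∈ K, |h x - v x| ≤ c) ∧ ∃ t > 0, (∀ x ∈ K, ball x t ⊆ U) ∧
      ∀ x ∈ K, ∀ η, (∀ y ∈ ball x t, StrongConvexAt η v y) → StrongConvexAt η h x := by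
  obtain ⟨t, ht, htU⟩ := hK.exists_cthickening_subset_open hU hKU
  set K' := cthickening t K with hK'
  have hK'c : IsCompact K' := hK.cthickening
  have hvK : ContinuousOn v K' := hv.mono htU
  have huc := hK'c.uniformContinuousOn_of_continuous hvK
  rw [Metric.uniformContinuousOn_iff_le] at huc
  obtain ⟨s₀, hs₀, huc⟩ := huc c hc
  set s := min s₀ (t / 2) with hs
  have hs0 : 0 < s := lt_min hs₀ (by linarith)
  have hst : s < t := (min_le_right _ _).trans_lt (by linarith)
  have hli := locallyIntegrable_indicator hK'c hvK
  have hmem : ∀ x ∈ K, ∀ y, dist y x ≤ t → y ∈ K' := fun x hx y hy =>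
    mem_cthickening_of_dist_le y x _ _ hx hy
  have hbU : ∀ x ∈ K, ball x t ⊆ K' := fun x hx y hy => hmem x hx y (mem_ball.1 hy).le
  refine ⟨mol s (K'.indicator v), contDiff_mol hs0.ne' hli (n := 2), fun x hx => ?_, t, ht,
    fun x hx => (hbU x hx).trans htU, fun x hx η hη => ?_⟩
  · refine abs_mol_sub_le hs0 hli fun y hy => ?_
    rw [mem_closedBall] at hy
    have hyK : y ∈ K' := hmem x hx y (hy.trans hst.le)
    rw [indicator_of_mem hyK]
    exact huc y hyK x (hmem x hx x (by simpa using ht.le)) (hy.trans (min_le_left _ _))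
  · exact strongConvexAt_mol hs0 hst hli
      (fun y hy => (indicator_of_mem (hbU x hx hy) v).symm) hη

/-- One smoothing step: lower `v` slightly inside `V` so that it becomes `C²` near `L`. -/
theorem exists_smoothing_step {U : Set E} (hU : IsOpen U) {v : E → ℝ} (hv : LocStrongConvex U v)
    {L V K : Set E} (hL : IsCompact L) (hV : IsOpen V) (hLV : L ⊆ V) (hK : IsCompact K)
    (hVK : V ⊆ K) (hKU : K ⊆ U) {e l : ℝ} (he : 0 < e) (hl : 0 < l) :
    ∃ v' : E → ℝ, LocStrongConvex U v' ∧ (∀ x, v' x ≤ v x) ∧ (∀ x, v x - e ≤ v' x) ∧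
      (∀ x ∉ V, v' x = v x) ∧ (∀ x ∈ L, v' x < v x) ∧
      (∀ x ∈ U, ContDiffAt ℝ 2 v x → ContDiffAt ℝ 2 v' x) ∧ (∀ x ∈ L, ContDiffAt ℝ 2 v' x) ∧
      ∀ η, (∀ x ∈ U, StrongConvexAt η v x) → ∀ x ∈ U, StrongConvexAt (η - l) v' x := by
  obtain ⟨C, hC1, hcut⟩ := exists_cutoff E
  obtain ⟨t₂, ht₂, hK₂⟩ := hK.exists_cthickening_subset_open hU hKU
  have hKt : K ⊆ thickening t₂ K := self_subset_thickening ht₂ K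
  have htU : thickening t₂ K ⊆ U := (thickening_subset_cthickening _ _).trans hK₂
  obtain ⟨η₀, hη₀, hK0⟩ := hv.exists_modulus hK.cthickening hK₂
  replace hK0 : ∀ x ∈ thickening t₂ K, StrongConvexAt η₀ v x := fun x hx =>
    hK0 x (thickening_subset_cthickening _ _ hx)
  obtain ⟨t, ht, htV⟩ := hL.exists_cthickening_subset_open hV hLV
  obtain ⟨χ, hχ, hχ01, hχ1, hχ0, hχd⟩ := hcut L t ht
  set Q := cthickening t L with hQ
  have hQc : IsClosed Q := isClosed_cthickening
  have hχQ : ∀ x ∉ Q, χ x = 0 := fun x hx => hχ0 x fun h => hx (thickening_subset_cthickening _ _ h)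
  set l' := min l (η₀ / 2) with hl'
  have hl'0 : 0 < l' := lt_min hl (by linarith)
  obtain ⟨c, hc0, hce, hcl⟩ : ∃ c > 0, 4 * c ≤ e ∧ 4 * c * (C / t ^ 2) ≤ l' := by
    refine ⟨min (e / 4) (l' / (4 * (C / t ^ 2))), lt_min (by linarith) (by positivity), ?_, ?_⟩
    · linarith [min_le_left (e / 4) (l' / (4 * (C / t ^ 2)))]
    · have h1 : min (e / 4) (l' / (4 * (C / t ^ 2))) ≤ l' / (4 * (C / t ^ 2)) := min_le_right _ _
      rw [le_div_iff₀ (by positivity)] at h1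
      linarith
  obtain ⟨h₀, hh₀, hh₀v, t₁, ht₁, hballU, hh₀s⟩ := exists_mol_approx isOpen_thickening
    (hv.continuousOn.mono htU) hK hKt
    (c := c / 2) (by linarith)
  set b : E → ℝ := fun x => -(4 * c) * χ x with hb
  have hbc : ContDiff ℝ 2 b := contDiff_const.mul hχ
  have hbd : ∀ x, ‖iteratedFDeriv ℝ 2 b x‖ ≤ l' := fun x => by
    rw [hb, norm_iteratedFDeriv_const_mul _ hχ.contDiffAt le_rfl, abs_neg,
      abs_of_pos (by linarith)]
    exact (mul_le_mul_of_nonneg_left (hχd x 2 le_rfl) (by linarith)).trans hcl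
  set a : E → ℝ := fun x => v x + b x with ha
  set h : E → ℝ := fun x => h₀ x - 2 * c with hh
  set δ := c / 4 with hδ
  have hδ0 : 0 < δ := by rw [hδ]; linarith
  have hhv : ∀ x ∈ V, h x ≤ v x - 3 / 2 * c ∧ v x - 5 / 2 * c ≤ h x := fun x hx => by
    have := abs_le.1 (hh₀v x (hVK hx))
    simp only [hh]; constructor <;> linarith [this.1, this.2]
  have haQ : ∀ x ∉ Q, a x = v x := fun x hx => by simp [ha, hb, hχQ x hx]
  have hav : ∀ x, a x ≤ v x := fun x => by
    have := mul_nonneg hc0.le (hχ01 x).1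
    simp only [ha, hb]; linarith
  have hva : ∀ x, v x - 4 * c ≤ a x := fun x => by
    have := mul_le_mul_of_nonneg_left (hχ01 x).2 hc0.le
    simp only [ha, hb]; linarith
  have H : ∀ x ∈ V \ Q, h x + δ ≤ a x := fun x hx => by
    rw [haQ x hx.2]; linarith [(hhv x hx.1).1]
  have haS : ∀ x η, StrongConvexAt η v x → StrongConvexAt (η - l') a x := fun x η hη =>
    hη.add_contDiffAt univ_mem (fun y _ => hbc.contDiffAt) fun y _ => hbd y
  have hhS : ∀ x ∈ V, ∀ η, (∀ y ∈ ball x t₁, StrongConvexAt η v y) → StrongConvexAt η h x := by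
    intro x hx η hη
    have := (hh₀s x (hVK hx) η hη).add_contDiffAt (h := fun _ => -(2 * c)) (l := 0) univ_mem
      (fun y _ => contDiffAt_const) fun y _ => by simp [iteratedFDeriv_const_of_ne]
    rw [sub_zero] at this
    exact this
  have hLg : ∀ x ∈ L, glue V δ a h x = h x ∧ glue V δ a h =ᶠ[𝓝 x] h := by
    intro x hx
    have hev : glue V δ a h =ᶠ[𝓝 x] h := by
      have h1 : thickening (t / 4) L ∈ 𝓝 x :=
        isOpen_thickening.mem_nhds (self_subset_thickening (by linarith) _ hx)
      filter_upwards [hV.mem_nhds (hLV hx), h1] with y hy hy1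
      rw [glue_of_mem hy]
      refine smax_of_le hδ0 ?_
      have := (hhv y hy).2
      simp only [ha, hb, hχ1 y hy1]; linarith
    exact ⟨hev.self_of_nhds, hev⟩
  refine ⟨glue V δ a h, fun x hx => ?_, fun x => ?_, fun x => ?_, fun x hx => ?_, fun x hx => ?_,
    fun x hx hxv => ?_, fun x hx => ?_, fun η hη x hx => ?_⟩
  · by_cases hxV : x ∈ V
    · have hηx : StrongConvexAt η₀ v x := hK0 x (hKt (hVK hxV))
      refine ⟨η₀ - l', by linarith [min_le_right l (η₀ / 2)], ?_⟩
      refine strongConvexAt_glue hV hQc htV hδ0 H (haS x _ hηx) fun _ => ?_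
      exact (hhS x hxV η₀ fun y hy => hK0 y (hballU x (hVK hxV) hy)).mono (by linarith)
    · obtain ⟨η, hη, hs⟩ := hv x hx
      have hxQ : x ∉ Q := fun h => hxV (htV h)
      refine ⟨η, hη, (hs.congr ?_)⟩
      refine EventuallyEq.trans ?_ (glue_eventuallyEq_left hQc hδ0 H hxQ).symm
      filter_upwards [hQc.isOpen_compl.mem_nhds hxQ] with y hy using (haQ y hy).symm
  · by_cases hxV : x ∈ V
    · rw [glue_of_mem hxV]
      rcases le_total (h x + δ) (a x) with h1 | h1
      · rw [smax_of_ge hδ0 h1]; exact hav x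
      · refine (smax_le hδ0 _ _).trans ?_
        have := max_le h1 (by linarith : h x ≤ h x + δ)
        linarith [(hhv x hxV).1]
    · rw [glue_of_notMem hxV]; exact hav x
  · linarith [hva x, le_glue hδ0 (N := V) (a := a) (h := h) x]
  · rw [glue_of_notMem hx, haQ x fun h => hx (htV h)]
  · rw [(hLg x hx).1]; linarith [(hhv x (hLV hx)).1]
  · exact contDiffAt_glue hV hQc htV hδ0 H (hxv.add hbc.contDiffAt)
      fun _ => hh₀.contDiffAt.sub contDiffAt_const
  · exact (hh₀.contDiffAt.sub contDiffAt_const).congr_of_eventuallyEq (hLg x hx).2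
  · refine (strongConvexAt_glue hV hQc htV hδ0 H (haS x _ (hη x hx)) fun hxV => ?_).mono
      (η' := η - l) (by linarith [min_le_left l (η₀ / 2)])
    exact (hhS x hxV η fun y hy => hη y (htU (hballU x (hVK hxV) hy))).mono (by linarith)

end Background

section Exhaustion

theorem exists_seq_of_step {α : Type*} {P : α → Prop} {R : ℕ → α → α → Prop} (a₀ : α) (h₀ : P a₀)
    (step : ∀ j a, P a → ∃ a', P a' ∧ R j a a') :
    ∃ s : ℕ → α, s 0 = a₀ ∧ ∀ j, P (s j) ∧ R j (s j) (s (j + 1)) := by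
  choose! F hF hR using step
  set s : ℕ → α := fun j => Nat.rec a₀ (fun j a => F j a) j with hs
  have hP : ∀ j, P (s j) := fun j => by
    induction j with
    | zero => exact h₀
    | succ j ih => exact hF j _ ih
  exact ⟨s, rfl, fun j => ⟨hP j, hR j _ (hP j)⟩⟩

/-- A sequence of functions which is eventually constant on each `O k` has a limit. -/
theorem exists_limit_of_eventually_const {α β : Type*} [Inhabited β] {O : ℕ → Set α} {m : ℕ → ℕ}
    {v : ℕ → α → β} (h : ∀ k, ∀ j ≥ m k, ∀ x ∈ O k, v (j + 1) x = v j x) :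
    ∃ g : α → β, ∀ k, ∀ j ≥ m k, ∀ x ∈ O k, g x = v j x := by
  classical
  have key : ∀ k x, x ∈ O k → ∀ i j, m k ≤ i → i ≤ j → v j x = v i x := by
    intro k x hx i j hi hij
    induction j, hij using Nat.le_induction with
    | base => rfl
    | succ j hij ih => rw [h k j (hi.trans hij) x hx, ih]
  refine ⟨fun x => if hx : ∃ k, x ∈ O k then v (m hx.choose) x else default, fun k j hj x hx => ?_⟩
  have hex : ∃ k, x ∈ O k := ⟨k, hx⟩
  simp only [hex, dif_pos]
  have h1 := hex.choose_spec
  rw [← key _ x h1 _ (max j (m hex.choose)) le_rfl (le_max_right _ _),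
    key k x hx j _ hj (le_max_left _ _)]

variable {E : Type*} [NormedAddCommGroup E] [InnerProductSpace ℝ E] [FiniteDimensional ℝ E]

theorem exists_exhaustion {U : Set E} (hU : IsOpen U) :
    ∃ C : ℕ → Set E, C 0 = ∅ ∧ (∀ j, IsCompact (C j)) ∧ (∀ j, C j ⊆ interior (C (j + 1))) ∧
      ⋃ j, C j = U := by
  have : LocallyCompactSpace U := hU.locallyCompactSpace
  have : SigmaCompactSpace U := inferInstance
  let X : CompactExhaustion U := default
  refine ⟨fun j => match j with | 0 => ∅ | j + 1 => Subtype.val '' (X j), rfl, fun j => ?_,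
    fun j => ?_, ?_⟩
  · match j with
    | 0 => exact isCompact_empty
    | j + 1 => exact (X.isCompact j).image continuous_subtype_val
  · match j with
    | 0 => exact empty_subset _
    | j + 1 =>
      refine interior_maximal (t := Subtype.val '' (interior (X (j + 1)))) ?_ ?_ |>.trans' ?_
      · exact image_mono interior_subset
      · exact hU.isOpenMap_subtype_val _ isOpen_interior
      · exact image_mono (X.subset_interior_succ j)
  · apply Subset.antisymm
    · refine iUnion_subset fun j => ?_
      match j with
      | 0 => exact empty_subset _
      | j + 1 => rintro _ ⟨x, -, rfl⟩; exact x.2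
    · intro x hx
      obtain ⟨j, hj⟩ := X.exists_mem ⟨x, hx⟩
      exact mem_iUnion.2 ⟨j + 1, ⟨x, hx⟩, hj, rfl⟩

end Exhaustion

section Background

variable {E : Type*} [NormedAddCommGroup E] [InnerProductSpace ℝ E] [FiniteDimensional ℝ E]
  [MeasurableSpace E] [BorelSpace E]

/-- Fine `C²` approximation of a locally strongly convex function from strictly below. -/
theorem exists_contDiff_approx_below {U : Set E} (hU : IsOpen U) {u : E → ℝ}
    (hu : LocStrongConvex U u) {e : E → ℝ}
    (he : ∀ K ⊆ U, IsCompact K → ∃ b > 0, ∀ x ∈ K, b ≤ e x) {l : ℝ} (hl : 0 < l) :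
    ∃ g : E → ℝ, LocStrongConvex U g ∧ (∀ x ∈ U, ContDiffAt ℝ 2 g x) ∧
      (∀ x ∈ U, u x - e x < g x ∧ g x < u x) ∧
      ∀ η, (∀ x ∈ U, StrongConvexAt η u x) → ∀ x ∈ U, StrongConvexAt (η - l) g x := by
  obtain ⟨C, hC0, hCc, hCi, hCU⟩ := exists_exhaustion hU
  have hCs : ∀ j, C j ⊆ C (j + 1) := fun j => (hCi j).trans interior_subset
  have hCm : Monotone C := monotone_nat_of_le_succ hCs
  have hCsub : ∀ j, C j ⊆ U := fun j => hCU ▸ subset_iUnion C j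
  choose b hb0 hb using fun j => he (C (j + 2)) (hCsub _) (hCc _)
  set L : ℕ → Set E := fun j => C (j + 1) \ interior (C j) with hL
  set V : ℕ → Set E := fun j => interior (C (j + 2)) \ C (j - 1) with hV
  have hLc : ∀ j, IsCompact (L j) := fun j => (hCc _).diff isOpen_interior
  have hVo : ∀ j, IsOpen (V j) := fun j => isOpen_interior.sdiff (hCc _).isClosed
  have hLV : ∀ j, L j ⊆ V j := fun j x hx => by
    refine ⟨hCi _ hx.1, fun h => hx.2 ?_⟩
    rcases j with _ | j
    · rw [show C (0 - 1) = ∅ from hC0] at h; exact h.elim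
    · exact hCi j h
  have hVC : ∀ j, V j ⊆ C (j + 2) := fun j => sdiff_subset.trans interior_subset
  obtain ⟨v, hv0, hv⟩ := exists_seq_of_step (P := LocStrongConvex U)
    (R := fun j v v' => (∀ x, v' x ≤ v x) ∧ (∀ x, v x - b j * (1 / 2) ^ (j + 2) ≤ v' x) ∧
      (∀ x ∉ V j, v' x = v x) ∧ (∀ x ∈ L j, v' x < v x) ∧
      (∀ x ∈ U, ContDiffAt ℝ 2 v x → ContDiffAt ℝ 2 v' x) ∧ (∀ x ∈ L j, ContDiffAt ℝ 2 v' x) ∧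
      ∀ η, (∀ x ∈ U, StrongConvexAt η v x) →
        ∀ x ∈ U, StrongConvexAt (η - l * (1 / 2) ^ (j + 1)) v' x) u hu
    (fun j a ha => exists_smoothing_step hU ha (hLc j) (hVo j) (hLV j) (hCc _) (hVC j) (hCsub _)
      (mul_pos (hb0 j) (by positivity)) (mul_pos hl (by positivity)))
  choose hP hle hge hVeq hlt hcd hcdL hS using hv
  have hconst : ∀ k, ∀ j ≥ k + 1, ∀ x ∈ interior (C k), v (j + 1) x = v j x := by
    intro k j hj x hx
    refine hVeq j x fun h => h.2 ?_
    exact hCm (by omega : k ≤ j - 1) (interior_subset hx)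
  obtain ⟨g, hg⟩ := exists_limit_of_eventually_const (O := fun k => interior (C k)) hconst
  have hgev : ∀ x ∈ U, ∃ k, ∀ j ≥ k, v j =ᶠ[𝓝 x] g := by
    intro x hx
    rw [← hCU] at hx
    obtain ⟨k, hk⟩ := mem_iUnion.1 hx
    refine ⟨k + 1 + 1, fun j hj => ?_⟩
    filter_upwards [isOpen_interior.mem_nhds (hCi k hk)] with y hy using (hg (k + 1) j hj y hy).symm
  have hlow : ∀ x ∈ U, ∀ j, u x - e x * (1 / 2 - (1 / 2) ^ (j + 1)) ≤ v j x := by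
    intro x hx j
    have hex : 0 < e x := by
      obtain ⟨b, hb, h⟩ := he {x} (singleton_subset_iff.2 hx) isCompact_singleton
      exact hb.trans_le (h x rfl)
    induction j with
    | zero => simp [hv0]
    | succ j ih =>
      have e1 : (1 / 2 : ℝ) ^ (j + 1) = 2 * (1 / 2) ^ (j + 2) := by ring
      have hp : (0 : ℝ) < (1 / 2) ^ (j + 2) := by positivity
      by_cases hxV : x ∈ V j
      · have h1 := hge j x
        have h2 := mul_le_mul_of_nonneg_right (hb j x (hVC j hxV)) hp.le
        rw [e1] at ih
        show u x - e x * (1 / 2 - (1 / 2) ^ (j + 2)) ≤ _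
        linarith
      · rw [hVeq j x hxV]
        refine le_trans ?_ ih
        show u x - e x * (1 / 2 - (1 / 2) ^ (j + 2)) ≤ _
        rw [e1]
        nlinarith
  have hup : ∀ x i j, i ≤ j → v j x ≤ v i x := fun x i j hij => by
    induction j, hij using Nat.le_induction with
    | base => rfl
    | succ j _ ih => exact (hle j x).trans ih
  have hshell : ∀ x ∈ U, ∃ k, x ∈ L k := by
    intro x hx
    rw [← hCU] at hx
    have hex := mem_iUnion.1 hx
    classical
    have hf := Nat.find_spec hex
    rcases h0 : Nat.find hex with _ | k
    · rw [h0, hC0] at hf; exact hf.elim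
    · rw [h0] at hf
      exact ⟨k, hf, fun h => Nat.find_min hex (by omega : k < Nat.find hex) (interior_subset h)⟩
  refine ⟨g, fun x hx => ?_, fun x hx => ?_, fun x hx => ?_, fun η hη x hx => ?_⟩
  · obtain ⟨k, hk⟩ := hgev x hx
    obtain ⟨η, hη, h⟩ := hP k x hx
    exact ⟨η, hη, h.congr (hk k le_rfl)⟩
  · obtain ⟨k, hk⟩ := hgev x hx
    obtain ⟨m, hm⟩ := hshell x hx
    have hj : ∀ j ≥ m + 1, ContDiffAt ℝ 2 (v j) x := by
      intro j hj
      induction j, hj using Nat.le_induction with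
      | base => exact hcdL m x hm
      | succ j _ ih => exact hcd j x hx ih
    exact (hj (max k (m + 1)) (le_max_right _ _)).congr_of_eventuallyEq
      (hk _ (le_max_left _ _)).symm
  · obtain ⟨k, hk⟩ := hgev x hx
    obtain ⟨m, hm⟩ := hshell x hx
    have hex : 0 < e x := by
      obtain ⟨b, hb, h⟩ := he {x} (singleton_subset_iff.2 hx) isCompact_singleton
      exact hb.trans_le (h x rfl)
    constructor
    · rw [← (hk k le_rfl).self_of_nhds]
      have := hlow x hx k
      have hp : (0 : ℝ) < (1 / 2) ^ (k + 1) := by positivity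
      nlinarith
    · rw [← (hk (max k (m + 1)) (le_max_left _ _)).self_of_nhds]
      calc v (max k (m + 1)) x ≤ v (m + 1) x := hup x _ _ (le_max_right _ _)
        _ < v m x := hlt m x hm
        _ ≤ v 0 x := hup x _ _ (Nat.zero_le _)
        _ = u x := by rw [hv0]
  · obtain ⟨k, hk⟩ := hgev x hx
    have hj : ∀ j, ∀ x ∈ U, StrongConvexAt (η - l * (1 - (1 / 2) ^ j)) (v j) x := by
      intro j
      induction j with
      | zero => simpa [hv0] using hη
      | succ j ih =>
        intro x hx
        refine (hS j _ ih x hx).mono (le_of_eq ?_)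
        ring
    refine ((hj k x hx).mono ?_).congr (hk k le_rfl)
    have hp : (0 : ℝ) < (1 / 2) ^ k := by positivity
    nlinarith

end Background

section Whitney

variable {E : Type*} [NormedAddCommGroup E] [InnerProductSpace ℝ E] [FiniteDimensional ℝ E]
  [MeasurableSpace E] [BorelSpace E]

/-- A sequence of functions that is uniformly Cauchy in `C²` has a `C²` limit. -/
theorem exists_contDiff_limit {h : ℕ → E → ℝ} (hh : ∀ m, ContDiff ℝ 2 (h m))
    (hcau : ∀ ε > 0, ∃ N, ∀ k ≥ N, ∀ m ≥ k, ∀ x, ∀ i ≤ 2,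
      ‖iteratedFDeriv ℝ i (fun y => h m y - h k y) x‖ ≤ ε) :
    ∃ g : E → ℝ, ContDiff ℝ 2 g ∧ ∃ φ : ℕ → ℕ, StrictMono φ ∧
      (∀ x, Tendsto (fun n => h (φ n) x) atTop (𝓝 (g x))) ∧
      ∀ x, ∀ i ≤ 2, Tendsto (fun n => iteratedFDeriv ℝ i (h (φ n)) x) atTop
        (𝓝 (iteratedFDeriv ℝ i g x)) := by
  obtain ⟨φ, hφ, hφb⟩ := extraction_forall_of_eventually' (P := fun n k => ∀ m ≥ k, ∀ x, ∀ i ≤ 2,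
    ‖iteratedFDeriv ℝ i (fun y => h m y - h k y) x‖ ≤ (1 / 2 : ℝ) ^ n)
    (fun n => hcau _ (by positivity))
  set G : ℕ → E → ℝ := fun n y => h (φ (n + 1)) y - h (φ n) y with hG
  have hcast : ((2 : ℕ∞) : WithTop ℕ∞) = 2 := rfl
  have hGc : ∀ n, ContDiff ℝ ((2 : ℕ∞) : WithTop ℕ∞) (G n) := fun n => by
    rw [hcast]; exact (hh _).sub (hh _)
  have hGs : ∀ k : ℕ, (k : ℕ∞) ≤ 2 → Summable fun n : ℕ => (1 / 2 : ℝ) ^ n :=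
    fun _ _ => summable_geometric_two
  have hGb : ∀ (k n : ℕ) (x : E), (k : ℕ∞) ≤ 2 → ‖iteratedFDeriv ℝ k (G n) x‖ ≤ (1 / 2 : ℝ) ^ n :=
    fun k n x hk => hφb n _ (hφ (Nat.lt_succ_self n)).le x k (by exact_mod_cast hk)
  have hSc : ContDiff ℝ 2 fun x => ∑' n, G n x := contDiff_tsum hGc hGs hGb
  have hsum : ∀ n x, h (φ n) x = h (φ 0) x + ∑ j ∈ Finset.range n, G j x := by
    intro n x
    simp only [hG]
    rw [Finset.sum_range_sub (fun j => h (φ j) x)]; ring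
  have hlim : ∀ x, ∀ i ≤ 2, Tendsto (fun n => iteratedFDeriv ℝ i (h (φ n)) x) atTop
      (𝓝 (iteratedFDeriv ℝ i (fun x => h (φ 0) x + ∑' n, G n x) x)) := by
    intro x i hi
    have hi' : (i : ℕ∞) ≤ 2 := by exact_mod_cast hi
    have hi2 : ((i : ℕ) : WithTop ℕ∞) ≤ 2 := by exact_mod_cast hi
    rw [fun_iteratedFDeriv_add_apply ((hh _).contDiffAt.of_le hi2) (hSc.contDiffAt.of_le hi2),
      iteratedFDeriv_tsum hGc hGs hGb hi']
    have hs : Summable fun n => iteratedFDeriv ℝ i (G n) x :=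
      Summable.of_norm_bounded summable_geometric_two fun n => hGb i n x hi'
    refine (tendsto_const_nhds.add hs.hasSum.tendsto_sum_nat).congr fun n => ?_
    have e : h (φ n) = fun x => h (φ 0) x + ∑ j ∈ Finset.range n, G j x := funext (hsum n)
    have hGi : ∀ j ∈ Finset.range n, ContDiff ℝ i (G j) := fun j _ => (hGc j).of_le hi2
    rw [e, fun_iteratedFDeriv_add_apply ((hh _).contDiffAt.of_le hi2)
      (ContDiff.sum hGi).contDiffAt, iteratedFDeriv_sum hGi]
    simp
  refine ⟨fun x => h (φ 0) x + ∑' n, G n x, (hh _).add hSc, φ, hφ, fun x => ?_, hlim⟩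
  have h0 := (continuous_eval_const (0 : Fin 0 → E)).continuousAt.tendsto.comp
    (hlim x 0 (by norm_num))
  simpa [Function.comp_def, iteratedFDeriv_zero_apply] using h0

/-- `f` agrees to second order with each model `T a`, `a ∈ K`, up to `κ` at scale `r`. -/
def Good (K : Set E) (T : E → E → ℝ) (f : E → ℝ) (κ r : ℝ) : Prop :=
  ∀ a ∈ K, ∀ x, dist x a ≤ r → ∀ i ≤ 2,
    ‖iteratedFDeriv ℝ i (fun y => f y - T a y) x‖ ≤ κ * r ^ (2 - i)

theorem exists_whitney_extension (E : Type*) [NormedAddCommGroup E] [InnerProductSpace ℝ E]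
    [FiniteDimensional ℝ E] [MeasurableSpace E] [BorelSpace E] :
    ∃ B : ℝ, 1 ≤ B ∧ ∀ (K : Set E), IsCompact K → ∀ (T : E → E → ℝ), (∀ a, ContDiff ℝ 2 (T a)) →
      ∀ (f : ℕ → E → ℝ), (∀ k, ContDiff ℝ 2 (f k)) → ∀ r : ℝ, 0 < r → r ≤ 1 →
      ∀ κ : ℝ, 0 < κ → (∀ k, Good K T (f k) κ (r * (1 / 8) ^ k)) →
      (∀ κ' > 0, ∃ N, ∀ k ≥ N, Good K T (f k) κ' (r * (1 / 8) ^ k)) →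
      ∃ w : E → ℝ, ContDiff ℝ 2 w ∧ (∀ x ∈ K, w x = T x x) ∧
        (∀ x ∉ thickening (r / 8) K, w x = f 0 x) ∧
        ∀ x, ∀ i ≤ 2, ‖iteratedFDeriv ℝ i (fun y => w y - f 0 y) x‖ ≤ B * κ * r ^ (2 - i) := by
  obtain ⟨C, hC1, hcut⟩ := exists_cutoff E
  refine ⟨2 + 260 * C, by linarith, fun K hK T hT f hf r hr hr1 κ hκ hgood hlim => ?_⟩
  set ρ : ℕ → ℝ := fun k => r * (1 / 8) ^ k with hρ
  have hρ0 : ∀ k, 0 < ρ k := fun k => by positivity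
  have hρs : ∀ k, ρ (k + 1) = ρ k / 8 := fun k => by simp only [hρ, pow_succ]; ring
  have hρa : Antitone ρ := antitone_nat_of_succ_le fun k => by rw [hρs]; linarith [hρ0 k]
  have hρ1 : ∀ k, ρ k ≤ 1 := fun k => (hρa (Nat.zero_le k)).trans (by simpa [hρ] using hr1)
  choose χ hχc hχ01 hχ1 hχ0 hχd using fun k => hcut K (ρ (k + 1)) (hρ0 _)
  set w : ℕ → E → ℝ := fun m x => f 0 x + ∑ j ∈ Finset.range m, χ j x * (f (j + 1) x - f j x)
    with hw
  have hws : ∀ m x, w (m + 1) x = w m x + χ m x * (f (m + 1) x - f m x) := fun m x => by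
    simp only [hw, Finset.sum_range_succ]; ring
  have hwc : ∀ m, ContDiff ℝ 2 (w m) := fun m =>
    (hf 0).add (ContDiff.sum fun j _ => (hχc j).mul ((hf _).sub (hf _)))
  have hwf : ∀ m, ∀ x ∈ thickening (ρ m / 4) K, w m x = f m x := by
    intro m x hx
    induction m with
    | zero => simp [hw]
    | succ m ih =>
      rw [hws, ih (thickening_mono (by rw [hρs]; linarith [hρ0 m]) K hx), hχ1 m x hx]; ring
  have hwev : ∀ m x, x ∈ thickening (ρ m / 4) K → w m =ᶠ[𝓝 x] f m := fun m x hx => by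
    filter_upwards [isOpen_thickening.mem_nhds hx] with y hy using hwf m y hy
  have hpair : ∀ (κ' : ℝ) (j m : ℕ) (a x : E) (i : ℕ), i ≤ 2 → a ∈ K → j ≤ m → dist x a ≤ ρ m →
      0 ≤ κ' → Good K T (f j) κ' (ρ j) → Good K T (f m) κ' (ρ m) →
      ‖iteratedFDeriv ℝ i (fun y => f m y - f j y) x‖ ≤
        κ' * ρ m ^ (2 - i) + κ' * ρ j ^ (2 - i) := by
    intro κ' j m a x i hi ha hjm hx _ h1 h2
    have e : (fun y => f m y - f j y) = fun y => (f m y - T a y) - (f j y - T a y) := by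
      ext y; ring
    rw [e]
    refine (norm_iteratedFDeriv_sub_le ((hf m).sub (hT a)).contDiffAt
      ((hf j).sub (hT a)).contDiffAt hi).trans ?_
    exact add_le_add (h2 a ha x hx i hi) (h1 a ha x (hx.trans (hρa hjm)) i hi)
  have hprod : ∀ (κ' : ℝ) (m : ℕ) (a x : E) (i : ℕ), i ≤ 2 → a ∈ K → dist x a ≤ ρ (m + 1) →
      0 ≤ κ' → Good K T (f m) κ' (ρ m) → Good K T (f (m + 1)) κ' (ρ (m + 1)) →
      ‖iteratedFDeriv ℝ i (fun y => χ m y * (f (m + 1) y - f m y)) x‖ ≤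
        260 * C * κ' * ρ (m + 1) ^ (2 - i) := by
    intro κ' m a x i hi ha hx hκ' h1 h2
    have hD : ∀ j ≤ 2, ‖iteratedFDeriv ℝ j (fun y => f (m + 1) y - f m y) x‖ ≤
        65 * κ' * ρ (m + 1) ^ (2 - j) := by
      intro j hj
      refine (hpair κ' m (m + 1) a x j hj ha (Nat.le_succ m) hx hκ' h1 h2).trans ?_
      have e : ρ m = 8 * ρ (m + 1) := by rw [hρs]; ring
      have hp := hρ0 (m + 1)
      rw [e]
      interval_cases j
      · norm_num; nlinarith [mul_nonneg hκ' (sq_nonneg (ρ (m + 1)))]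
      · norm_num; nlinarith [mul_nonneg hκ' hp.le]
      · norm_num; nlinarith
    refine (norm_iteratedFDeriv_mul_le (hχc m) ((hf (m + 1)).sub (hf m)) x
      (by exact_mod_cast hi)).trans ?_
    have hterm : ∀ j ∈ Finset.range (i + 1), (i.choose j : ℝ) * ‖iteratedFDeriv ℝ j (χ m) x‖ *
        ‖iteratedFDeriv ℝ (i - j) (fun y => f (m + 1) y - f m y) x‖ ≤
        (i.choose j : ℝ) * (65 * C * κ' * ρ (m + 1) ^ (2 - i)) := by
      intro j hj
      have hji : j ≤ i := Nat.lt_succ_iff.1 (Finset.mem_range.1 hj)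
      have hp := hρ0 (m + 1)
      have b1 := hχd m x j (hji.trans hi)
      have b2 := hD (i - j) (by omega)
      have e : C / ρ (m + 1) ^ j * (65 * κ' * ρ (m + 1) ^ (2 - (i - j))) =
          65 * C * κ' * ρ (m + 1) ^ (2 - i) := by
        rw [show 2 - (i - j) = (2 - i) + j by omega, pow_add]
        field_simp
      rw [mul_assoc, ← e]
      gcongr
    refine (Finset.sum_le_sum hterm).trans ?_
    rw [← Finset.sum_mul]
    have hch : (∑ j ∈ Finset.range (i + 1), (i.choose j : ℝ)) ≤ 4 := by
      have : (∑ j ∈ Finset.range (i + 1), i.choose j) ≤ 4 := by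
        rw [Nat.sum_range_choose]
        exact Nat.pow_le_pow_right (by norm_num) hi
      exact_mod_cast this
    have hp := hρ0 (m + 1)
    have := mul_le_mul_of_nonneg_right hch
      (by positivity : 0 ≤ 65 * C * κ' * ρ (m + 1) ^ (2 - i))
    linarith
  have hmain : ∀ κ' > 0, ∀ k, (∀ j ≥ k, Good K T (f j) κ' (ρ j)) → ∀ m ≥ k, ∀ x, ∀ i ≤ 2,
      ‖iteratedFDeriv ℝ i (fun y => w m y - w k y) x‖ ≤ (2 + 260 * C) * κ' * ρ k ^ (2 - i) := by
    intro κ' hκ' k hg m hm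
    induction m, hm using Nat.le_induction with
    | base =>
      intro x i hi
      have hp := hρ0 k
      have : iteratedFDeriv ℝ i (fun _ : E => (0 : ℝ)) x = 0 := by
        rw [show (fun _ : E => (0 : ℝ)) = 0 from rfl, iteratedFDeriv_zero]; rfl
      simp only [sub_self, this, norm_zero]
      positivity
    | succ m hkm ih =>
      intro x i hi
      by_cases hx : x ∈ cthickening (ρ (m + 1)) K
      · rw [hK.cthickening_eq_biUnion_closedBall (hρ0 _).le, mem_iUnion₂] at hx
        obtain ⟨a, ha, hxa⟩ := hx
        rw [mem_closedBall] at hxa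
        have hmt : x ∈ thickening (ρ m / 4) K := by
          rw [mem_thickening_iff]
          exact ⟨a, ha, hxa.trans_lt (by rw [hρs]; linarith [hρ0 m])⟩
        have hkt : x ∈ thickening (ρ k / 4) K := thickening_mono (by linarith [hρa hkm]) K hmt
        have hev : (fun y => w (m + 1) y - w k y) =ᶠ[𝓝 x]
            fun y => (f m y - f k y) + χ m y * (f (m + 1) y - f m y) := by
          filter_upwards [hwev m x hmt, hwev k x hkt] with y h1 h2
          rw [hws, h1, h2]; ring
        rw [(hev.iteratedFDeriv ℝ i).self_of_nhds]
        refine (norm_iteratedFDeriv_add_le ((hf m).sub (hf k)).contDiffAt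
          ((hχc m).mul ((hf _).sub (hf _))).contDiffAt hi).trans ?_
        have b1 := hpair κ' k m a x i hi ha hkm (hxa.trans (hρa (Nat.le_succ m))) hκ'.le
          (hg k le_rfl) (hg m hkm)
        have b2 := hprod κ' m a x i hi ha hxa hκ'.le (hg m hkm) (hg _ (hkm.trans (Nat.le_succ m)))
        have p1 : ρ m ^ (2 - i) ≤ ρ k ^ (2 - i) := pow_le_pow_left₀ (hρ0 m).le (hρa hkm) _
        have p2 : ρ (m + 1) ^ (2 - i) ≤ ρ k ^ (2 - i) :=
          pow_le_pow_left₀ (hρ0 _).le (hρa (hkm.trans (Nat.le_succ m))) _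
        have q1 := mul_le_mul_of_nonneg_left p1 hκ'.le
        have q2 := mul_le_mul_of_nonneg_left p2 (by positivity : 0 ≤ 260 * C * κ')
        linarith
      · have hev : (fun y => w (m + 1) y - w k y) =ᶠ[𝓝 x] fun y => w m y - w k y := by
          filter_upwards [isClosed_cthickening.isOpen_compl.mem_nhds hx] with y hy
          rw [hws, hχ0 m y fun h => hy (thickening_subset_cthickening _ _ h)]; ring
        rw [(hev.iteratedFDeriv ℝ i).self_of_nhds]
        exact ih x i hi
  set h : ℕ → E → ℝ := fun m y => w m y - w 0 y with hh
  have hw0 : w 0 = f 0 := by ext x; simp [hw]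
  obtain ⟨g, hg, φ, hφ, hglim, hgd⟩ := exists_contDiff_limit (h := h)
    (fun m => (hwc m).sub (hwc 0)) (by
      intro ε hε
      obtain ⟨N, hN⟩ := hlim (ε / (2 + 260 * C)) (by positivity)
      refine ⟨N, fun k hk m hm x i hi => ?_⟩
      have e : (fun y => h m y - h k y) = fun y => w m y - w k y := by ext y; simp [hh]
      rw [e]
      refine (hmain _ (by positivity) k (fun j hj => hN j (hk.le.trans hj)) m hm x i hi).trans ?_
      rw [mul_div_cancel₀ _ (by positivity)]
      exact mul_le_of_le_one_right hε.le (pow_le_one₀ (hρ0 k).le (hρ1 k)))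
  refine ⟨fun x => f 0 x + g x, (hf 0).add hg, fun x hx => ?_, fun x hx => ?_, fun x i hi => ?_⟩
  · have h1 : Tendsto (fun n => f 0 x + h (φ n) x) atTop (𝓝 (f 0 x + g x)) :=
      tendsto_const_nhds.add (hglim x)
    refine tendsto_nhds_unique h1 ?_
    have e : ∀ n, f 0 x + h (φ n) x = f (φ n) x := fun n => by
      have hxt : x ∈ thickening (ρ (φ n) / 4) K :=
        self_subset_thickening (by linarith [hρ0 (φ n)]) K hx
      simp only [hh, hw0, hwf _ x hxt]; ring
    simp only [e]
    rw [Metric.tendsto_atTop]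
    intro ε hε
    obtain ⟨N, hN⟩ := hlim (ε / 2) (by linarith)
    refine ⟨N, fun n hn => ?_⟩
    have := hN (φ n) (hn.le.trans hφ.le_apply) x hx x (by rw [dist_self]; exact (hρ0 _).le) 0
      (by norm_num)
    rw [norm_iteratedFDeriv_zero, Real.norm_eq_abs] at this
    rw [Real.dist_eq]
    have hp : ρ (φ n) ^ (2 - 0) ≤ 1 := pow_le_one₀ (hρ0 _).le (hρ1 _)
    calc |f (φ n) x - T x x| ≤ ε / 2 * ρ (φ n) ^ (2 - 0) := this
      _ ≤ ε / 2 * 1 := by gcongr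
      _ < ε := by linarith
  · have hz : ∀ m, h m x = 0 := fun m => by
      have hsum : ∑ j ∈ Finset.range m, χ j x * (f (j + 1) x - f j x) = 0 := by
        refine Finset.sum_eq_zero fun j _ => ?_
        have hle : ρ (j + 1) ≤ r / 8 := by
          have := hρa (Nat.zero_le j)
          rw [hρs]; simp only [hρ, pow_zero, mul_one] at this ⊢; linarith
        rw [hχ0 j x fun hmem => hx (thickening_mono hle K hmem), zero_mul]
      simp only [hh, hw, hsum]; simp
    have h1 := hglim x
    simp only [hz] at h1
    simp [tendsto_nhds_unique h1 tendsto_const_nhds]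
  · have e : (fun y => f 0 y + g y - f 0 y) = g := by ext y; ring
    rw [e]
    refine le_of_tendsto (hgd x i hi).norm (Eventually.of_forall fun n => ?_)
    have := hmain κ hκ 0 (fun j _ => hgood j) (φ n) (Nat.zero_le _) x i hi
    simpa [hρ] using this

end Whitney

section Foreground

variable {E : Type*} [NormedAddCommGroup E] [InnerProductSpace ℝ E] [FiniteDimensional ℝ E]
  [MeasurableSpace E] [BorelSpace E]

theorem norm_iteratedFDeriv_const_le (d : ℝ) (x : E) {r b : ℝ} (hr : 0 ≤ r) (hb : 0 ≤ b)
    (hd : |d| ≤ b * r ^ 2) (i : ℕ) : ‖iteratedFDeriv ℝ i (fun _ : E => d) x‖ ≤ b * r ^ (2 - i) := by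
  rcases Nat.eq_zero_or_pos i with rfl | hi
  · simpa [norm_iteratedFDeriv_zero] using hd
  · rw [iteratedFDeriv_const_of_ne hi.ne']
    simp only [Pi.zero_apply, norm_zero]
    positivity

theorem Good.mono {K : Set E} {T : E → E → ℝ} {f : E → ℝ} {κ κ' r : ℝ} (h : Good K T f κ r)
    (hr : 0 ≤ r) (hκ : κ ≤ κ') : Good K T f κ' r := fun a ha x hx i hi =>
  (h a ha x hx i hi).trans (mul_le_mul_of_nonneg_right hκ (by positivity))

theorem Good.sub_const {K : Set E} {T : E → E → ℝ} {f : E → ℝ} {κ κ' r d : ℝ}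
    (h : Good K T f κ r) (hf : ContDiff ℝ 2 f) (hT : ∀ a, ContDiff ℝ 2 (T a)) (hr : 0 ≤ r)
    (hκ : 0 ≤ κ') (hd : |d| ≤ κ' * r ^ 2) : Good K T (fun y => f y - d) (κ + κ') r := by
  intro a ha x hx i hi
  have e : (fun y => f y - d - T a y) = fun y => (f y - T a y) - d := by ext y; ring
  rw [e, add_mul]
  exact (norm_iteratedFDeriv_sub_le (hf.sub (hT a)).contDiffAt contDiffAt_const hi).trans
    (add_le_add (h a ha x hx i hi) (norm_iteratedFDeriv_const_le d x hr hκ hd i))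

theorem exists_good_mol {K : Set E} {g : E → ℝ} (hg : LocallyIntegrable g) {c : E → ℝ} {p : E → E}
    {A : E → E →L[ℝ] E} {M : ℝ} (hA : ∀ a ∈ K, ‖A a‖ ≤ M)
    (hT : ∀ ε > 0, ∃ δ > 0, ∀ a ∈ K, ∀ y, dist y a < δ →
      |g y - quad a (c a) (p a) (A a) y| ≤ ε * dist y a ^ 2) {κ : ℝ} (hκ : 0 < κ) :
    ∃ θ > 0, θ ≤ 1 ∧ ∃ R > 0, ∀ r, 0 < r → r ≤ R →
      Good K (fun a => quad a (c a) (p a) (A a)) (mol (θ * r) g) κ r := by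
  obtain ⟨C, hC1, hC⟩ := exists_norm_iteratedFDeriv_mol_le E
  have hM : 0 ≤ |M| := abs_nonneg M
  set θ : ℝ := min 1 (κ / (2 * (|M| + 1))) with hθ
  have hθ0 : 0 < θ := lt_min one_pos (by positivity)
  have hθ1 : θ ≤ 1 := min_le_left _ _
  have hθM : |M| * θ ^ 2 ≤ κ / 2 := by
    have h1 : θ * (2 * (|M| + 1)) ≤ κ := by
      rw [← le_div_iff₀ (by positivity)]; exact min_le_right _ _
    nlinarith [mul_nonneg hM hθ0.le]
  obtain ⟨δ, hδ, hδT⟩ := hT (κ * θ ^ 2 / (8 * C)) (by positivity)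
  refine ⟨θ, hθ0, hθ1, δ / 3, by positivity, fun r hr hrR a ha x hx i hi => ?_⟩
  have hs : 0 < θ * r := by positivity
  have hsr : θ * r ≤ r := mul_le_of_le_one_left hr.le hθ1
  set q := quad a (c a) (p a) (A a) with hq
  have hqc : ContDiff ℝ 2 q := contDiff_quad _ _ _ _
  have hql : LocallyIntegrable q := hqc.continuous.locallyIntegrable
  obtain ⟨d, hd, hmq⟩ := mol_quad (s := θ * r) a (c a) (p a) (A a)
  have hgq : LocallyIntegrable fun y => g y - q y := hg.sub hql
  have e : (fun y => mol (θ * r) g y - q y) = fun y => mol (θ * r) (fun z => g z - q z) y + d := by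
    ext y
    rw [mol_sub hs.ne' hg hql, hmq]; ring
  have hb : ∀ y ∈ closedBall x (θ * r), |g y - q y| ≤ κ * θ ^ 2 * r ^ 2 / (2 * C) := by
    intro y hy
    have hya : dist y a ≤ 2 * r := by
      have := dist_triangle y x a
      rw [mem_closedBall] at hy; linarith
    refine (hδT a ha y (by linarith)).trans ?_
    have : dist y a ^ 2 ≤ (2 * r) ^ 2 := pow_le_pow_left₀ dist_nonneg hya 2
    calc κ * θ ^ 2 / (8 * C) * dist y a ^ 2 ≤ κ * θ ^ 2 / (8 * C) * (2 * r) ^ 2 := by gcongr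
      _ = _ := by field_simp; ring
  have h1 := hC _ hgq x (θ * r) hs _ (by positivity) hb i hi
  have h2 : C * (κ * θ ^ 2 * r ^ 2 / (2 * C)) / (θ * r) ^ i ≤ κ / 2 * r ^ (2 - i) := by
    have e1 : C * (κ * θ ^ 2 * r ^ 2 / (2 * C)) / (θ * r) ^ i = κ / 2 * (θ * r) ^ (2 - i) := by
      have : (θ * r) ^ 2 = (θ * r) ^ (2 - i) * (θ * r) ^ i := by
        rw [← pow_add]; congr 1; omega
      have e2 : κ * θ ^ 2 * r ^ 2 = κ * ((θ * r) ^ (2 - i) * (θ * r) ^ i) := by rw [← this]; ring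
      rw [e2]; field_simp
    rw [e1]; gcongr
  have h3 : |d| ≤ κ / 2 * r ^ 2 := by
    refine hd.trans ?_
    have : ‖A a‖ ≤ |M| := (hA a ha).trans (le_abs_self M)
    calc ‖A a‖ * (θ * r) ^ 2 ≤ |M| * (θ * r) ^ 2 := by gcongr
      _ = |M| * θ ^ 2 * r ^ 2 := by ring
      _ ≤ _ := by gcongr
  change ‖iteratedFDeriv ℝ i (fun y => mol (θ * r) g y - q y) x‖ ≤ _
  have hmc : ContDiff ℝ 2 (mol (θ * r) fun z => g z - q z) := contDiff_mol hs.ne' hgq (n := 2)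
  rw [e]
  refine (norm_iteratedFDeriv_add_le hmc.contDiffAt contDiffAt_const hi).trans ?_
  have h4 := norm_iteratedFDeriv_const_le d x hr.le (by positivity) h3 i
  linarith

theorem exists_foreground {K Ω : Set E} (hK : IsCompact K) (hΩ : IsOpen Ω) (hKΩ : K ⊆ Ω)
    {u : E → ℝ} (hu : ContinuousOn u Ω) {p : E → E} {A : E → E →L[ℝ] E} {M : ℝ}
    (hA : ∀ a ∈ K, ‖A a‖ ≤ M)
    (hT : ∀ ε > 0, ∃ δ > 0, ∀ a ∈ K, ∀ y, dist y a < δ →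
      |u y - quad a (u a) (p a) (A a) y| ≤ ε * dist y a ^ 2) {l c : ℝ} (hl : 0 < l) (hc : 0 < c) :
    ∃ w : E → ℝ, ContDiff ℝ 2 w ∧ ∃ r > 0, ∃ b > 0, cthickening r K ⊆ Ω ∧ (∀ x ∈ K, w x = u x) ∧
      (∀ x ∈ thickening r K \ thickening (r / 8) K, w x + b ≤ u x) ∧
      (∀ x ∈ thickening r K, w x ≤ u x + c) ∧
      ∀ η, (∀ y ∈ Ω, StrongConvexAt η u y) → ∀ x ∈ thickening r K, StrongConvexAt (η - l) w x := by
  obtain ⟨B, hB1, hB⟩ := exists_whitney_extension E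
  obtain ⟨t, ht, htΩ⟩ := hK.exists_cthickening_subset_open hΩ hKΩ
  set K' := cthickening t K with hK'
  have hK'c : IsCompact K' := hK.cthickening
  set g : E → ℝ := K'.indicator u with hgdef
  have hg : LocallyIntegrable g := locallyIntegrable_indicator hK'c (hu.mono htΩ)
  have hgu : ∀ a ∈ K, ∀ y, dist y a ≤ t → g y = u y := fun a ha y hy =>
    indicator_of_mem (mem_cthickening_of_dist_le y a t K ha hy) u
  set T : E → E → ℝ := fun a => quad a (u a) (p a) (A a) with hTdef
  have hTc : ∀ a, ContDiff ℝ 2 (T a) := fun a => contDiff_quad _ _ _ _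
  have hgT : ∀ ε > 0, ∃ δ > 0, ∀ a ∈ K, ∀ y, dist y a < δ →
      |g y - quad a (u a) (p a) (A a) y| ≤ ε * dist y a ^ 2 := by
    intro ε hε
    obtain ⟨δ, hδ, h⟩ := hT ε hε
    refine ⟨min δ t, lt_min hδ ht, fun a ha y hy => ?_⟩
    rw [hgu a ha y (hy.le.trans (min_le_right _ _))]
    exact h a ha y (hy.trans_le (min_le_left _ _))
  set κ : ℝ := l / (4 * B) with hκdef
  have hκ : 0 < κ := by positivity
  choose θ hθ0 hθ1 R hR0 hR using fun n : ℕ =>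
    exists_good_mol (κ := κ / (n + 1)) hg hA hgT (by positivity)
  obtain ⟨δ, hδ, hδu⟩ := hT κ hκ
  obtain ⟨r, hr, hrR, hr1, hrt, hrδ, hrc⟩ : ∃ r > 0, r ≤ R 0 ∧ r ≤ 1 ∧ r < t / 2 ∧ r < δ ∧
      (4 * B + 5) * κ * r ≤ c := by
    refine ⟨min (min (R 0) 1) (min (t / 3) (min (δ / 2) (c / ((4 * B + 5) * κ)))), ?_, ?_, ?_, ?_,
      ?_, ?_⟩
    · have := hR0 0
      positivity
    · exact (min_le_left _ _).trans (min_le_left _ _)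
    · exact (min_le_left _ _).trans (min_le_right _ _)
    · exact ((min_le_right _ _).trans (min_le_left _ _)).trans_lt (by linarith)
    · exact ((min_le_right _ _).trans ((min_le_right _ _).trans (min_le_left _ _))).trans_lt
        (by linarith)
    · rw [← le_div_iff₀' (by positivity)]
      exact (min_le_right _ _).trans ((min_le_right _ _).trans (min_le_right _ _))
  set ρ : ℕ → ℝ := fun k => r * (1 / 8) ^ k with hρ
  have hρ0 : ∀ k, 0 < ρ k := fun k => by positivity
  have hρr : ∀ k, ρ k ≤ r := fun k =>
    mul_le_of_le_one_right hr.le (pow_le_one₀ (by norm_num) (by norm_num))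
  set ν : ℕ → ℕ := fun k => Nat.findGreatest (fun n => ρ k ≤ R n) k with hν
  have hν0 : ν 0 = 0 := by simp [hν]
  have hνR : ∀ k, ρ k ≤ R (ν k) := fun k =>
    Nat.findGreatest_spec (P := fun n => ρ k ≤ R n) (Nat.zero_le k) ((hρr k).trans hrR)
  set f : ℕ → E → ℝ := fun k x => mol (θ (ν k) * ρ k) g x - 3 * κ * ρ k ^ 2 / (ν k + 1) with hf
  have hs0 : ∀ k, 0 < θ (ν k) * ρ k := fun k => mul_pos (hθ0 _) (hρ0 k)
  have hmc : ∀ k, ContDiff ℝ 2 (mol (θ (ν k) * ρ k) g) := fun k =>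
    contDiff_mol (hs0 k).ne' hg (n := 2)
  have hfc : ∀ k, ContDiff ℝ 2 (f k) := fun k => (hmc k).sub contDiff_const
  have hmg : ∀ k, Good K T (mol (θ (ν k) * ρ k) g) (κ / (ν k + 1)) (ρ k) := fun k =>
    hR (ν k) (ρ k) (hρ0 k) (hνR k)
  have hfg : ∀ k, Good K T (f k) (4 * κ / (ν k + 1)) (ρ k) := fun k => by
    have h1 := (hmg k).sub_const (κ' := 3 * κ / (ν k + 1)) (d := 3 * κ * ρ k ^ 2 / (ν k + 1))
      (hmc k) hTc (hρ0 k).le (by positivity)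
      (by rw [abs_of_nonneg (by positivity)]; apply le_of_eq; ring)
    exact h1.mono (hρ0 k).le (le_of_eq (by ring))
  have hlim : ∀ κ' > 0, ∃ N, ∀ k ≥ N, Good K T (f k) κ' (ρ k) := by
    intro κ' hκ'
    obtain ⟨n, hn⟩ := exists_nat_gt (4 * κ / κ')
    have hev : ∀ᶠ k in atTop, ρ k ≤ R n := by
      have h0 : Tendsto ρ atTop (𝓝 (r * 0)) :=
        (tendsto_pow_atTop_nhds_zero_of_lt_one (by norm_num) (by norm_num)).const_mul r
      rw [mul_zero] at h0
      exact h0.eventually (ge_mem_nhds (hR0 n))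
    obtain ⟨N, hN⟩ := eventually_atTop.1 (hev.and (eventually_ge_atTop n))
    refine ⟨N, fun k hk => (hfg k).mono (hρ0 k).le ?_⟩
    have hnk : n ≤ ν k := Nat.le_findGreatest (hN k hk).2 (hN k hk).1
    have hnk' : (n : ℝ) ≤ ν k := by exact_mod_cast hnk
    rw [div_lt_iff₀ hκ'] at hn
    rw [div_le_iff₀ (by positivity)]
    nlinarith
  obtain ⟨w, hwc, hwK, hwf, hwd⟩ := hB K hK T hTc f hfc r hr hr1 (4 * κ) (by positivity)
    (fun k => (hfg k).mono (hρ0 k).le (div_le_self (by positivity) (by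
      have : (0 : ℝ) ≤ ν k := by positivity
      linarith))) hlim
  have hρz : ρ 0 = r := by simp [hρ]
  have hf0 : ∀ x, f 0 x = mol (θ 0 * r) g x - 3 * κ * r ^ 2 := fun x => by
    simp [hf, hν0, hρz]
  have hmu : ∀ x ∈ thickening r K, |mol (θ 0 * r) g x - u x| ≤ 2 * κ * r ^ 2 := by
    intro x hx
    obtain ⟨a, ha, hxa⟩ := mem_thickening_iff.1 hx
    have h1 := hmg 0 a ha x (by rw [hρz]; exact hxa.le) 0 (by norm_num)
    rw [norm_iteratedFDeriv_zero, Real.norm_eq_abs, hν0, hρz] at h1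
    simp only [Nat.cast_zero, zero_add, div_one, Nat.sub_zero] at h1
    have h2 := hδu a ha x (hxa.trans hrδ)
    have h3 : κ * dist x a ^ 2 ≤ κ * r ^ 2 := by gcongr
    have h4 := abs_sub_le (mol (θ 0 * r) g x) (T a x) (u x)
    rw [abs_sub_comm (T a x)] at h4
    linarith
  refine ⟨w, hwc, r, hr, κ * r ^ 2, by positivity,
    (cthickening_mono (by linarith) K).trans htΩ, fun x hx => ?_, fun x hx => ?_, fun x hx => ?_,
    fun η hη x hx => ?_⟩
  · rw [hwK x hx]; simp [hTdef, quad]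
  · rw [hwf x hx.2, hf0]
    have := abs_le.1 (hmu x hx.1)
    linarith
  · have h1 := hwd x 0 (by norm_num)
    rw [norm_iteratedFDeriv_zero, Real.norm_eq_abs, hf0] at h1
    simp only [Nat.sub_zero] at h1
    have h2 := (abs_le.1 (hmu x hx)).2
    have h3 := (abs_le.1 h1).2
    have h4 : (4 * B + 5) * κ * r ^ 2 ≤ (4 * B + 5) * κ * r := by
      have : r ^ 2 ≤ r := by nlinarith
      gcongr
    nlinarith [mul_nonneg hκ.le (sq_nonneg r)]
  · obtain ⟨a, ha, hxa⟩ := mem_thickening_iff.1 hx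
    have hbt : ∀ y ∈ ball x (t / 2), dist y a ≤ t := fun y hy => by
      have := dist_triangle y x a
      rw [mem_ball] at hy; linarith
    have hsc : StrongConvexAt η (mol (θ 0 * r) g) x := by
      refine strongConvexAt_mol (t := t / 2) (f := u) (mul_pos (hθ0 0) hr)
        ((mul_le_of_le_one_left hr.le (hθ1 0)).trans_lt hrt) hg
        (fun y hy => (hgu a ha y (hbt y hy)).symm) fun y hy => hη y
          (htΩ (mem_cthickening_of_dist_le y a t K ha (hbt y hy)))
    have h1 := hsc.add_contDiffAt (h := fun y => w y - mol (θ 0 * r) g y) (l := l) univ_mem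
      (fun y _ => (hwc.sub (by simpa [hν0, hρz] using hmc 0)).contDiffAt) (fun y _ => by
        have e : (fun y => w y - mol (θ 0 * r) g y) = fun y => (w y - f 0 y) - 3 * κ * r ^ 2 := by
          ext y; rw [hf0]; ring
        rw [e]
        refine (norm_iteratedFDeriv_sub_le (hwc.sub (hfc 0)).contDiffAt contDiffAt_const
          le_rfl).trans ?_
        rw [iteratedFDeriv_const_of_ne two_ne_zero]
        refine (add_le_add (hwd y 2 le_rfl) le_rfl).trans (le_of_eq ?_)
        simp [hκdef]; field_simp)
    refine h1.congr (Eventually.of_forall fun y => by ring)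
end Foreground

section Alexandrov

variable {E : Type*} [NormedAddCommGroup E] [InnerProductSpace ℝ E] [FiniteDimensional ℝ E]
  [MeasurableSpace E] [BorelSpace E]

theorem exists_subgradient {s : Set E} (hs : IsOpen s) {u : E → ℝ} (hu : ConvexOn ℝ s u) {x : E}
    (hx : x ∈ s) : ∃ p : E, ∀ y ∈ s, u x + inner ℝ p (y - x) ≤ u y := by
  have hc : ContinuousOn u s := hu.continuousOn hs
  have hopen : IsOpen {q : E × ℝ | q.1 ∈ s ∧ u q.1 < q.2} := by
    have h1 : ContinuousOn (fun q : E × ℝ => q.2 - u q.1) (Prod.fst ⁻¹' s) :=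
      continuous_snd.continuousOn.sub (hc.comp continuous_fst.continuousOn fun _ h => h)
    have h2 := h1.isOpen_inter_preimage (hs.preimage continuous_fst) (isOpen_Ioi (a := (0 : ℝ)))
    convert h2 using 1
    ext q
    simp
  obtain ⟨f, hf⟩ := geometric_hahn_banach_point_open (x := (x, u x)) hu.convex_strict_epigraph hopen
    (fun h => lt_irrefl _ h.2)
  set φ : E →L[ℝ] ℝ := f.comp (ContinuousLinearMap.inl ℝ E ℝ) with hφ
  set b : ℝ := f (0, 1) with hb
  have hfe : ∀ y t, f (y, t) = φ y + t * b := fun y t => by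
    have : (y, t) = (y, (0 : ℝ)) + t • ((0 : E), (1 : ℝ)) := by simp
    rw [this, map_add, map_smul]; simp [hφ, hb]
  have hb0 : 0 < b := by
    have := hf (x, u x + 1) ⟨hx, by simp⟩
    rw [hfe, hfe] at this; linarith
  refine ⟨-(b⁻¹ • (InnerProductSpace.toDual ℝ E).symm φ), fun y hy => ?_⟩
  have h1 : φ x + u x * b ≤ φ y + u y * b := by
    refine le_of_forall_pos_lt_add fun ε hε => ?_
    have := hf (y, u y + ε / b) ⟨hy, by simp; positivity⟩
    rw [hfe, hfe, add_mul, div_mul_cancel₀ _ hb0.ne'] at this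
    linarith
  rw [inner_neg_left, real_inner_smul_left, InnerProductSpace.toDual_symm_apply, map_sub]
  have : b * (b⁻¹ * (φ y - φ x)) = φ y - φ x := by field_simp
  nlinarith

/-- `G p` minimises `u - ⟪p, ·⟫` over `B`, with quadratic growth of rate `c`. -/
def IsArgmin (u : E → ℝ) (B : Set E) (c : ℝ) (G : E → E) : Prop :=
  ∀ p, G p ∈ B ∧ ∀ y ∈ B, u (G p) + inner ℝ p (y - G p) + c * ‖y - G p‖ ^ 2 ≤ u y

variable {u : E → ℝ} {B : Set E} {c : ℝ} {G : E → E}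

theorem IsArgmin.monotone (hG : IsArgmin u B c G) (p q : E) :
    2 * c * ‖G p - G q‖ ^ 2 ≤ inner ℝ (p - q) (G p - G q) := by
  have h1 := (hG p).2 _ (hG q).1
  have h2 := (hG q).2 _ (hG p).1
  rw [norm_sub_rev] at h1
  rw [← neg_sub (G p), inner_neg_right] at h1
  rw [inner_sub_left]
  linarith

theorem IsArgmin.norm_sub_le (hG : IsArgmin u B c G) (hc : 0 < c) (p q : E) :
    ‖G p - G q‖ ≤ (2 * c)⁻¹ * ‖p - q‖ := by
  have h1 := (hG.monotone p q).trans (real_inner_le_norm _ _)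
  rw [inv_mul_eq_div, le_div_iff₀ (by positivity)]
  rcases (norm_nonneg (G p - G q)).eq_or_lt with h | h
  · rw [← h]; simp
  · nlinarith

/-- The Legendre transform attached to the minimiser map `G`. -/
def conj (u : E → ℝ) (G : E → E) (p : E) : ℝ := inner ℝ p (G p) - u (G p)

theorem IsArgmin.inner_sub_conj_le (hG : IsArgmin u B c G) (hc : 0 < c) (p : E) {y : E}
    (hy : y ∈ B) : inner ℝ p y - conj u G p ≤ u y := by
  have := (hG p).2 y hy
  rw [inner_sub_right] at this
  unfold conj
  nlinarith [sq_nonneg ‖y - G p‖]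

theorem IsArgmin.hasFDerivAt_conj (hG : IsArgmin u B c G) (hc : 0 < c) (p : E) :
    HasFDerivAt (conj u G) (innerSL ℝ (G p)) p := by
  refine HasFDerivAt.of_isLittleO ?_
  have hO : (fun q => conj u G q - conj u G p - innerSL ℝ (G p) (q - p)) =O[𝓝 p]
      fun q => ‖q - p‖ ^ 2 := by
    refine Asymptotics.IsBigO.of_bound (2 * c)⁻¹ (Eventually.of_forall fun q => ?_)
    have h1 := hG.inner_sub_conj_le hc q (hG p).1
    have h2 := hG.inner_sub_conj_le hc p (hG q).1
    have h3 := hG.norm_sub_le hc q p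
    have h4 := real_inner_le_norm (G q - G p) (q - p)
    have h5 : ‖G q - G p‖ * ‖q - p‖ ≤ (2 * c)⁻¹ * ‖q - p‖ * ‖q - p‖ := by gcongr
    have e1 : inner ℝ (G q - G p) (q - p) =
        inner ℝ q (G q) - inner ℝ p (G q) - inner ℝ (G p) (q - p) := by
      rw [inner_sub_left, inner_sub_right (G q), real_inner_comm q, real_inner_comm p]
    have e2 : inner ℝ (G p) (q - p) = inner ℝ q (G p) - inner ℝ p (G p) := by
      rw [inner_sub_right, real_inner_comm q, real_inner_comm p]
    rw [innerSL_apply_apply, Real.norm_eq_abs, norm_pow, norm_norm, abs_of_nonneg]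
    · unfold conj at *
      nlinarith
    · unfold conj at *
      nlinarith
  refine hO.trans_isLittleO ?_
  have := (Asymptotics.isLittleO_pow_sub_sub p (one_lt_two))
  exact this

theorem IsArgmin.conj_taylor (hG : IsArgmin u B c G) (hc : 0 < c) {p : E} {Q : E →L[ℝ] E}
    {δ ε : ℝ} (h : ∀ k, ‖k‖ ≤ δ → ‖G (p + k) - G p - Q k‖ ≤ ε * ‖k‖) (hε : 0 ≤ ε) {k : E}
    (hk : ‖k‖ ≤ δ) :
    |conj u G (p + k) - conj u G p - inner ℝ (G p) k - 1 / 2 * inner ℝ (Q k) k| ≤ ε * ‖k‖ ^ 2 := by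
  set φ : ℝ → ℝ := fun t => conj u G (p + t • k) - t * inner ℝ (G p) k -
    t ^ 2 / 2 * inner ℝ (Q k) k with hφ
  have hd : ∀ t, HasDerivAt φ (inner ℝ (G (p + t • k) - G p - Q (t • k)) k) t := by
    intro t
    have h1 : HasDerivAt (fun t : ℝ => p + t • k) k t := by
      simpa using ((hasDerivAt_id t).smul_const k).const_add p
    have h2 := (hG.hasFDerivAt_conj hc (p + t • k)).comp_hasDerivAt t h1
    have h3 := (h2.sub ((hasDerivAt_id t).mul_const (inner ℝ (G p) k))).sub
      (((hasDerivAt_id t).pow 2).div_const 2 |>.mul_const (inner ℝ (Q k) k))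
    refine (HasDerivAt.congr_deriv (f := φ) h3 ?_)
    simp only [innerSL_apply_apply, inner_sub_left, map_smul, real_inner_smul_left, id]
    ring
  have h1 := norm_image_sub_le_of_norm_deriv_le_segment_01' (f := φ)
    (C := ε * ‖k‖ ^ 2) (fun t _ => (hd t).hasDerivWithinAt) (fun t ht => by
      have ht' : ‖t • k‖ ≤ ‖k‖ := by
        rw [norm_smul, Real.norm_eq_abs, abs_of_nonneg ht.1]
        exact mul_le_of_le_one_left (norm_nonneg _) ht.2.le
      refine (norm_inner_le_norm _ _).trans ?_
      calc _ ≤ ε * ‖t • k‖ * ‖k‖ := by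
            gcongr; exact h _ (ht'.trans hk)
        _ ≤ ε * ‖k‖ * ‖k‖ := by gcongr
        _ = _ := by ring)
  rw [Real.norm_eq_abs] at h1
  convert h1 using 2
  simp [hφ]; ring

/-- `u` has a second order Taylor expansion at `x`. -/
def HasTaylor (u : E → ℝ) (x : E) : Prop :=
  ∃ (p : E) (A : E →L[ℝ] E), ∀ ε > 0, ∃ δ > 0, ∀ y, dist y x < δ →
    |u y - quad x (u x) p A y| ≤ ε * dist y x ^ 2

theorem IsArgmin.hasTaylor (hG : IsArgmin u B c G) (hc : 0 < c) {p : E} {Q : E →L[ℝ] E}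
    (hQ : HasFDerivAt G Q p) (hdet : Q.det ≠ 0) (hB : B ∈ 𝓝 (G p)) (hr : range G ∈ 𝓝 (G p)) :
    HasTaylor u (G p) := by
  set x := G p with hx
  obtain ⟨S, hSQ, hQS⟩ : ∃ S : E →L[ℝ] E, (∀ k, S (Q k) = k) ∧ ∀ k, Q (S k) = k :=
    ⟨((Q.toContinuousLinearEquivOfDetNeZero hdet).symm : E →L[ℝ] E),
      (Q.toContinuousLinearEquivOfDetNeZero hdet).symm_apply_apply,
      (Q.toContinuousLinearEquivOfDetNeZero hdet).apply_symm_apply⟩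
  obtain ⟨N, hN0, hSN⟩ : ∃ N : ℝ, 0 < N ∧ ∀ k, ‖S k‖ ≤ N * ‖k‖ :=
    ⟨‖S‖ + 1, by positivity, fun k => (S.le_opNorm k).trans (by gcongr; linarith)⟩
  have hQk : ∀ ε > 0, ∃ δ > 0, ∀ k, ‖k‖ ≤ δ → ‖G (p + k) - x - Q k‖ ≤ ε * ‖k‖ := by
    intro ε hε
    have h1 := (hasFDerivAt_iff_isLittleO_nhds_zero.1 hQ).def hε
    obtain ⟨δ, hδ, h⟩ := Metric.eventually_nhds_iff.1 h1
    refine ⟨δ / 2, by linarith, fun k hk => h (by rw [dist_zero_right]; linarith)⟩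
  obtain ⟨τ, hτ, hQτ⟩ := hQk (1 / (2 * N)) (by positivity)
  obtain ⟨a, ha⟩ : ∃ a : ℝ, a = c / (2 * N ^ 2) := ⟨_, rfl⟩
  have ha0 : 0 < a := by rw [ha]; positivity
  have hinj : ∀ k s, 0 < s → s ≤ 1 → s * ‖k‖ ≤ τ → a * (s * ‖k‖) ≤ ‖G (p + k) - x‖ := by
    intro k s hs hs1 hsk
    rcases (norm_nonneg k).eq_or_lt with hk0 | hk0
    · rw [← hk0]; simp
    have hn : ‖s • k‖ = s * ‖k‖ := by rw [norm_smul, Real.norm_eq_abs, abs_of_pos hs]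
    have h1 : 0 ≤ inner ℝ ((1 - s) • k) (G (p + k) - G (p + s • k)) := by
      have := hG.monotone (p + k) (p + s • k)
      have e : p + k - (p + s • k) = (1 - s) • k := by rw [sub_smul, one_smul]; abel
      rw [e] at this
      exact le_trans (by positivity) this
    have h2 : inner ℝ k (G (p + s • k) - x) ≤ inner ℝ k (G (p + k) - x) := by
      rcases hs1.eq_or_lt with h | h
      · rw [h, one_smul]
      · rw [real_inner_smul_left] at h1
        have := (mul_nonneg_iff_of_pos_left (by linarith)).1 h1
        have e : G (p + k) - G (p + s • k) = (G (p + k) - x) - (G (p + s • k) - x) := by abel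
        rw [e, inner_sub_right] at this
        linarith
    have h3 := hG.monotone (p + s • k) p
    rw [add_sub_cancel_left, real_inner_smul_left, ← hx] at h3
    have h4 : s * ‖k‖ / (2 * N) ≤ ‖G (p + s • k) - x‖ := by
      have h5 := hQτ (s • k) (hn.trans_le hsk)
      have h6 := hSN (Q (s • k))
      rw [hSQ] at h6
      have h7 : ‖Q (s • k)‖ ≤ ‖G (p + s • k) - x‖ + ‖G (p + s • k) - x - Q (s • k)‖ := by
        have := _root_.norm_sub_le (G (p + s • k) - x) (G (p + s • k) - x - Q (s • k))
        rwa [sub_sub_cancel] at this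
      have h8 : ‖s • k‖ / N ≤ ‖Q (s • k)‖ := by rw [div_le_iff₀ hN0]; linarith
      rw [hn] at h5 h8
      have e : s * ‖k‖ / N = s * ‖k‖ / (2 * N) + 1 / (2 * N) * (s * ‖k‖) := by field_simp; ring
      linarith
    have h9 : (s * ‖k‖ / (2 * N)) ^ 2 ≤ ‖G (p + s • k) - x‖ ^ 2 := by gcongr
    have h10 := real_inner_le_norm k (G (p + k) - x)
    have h11 : 2 * c * (s * ‖k‖ / (2 * N)) ^ 2 ≤ s * (‖k‖ * ‖G (p + k) - x‖) := by
      calc _ ≤ 2 * c * ‖G (p + s • k) - x‖ ^ 2 := by gcongr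
        _ ≤ _ := h3
        _ ≤ _ := by gcongr; linarith
    have e : 2 * c * (s * ‖k‖ / (2 * N)) ^ 2 = (s * ‖k‖) * (a * (s * ‖k‖)) := by
      rw [ha]; field_simp
    rw [e, ← mul_assoc s] at h11
    exact le_of_mul_le_mul_left h11 (mul_pos hs hk0)
  refine ⟨p, (1 / 2 : ℝ) • S, fun ε hε => ?_⟩
  obtain ⟨D, hD⟩ : ∃ D : ℝ, D = N ^ 2 + 2 / a ^ 2 + N / a := ⟨_, rfl⟩
  have hD0 : 0 < D := by rw [hD]; positivity
  obtain ⟨δ', hδ', hQδ'⟩ := hQk (ε / D) (by positivity)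
  obtain ⟨δ₁, hδ₁⟩ : ∃ δ₁ : ℝ, δ₁ = min τ δ' := ⟨_, rfl⟩
  have hδ₁0 : 0 < δ₁ := hδ₁ ▸ lt_min hτ hδ'
  have hQδ : ∀ k, ‖k‖ ≤ δ₁ → ‖G (p + k) - x - Q k‖ ≤ ε / D * ‖k‖ := fun k hk =>
    hQδ' k (hk.trans (hδ₁ ▸ min_le_right _ _))
  obtain ⟨δ₂, hδ₂, hb⟩ := Metric.mem_nhds_iff.1 (inter_mem hB hr)
  refine ⟨min δ₂ (min (a * δ₁) (δ₁ / N)), by positivity, fun y hy => ?_⟩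
  obtain ⟨hyB, q, hq⟩ := hb (hy.trans_le (min_le_left _ _))
  set h := y - x with hh
  have hyx : dist y x = ‖h‖ := dist_eq_norm _ _
  rw [hyx] at hy ⊢
  set k := q - p with hk
  have hpk : p + k = q := by rw [hk]; abel
  have hGk : G (p + k) - x = h := by rw [hpk, hq]
  have hkδ : ‖k‖ ≤ δ₁ := by
    by_contra! hlt
    have hk0 : 0 < ‖k‖ := hδ₁0.trans hlt
    have := hinj k (δ₁ / ‖k‖) (by positivity) ((div_le_one hk0).2 hlt.le)
      (by rw [div_mul_cancel₀ _ hk0.ne', hδ₁]; exact min_le_left _ _)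
    rw [div_mul_cancel₀ _ hk0.ne', hGk] at this
    exact absurd (hy.trans_le ((min_le_right _ _).trans (min_le_left _ _))) (not_lt.2 this)
  have hkh : ‖k‖ ≤ ‖h‖ / a := by
    have := hinj k 1 one_pos le_rfl (by rw [one_mul]; exact hkδ.trans (hδ₁ ▸ min_le_left _ _))
    rw [one_mul, hGk] at this
    rw [le_div_iff₀ ha0]; linarith
  have hε1 : 0 ≤ ε / D := by positivity
  have hx0 : conj u G p = inner ℝ p x - u x := rfl
  have hyh : y = x + h := by rw [hh]; abel
  have hq0 : quad x (u x) p ((1 / 2 : ℝ) • S) y = u x + inner ℝ p h + 1 / 2 * inner ℝ (S h) h := by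
    simp only [quad, ← hh, smul_apply, real_inner_smul_left]
  rw [hq0, abs_le]
  constructor
  · have hSh : ‖S h‖ ≤ δ₁ := by
      refine (hSN h).trans ?_
      have : ‖h‖ < δ₁ / N := hy.trans_le ((min_le_right _ _).trans (min_le_right _ _))
      rw [lt_div_iff₀ hN0] at this
      linarith
    have h1 := hG.conj_taylor hc hQδ hε1 hSh
    rw [hQS] at h1
    have h2 := hG.inner_sub_conj_le hc (p + S h) hyB
    rw [hyh, inner_add_left, inner_add_right, inner_add_right, ← hyh] at h2
    have h3 := (abs_le.1 h1).2
    have h4 : ε / D * ‖S h‖ ^ 2 ≤ ε * ‖h‖ ^ 2 := by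
      have h5 : ‖S h‖ ^ 2 ≤ N ^ 2 * ‖h‖ ^ 2 := by rw [← mul_pow]; gcongr; exact hSN h
      have h6 : ε / D * N ^ 2 ≤ ε := by
        rw [div_mul_eq_mul_div, div_le_iff₀ hD0]
        have : 0 ≤ 2 / a ^ 2 + N / a := by positivity
        nlinarith
      calc ε / D * ‖S h‖ ^ 2 ≤ ε / D * (N ^ 2 * ‖h‖ ^ 2) := by gcongr
        _ = ε / D * N ^ 2 * ‖h‖ ^ 2 := by ring
        _ ≤ _ := by gcongr
    have e1 : inner ℝ (S h) x = inner ℝ x (S h) := real_inner_comm _ _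
    have e2 : inner ℝ (S h) h = inner ℝ h (S h) := real_inner_comm _ _
    rw [hx0, ← hx] at h3
    linarith
  · have h1 := hG.conj_taylor hc hQδ hε1 hkδ
    have h2 := hQδ k hkδ
    rw [hGk] at h2
    have h3 : conj u G (p + k) = inner ℝ (p + k) y - u y := by rw [hpk, conj, hq]
    rw [h3, hx0, ← hx, inner_add_left, hyh, inner_add_right, inner_add_right, ← hyh] at h1
    have h4 := (abs_le.1 h1).1
    set e := h - Q k with he
    have hSh : S h = k + S e := by
      have := S.map_sub h (Q k)
      rw [hSQ, ← he] at this
      rw [this]; abel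
    have e1 : inner ℝ (Q k) k = inner ℝ k h - inner ℝ k e := by
      rw [← inner_sub_right, he, sub_sub_cancel, real_inner_comm]
    have e2 : inner ℝ (S h) h = inner ℝ k h + inner ℝ (S e) h := by rw [hSh, inner_add_left]
    have e3 : inner ℝ k x = inner ℝ x k := real_inner_comm _ _
    have b1 : inner ℝ k e ≤ ε / D * ‖k‖ ^ 2 :=
      (real_inner_le_norm _ _).trans (by nlinarith [norm_nonneg k])
    have b2 : -inner ℝ (S e) h ≤ N * (ε / D * ‖k‖) * ‖h‖ := by
      refine (neg_le_abs _).trans ((abs_real_inner_le_norm _ _).trans ?_)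
      gcongr
      exact (hSN e).trans (by gcongr)
    have b3 : ‖k‖ ^ 2 ≤ ‖h‖ ^ 2 / a ^ 2 := by rw [← div_pow]; gcongr
    have b4 : ε / D * ‖k‖ ^ 2 ≤ ε / D * (‖h‖ ^ 2 / a ^ 2) := by gcongr
    have b5 : N * (ε / D * ‖k‖) * ‖h‖ ≤ N * (ε / D * (‖h‖ / a)) * ‖h‖ := by gcongr
    have b6 : ε * ‖h‖ ^ 2 = ε / D * (N ^ 2 * ‖h‖ ^ 2) + 2 * (ε / D * (‖h‖ ^ 2 / a ^ 2)) +
        N * (ε / D * (‖h‖ / a)) * ‖h‖ := by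
      have : ε * ‖h‖ ^ 2 = ε / D * D * ‖h‖ ^ 2 := by rw [div_mul_cancel₀ _ hD0.ne']
      rw [this]; nth_rewrite 2 [hD]; ring
    have p1 : 0 ≤ ε / D * (N ^ 2 * ‖h‖ ^ 2) := by positivity
    have p2 : 0 ≤ ε / D * (‖h‖ ^ 2 / a ^ 2) := by positivity
    have p3 : 0 ≤ N * (ε / D * (‖h‖ / a)) * ‖h‖ := by positivity
    linarith

theorem exists_isArgmin {x₀ : E} {r R η : ℝ} (hr : 0 < r) (hrR : r < R) (hη : 0 < η)
    (hu : StrongConvexOn (ball x₀ R) η u) :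
    ∃ G, IsArgmin u (closedBall x₀ r) (η / 4) G ∧ ball x₀ r ⊆ range G := by
  have hcv : ConvexOn ℝ (ball x₀ R) u := strongConvexOn_zero.1 (_root_.StrongConvexOn.mono hη.le hu)
  have hsub : closedBall x₀ r ⊆ ball x₀ R := closedBall_subset_ball hrR
  have hcont : ContinuousOn u (closedBall x₀ r) := (hcv.continuousOn isOpen_ball).mono hsub
  have hex : ∀ p, ∃ x ∈ closedBall x₀ r, ∀ y ∈ closedBall x₀ r,
      u x - inner ℝ p x ≤ u y - inner ℝ p y := fun p => by
    obtain ⟨x, hx, hm⟩ := (isCompact_closedBall x₀ r).exists_isMinOn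
      (nonempty_closedBall.2 hr.le)
      (hcont.sub (by fun_prop : ContinuousOn (fun y => inner ℝ p y) _))
    exact ⟨x, hx, fun y hy => hm hy⟩
  have hgrow : ∀ p, ∀ x ∈ closedBall x₀ r, (∀ y ∈ closedBall x₀ r,
      u x - inner ℝ p x ≤ u y - inner ℝ p y) → ∀ y ∈ closedBall x₀ r,
      u x + inner ℝ p (y - x) + η / 4 * ‖y - x‖ ^ 2 ≤ u y := by
    intro p x hx hm y hy
    have h0 := hu.2
    have h1 := h0 (hsub hx) (hsub hy) (a := 1 / 2) (b := 1 / 2) (by norm_num) (by norm_num)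
      (by norm_num)
    have hcb := convex_closedBall x₀ r hx hy
    have h2 := hm _ (hcb (a := 1 / 2) (b := 1 / 2) (by norm_num)
      (by norm_num) (by norm_num))
    simp only [smul_eq_mul, inner_add_right, real_inner_smul_right] at h1 h2
    rw [inner_sub_right, norm_sub_rev]
    linarith
  choose G hGm hG using hex
  refine ⟨G, fun p => ⟨hGm p, hgrow p _ (hGm p) (hG p)⟩, fun x hx => ?_⟩
  obtain ⟨p, hp⟩ := exists_subgradient isOpen_ball hcv (ball_subset_ball hrR.le hx)
  refine ⟨p, ?_⟩
  have h1 := hgrow p _ (hGm p) (hG p) x (ball_subset_closedBall hx)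
  have h2 := hp _ (hsub (hGm p))
  rw [← neg_sub, inner_neg_right] at h2
  have h3 : ‖x - G p‖ ^ 2 ≤ 0 := by
    by_contra! h
    nlinarith
  have h4 := pow_eq_zero_iff two_ne_zero |>.1 (le_antisymm h3 (sq_nonneg _))
  exact (sub_eq_zero.1 (norm_eq_zero.1 h4)).symm

theorem ae_hasTaylor_ball {x₀ : E} {r R η : ℝ} (hr : 0 < r) (hrR : r < R) (hη : 0 < η)
    (hu : StrongConvexOn (ball x₀ R) η u) :
    volume {x ∈ ball x₀ r | ¬ HasTaylor u x} = 0 := by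
  obtain ⟨G, hG, hGr⟩ := exists_isArgmin hr hrR hη hu
  have hc : 0 < η / 4 := by positivity
  have hL : LipschitzWith (Real.toNNReal (2 * (η / 4))⁻¹) G :=
    LipschitzWith.of_dist_le_mul fun p q => by
      rw [dist_eq_norm, dist_eq_norm, Real.coe_toNNReal _ (by positivity)]
      exact hG.norm_sub_le hc p q
  have hnull : ∀ s : Set E, volume s = 0 → volume (G '' s) = 0 := by
    intro s hs
    set μ : Measure E := μH[Module.finrank ℝ E] with hμ
    have h1 : μ ≪ (volume : Measure E) := Measure.absolutelyContinuous_isAddHaarMeasure μ volume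
    have h2 : (volume : Measure E) ≪ μ := Measure.absolutelyContinuous_isAddHaarMeasure volume μ
    refine h2 ?_
    have h3 := hL.hausdorffMeasure_image_le (d := Module.finrank ℝ E) (by positivity) s
    rw [← hμ, h1 hs, mul_zero] at h3
    exact le_antisymm h3 zero_le
  set N₁ : Set E := {p | ¬ DifferentiableAt ℝ G p}
  set N₂ : Set E := {p | DifferentiableAt ℝ G p ∧ (fderiv ℝ G p).det = 0}
  have h1 : volume (G '' N₁) = 0 := hnull _ hL.ae_differentiableAt
  have h2 : volume (G '' N₂) = 0 :=
    addHaar_image_eq_zero_of_det_fderivWithin_eq_zero volume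
      (fun p hp => hp.1.hasFDerivAt.hasFDerivWithinAt) fun p hp => hp.2
  refine measure_mono_null ?_ (measure_union_null h1 h2)
  rintro x ⟨hx, hnt⟩
  obtain ⟨p, rfl⟩ := hGr hx
  by_cases hd : DifferentiableAt ℝ G p
  · refine Or.inr ⟨p, ⟨hd, by_contra fun hdet => hnt ?_⟩, rfl⟩
    exact hG.hasTaylor hc hd.hasFDerivAt hdet
      (mem_of_superset (isOpen_ball.mem_nhds hx) ball_subset_closedBall)
      (mem_of_superset (isOpen_ball.mem_nhds hx) hGr)
  · exact Or.inl ⟨p, hd, rfl⟩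

theorem LocStrongConvex.ae_hasTaylor {U : Set E} (hu : LocStrongConvex U u) :
    volume {x ∈ U | ¬ HasTaylor u x} = 0 := by
  refine measure_null_of_locally_null _ fun x hx => ?_
  obtain ⟨η, hη, R, hR, h⟩ := hu x hx.1
  refine ⟨_, ?_, ae_hasTaylor_ball (half_pos hR) (half_lt_self hR) hη h⟩
  filter_upwards [self_mem_nhdsWithin, mem_nhdsWithin_of_mem_nhds (ball_mem_nhds x (half_pos hR))]
    with y hy hyb using ⟨hyb, hy.2⟩

end Alexandrov

section Egorov

variable {E : Type*} [NormedAddCommGroup E] [InnerProductSpace ℝ E] [FiniteDimensional ℝ E]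
  [MeasurableSpace E] [BorelSpace E]

/-- The points of `C` where `u` is within `ε` of a quadratic polynomial with coefficients bounded
by `M`, at scale `δ`. -/
def taylorSet (u : E → ℝ) (C : Set E) (M ε δ : ℝ) : Set E :=
  {x ∈ C | ∃ (p : E) (A : E →L[ℝ] E), ‖p‖ ≤ M ∧ ‖A‖ ≤ M ∧ ∀ y, dist y x < δ →
    |u y - quad x (u x) p A y| ≤ ε * dist y x ^ 2}

theorem taylorSet_mono {u : E → ℝ} {C : Set E} {M M' ε δ δ' : ℝ} (hM : M ≤ M') (hδ : δ' ≤ δ) :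
    taylorSet u C M ε δ ⊆ taylorSet u C M' ε δ' := fun _ ⟨hx, p, A, hp, hA, h⟩ =>
  ⟨hx, p, A, hp.trans hM, hA.trans hM, fun y hy => h y (hy.trans_le hδ)⟩

theorem tendsto_clm_apply {α : Type*} {l : Filter α} {f : α → E →L[ℝ] E} {v : α → E}
    {f₀ : E →L[ℝ] E} {v₀ : E} (hf : Tendsto f l (𝓝 f₀)) (hv : Tendsto v l (𝓝 v₀)) :
    Tendsto (fun a => f a (v a)) l (𝓝 (f₀ v₀)) :=
  (isBoundedBilinearMap_apply.continuous.tendsto (f₀, v₀)).comp (hf.prodMk_nhds hv)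

theorem isCompact_taylorSet {u : E → ℝ} {C : Set E} (hC : IsCompact C) (hu : ContinuousOn u C)
    (M ε δ : ℝ) : IsCompact (taylorSet u C M ε δ) := by
  set Z : Set (E × E × (E →L[ℝ] E)) := {z | z ∈ C ×ˢ (closedBall 0 M ×ˢ closedBall 0 M) ∧
    ∀ y, dist y z.1 < δ → |u y - quad z.1 (u z.1) z.2.1 z.2.2 y| ≤ ε * dist y z.1 ^ 2} with hZ
  have hP : IsCompact (C ×ˢ (closedBall (0 : E) M ×ˢ closedBall (0 : E →L[ℝ] E) M)) :=
    hC.prod ((isCompact_closedBall _ _).prod (isCompact_closedBall _ _))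
  have hZc : IsCompact Z := by
    refine hP.of_isClosed_subset (IsSeqClosed.isClosed fun z z₀ hz hlim => ?_) fun z hz => hz.1
    have hz₀ : z₀ ∈ C ×ˢ (closedBall (0 : E) M ×ˢ closedBall (0 : E →L[ℝ] E) M) :=
      hP.isClosed.mem_of_tendsto hlim (Eventually.of_forall fun n => (hz n).1)
    refine ⟨hz₀, fun y hy => ?_⟩
    have h1 : Tendsto (fun n => (z n).1) atTop (𝓝 z₀.1) := (continuous_fst.tendsto _).comp hlim
    have h2 : Tendsto (fun n => (z n).2.1) atTop (𝓝 z₀.2.1) :=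
      ((continuous_fst.comp continuous_snd).tendsto _).comp hlim
    have h3 : Tendsto (fun n => (z n).2.2) atTop (𝓝 z₀.2.2) :=
      ((continuous_snd.comp continuous_snd).tendsto _).comp hlim
    have hu1 : Tendsto (fun n => u (z n).1) atTop (𝓝 (u z₀.1)) :=
      (hu z₀.1 hz₀.1).tendsto.comp
        (tendsto_nhdsWithin_iff.2 ⟨h1, Eventually.of_forall fun n => (hz n).1.1⟩)
    have hs : Tendsto (fun n => y - (z n).1) atTop (𝓝 (y - z₀.1)) := tendsto_const_nhds.sub h1
    have hq : Tendsto (fun n => quad (z n).1 (u (z n).1) (z n).2.1 (z n).2.2 y) atTop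
        (𝓝 (quad z₀.1 (u z₀.1) z₀.2.1 z₀.2.2 y)) :=
      (hu1.add (h2.inner hs)).add ((tendsto_clm_apply h3 hs).inner hs)
    have hd : Tendsto (fun n => dist y (z n).1) atTop (𝓝 (dist y z₀.1)) :=
      tendsto_const_nhds.dist h1
    refine le_of_tendsto_of_tendsto (tendsto_const_nhds.sub hq).abs ((hd.pow 2).const_mul ε) ?_
    filter_upwards [hd.eventually (gt_mem_nhds hy)] with n hn using (hz n).2 y hn
  convert hZc.image continuous_fst using 1
  ext x
  constructor
  · rintro ⟨hx, p, A, hp, hA, h⟩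
    exact ⟨(x, p, A), ⟨⟨hx, by simpa using hp, by simpa using hA⟩, h⟩, rfl⟩
  · rintro ⟨⟨x', p, A⟩, ⟨⟨hx, hp, hA⟩, h⟩, rfl⟩
    exact ⟨hx, p, A, by simpa using hp, by simpa using hA, h⟩

theorem eq_zero_and_abs_le_of_abs_le {p : E} {A : E →L[ℝ] E} {c δ : ℝ} (hδ : 0 < δ)
    (h : ∀ y : E, ‖y‖ < δ → |inner ℝ p y + inner ℝ (A y) y| ≤ c * ‖y‖ ^ 2) :
    p = 0 ∧ ∀ y, |inner ℝ (A y) y| ≤ c * ‖y‖ ^ 2 := by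
  have hsc : ∀ y : E, ∀ᶠ t : ℝ in 𝓝[>] 0,
      |inner ℝ p y + t * inner ℝ (A y) y| ≤ t * (c * ‖y‖ ^ 2) := by
    intro y
    have h0 : Tendsto (fun t : ℝ => ‖t • y‖) (𝓝[>] 0) (𝓝 0) := by
      have : Continuous fun t : ℝ => ‖t • y‖ := by fun_prop
      simpa using (this.tendsto 0).mono_left nhdsWithin_le_nhds
    filter_upwards [h0.eventually (gt_mem_nhds hδ), self_mem_nhdsWithin] with t ht ht0
    have ht0 : 0 < t := ht0
    have h1 := h _ ht
    rw [map_smul, real_inner_smul_left, real_inner_smul_right, real_inner_smul_right, norm_smul,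
      mul_pow, Real.norm_eq_abs, sq_abs] at h1
    have e : t * inner ℝ p y + t * (t * inner ℝ (A y) y) =
        t * (inner ℝ p y + t * inner ℝ (A y) y) := by ring
    rw [e, abs_mul, abs_of_pos ht0] at h1
    refine le_of_mul_le_mul_left (h1.trans (le_of_eq ?_)) ht0
    ring
  have hp : p = 0 := by
    have h1 : Tendsto (fun t : ℝ => |inner ℝ p p + t * inner ℝ (A p) p|) (𝓝[>] 0)
        (𝓝 |inner ℝ p p + 0 * inner ℝ (A p) p|) :=
      ((by fun_prop : Continuous fun t : ℝ => |inner ℝ p p + t * inner ℝ (A p) p|).tendsto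
        0).mono_left nhdsWithin_le_nhds
    have h2 : Tendsto (fun t : ℝ => t * (c * ‖p‖ ^ 2)) (𝓝[>] 0) (𝓝 (0 * (c * ‖p‖ ^ 2))) :=
      ((by fun_prop : Continuous fun t : ℝ => t * (c * ‖p‖ ^ 2)).tendsto 0).mono_left
        nhdsWithin_le_nhds
    have h3 := le_of_tendsto_of_tendsto h1 h2 (hsc p)
    rw [zero_mul, zero_mul, add_zero] at h3
    exact inner_self_eq_zero.1 (abs_eq_zero.1 (le_antisymm h3 (abs_nonneg _)))
  refine ⟨hp, fun y => ?_⟩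
  obtain ⟨t, ht, ht0⟩ := ((hsc y).and self_mem_nhdsWithin).exists
  have ht0 : 0 < t := ht0
  rw [hp, inner_zero_left, zero_add, abs_mul, abs_of_pos ht0] at ht
  exact le_of_mul_le_mul_left ht ht0

theorem exists_taylor_of_mem_iInter {u : E → ℝ} {C : Set E} {M : ℝ} {δ : ℕ → ℝ} (hδ : ∀ i, 0 < δ i)
    {x : E} (hx : ∀ i : ℕ, x ∈ taylorSet u C M (1 / (i + 1)) (δ i)) :
    ∃ (p : E) (A : E →L[ℝ] E), ‖A‖ ≤ M ∧ ∀ (i : ℕ), ∀ y, dist y x < δ i →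
      |u y - quad x (u x) p A y| ≤ 2 / (i + 1) * dist y x ^ 2 := by
  choose _ p A _ hA h using hx
  have hij : ∀ i j, p i = p j ∧ ∀ y, |inner ℝ ((A i - A j) y) y| ≤
      (1 / ((i : ℝ) + 1) + 1 / ((j : ℝ) + 1)) * ‖y‖ ^ 2 := by
    intro i j
    have := eq_zero_and_abs_le_of_abs_le (p := p i - p j) (A := A i - A j)
      (c := 1 / ((i : ℝ) + 1) + 1 / ((j : ℝ) + 1)) (lt_min (hδ i) (hδ j)) (fun y hy => by
        have e : dist (x + y) x = ‖y‖ := by simp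
        have h1 := h i (x + y) (by rw [e]; exact hy.trans_le (min_le_left _ _))
        have h2 := h j (x + y) (by rw [e]; exact hy.trans_le (min_le_right _ _))
        rw [e] at h1 h2
        simp only [quad, add_sub_cancel_left] at h1 h2
        have h3 := abs_le.1 h1
        have h4 := abs_le.1 h2
        rw [sub_apply, inner_sub_left, inner_sub_left, abs_le]
        constructor <;> linarith [h3.1, h3.2, h4.1, h4.2])
    exact ⟨sub_eq_zero.1 this.1, this.2⟩
  obtain ⟨A₀, hA₀, φ, hφ, hlim⟩ := (isCompact_closedBall (0 : E →L[ℝ] E) M).tendsto_subseq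
    (fun i => by simpa using hA i)
  refine ⟨p 0, A₀, by simpa using hA₀, fun i y hy => ?_⟩
  have h1 := h i y hy
  have h2 : |inner ℝ ((A i - A₀) (y - x)) (y - x)| ≤ (1 / ((i : ℝ) + 1) + 0) * ‖y - x‖ ^ 2 := by
    have l1 : Tendsto (fun n => |inner ℝ ((A i - A (φ n)) (y - x)) (y - x)|) atTop
        (𝓝 |inner ℝ ((A i - A₀) (y - x)) (y - x)|) :=
      ((tendsto_clm_apply (tendsto_const_nhds.sub hlim) tendsto_const_nhds).inner
        tendsto_const_nhds).abs
    have l2 : Tendsto (fun n => (1 / ((i : ℝ) + 1) + 1 / ((φ n : ℝ) + 1)) * ‖y - x‖ ^ 2) atTop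
        (𝓝 ((1 / ((i : ℝ) + 1) + 0) * ‖y - x‖ ^ 2)) :=
      (tendsto_const_nhds.add
        (tendsto_one_div_add_atTop_nhds_zero_nat.comp hφ.tendsto_atTop)).mul_const _
    exact le_of_tendsto_of_tendsto l1 l2 (Eventually.of_forall fun n => (hij i (φ n)).2 _)
  rw [(hij i 0).1] at h1
  rw [add_zero, sub_apply, inner_sub_left] at h2
  have e : dist y x = ‖y - x‖ := dist_eq_norm _ _
  rw [e] at h1 ⊢
  simp only [quad] at h1 ⊢
  have h3 := abs_le.1 h1
  have h4 := abs_le.1 h2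
  have e2 : 2 / ((i : ℝ) + 1) * ‖y - x‖ ^ 2 =
    1 / ((i : ℝ) + 1) * ‖y - x‖ ^ 2 + 1 / ((i : ℝ) + 1) * ‖y - x‖ ^ 2 := by ring
  rw [e2, abs_le]
  constructor <;> linarith [h3.1, h3.2, h4.1, h4.2]

theorem exists_index_measure_lt {s : ℕ → Set E} (hs : ∀ n, MeasurableSet (s n)) (ha : Antitone s)
    (hf : volume (s 0) ≠ ∞) (h0 : volume (⋂ n, s n) = 0) {d : ℝ≥0∞} (hd : 0 < d) :
    ∃ n, volume (s n) < d := by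
  have h1 := tendsto_measure_iInter_atTop (μ := volume) (fun n => (hs n).nullMeasurableSet) ha
    ⟨0, hf⟩
  rw [h0] at h1
  exact (h1.eventually (gt_mem_nhds hd)).exists

theorem exists_compact_uniform_taylor {u : E → ℝ} {S C : Set E} (hC : IsCompact C)
    (hu : ContinuousOn u C) (hS : MeasurableSet S) (hSC : S ⊆ C)
    (hT : volume {x ∈ S | ¬ HasTaylor u x} = 0) {d : ℝ≥0∞} (hd : d ≠ 0) :
    ∃ K ⊆ S, IsCompact K ∧ volume (S \ K) < d ∧ ∃ (p : E → E) (A : E → E →L[ℝ] E) (M : ℝ),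
      (∀ a ∈ K, ‖A a‖ ≤ M) ∧ ∀ ε > 0, ∃ δ > 0, ∀ a ∈ K, ∀ y, dist y a < δ →
        |u y - quad a (u a) (p a) (A a) y| ≤ ε * dist y a ^ 2 := by
  have hSfin : ∀ s ⊆ S, volume s ≠ ∞ := fun s hs =>
    ((measure_mono (hs.trans hSC)).trans_lt hC.measure_lt_top).ne
  set V : ℕ → ℕ → ℕ → Set E := fun i m k => taylorSet u C m (1 / (i + 1)) (1 / (k + 1)) with hV
  have hVc : ∀ i m k, IsCompact (V i m k) := fun i m k => isCompact_taylorSet hC hu _ _ _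
  have hVm : ∀ i m k, MeasurableSet (V i m k) := fun i m k => (hVc i m k).measurableSet
  have hVmono : ∀ i {m m' k k'}, m ≤ m' → k ≤ k' → V i m k ⊆ V i m' k' := fun i m m' k k' h1 h2 =>
    taylorSet_mono (by exact_mod_cast h1) (Nat.one_div_le_one_div h2)
  set W : ℕ → Set E := fun m => ⋂ i, ⋃ k, V i m k with hW
  have hWm : ∀ m, MeasurableSet (W m) := fun m =>
    MeasurableSet.iInter fun i => MeasurableSet.iUnion fun k => hVm i m k
  have hd3 : 0 < d / 3 := ENNReal.div_pos hd (by norm_num)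
  obtain ⟨m, hm⟩ : ∃ m, volume (S \ W m) < d / 3 := by
    refine exists_index_measure_lt (fun m => hS.diff (hWm m)) (fun m m' h => ?_)
      (hSfin _ sdiff_subset) (measure_mono_null (fun x hx => ?_) hT) hd3
    · exact sdiff_subset_sdiff_right (iInter_mono fun i => iUnion_mono fun k => hVmono i h le_rfl)
    · rw [mem_iInter] at hx
      refine ⟨(hx 0).1, fun ⟨p, A, h⟩ => ?_⟩
      obtain ⟨m, hm⟩ := exists_nat_ge (max ‖p‖ ‖A‖)
      refine (hx m).2 (mem_iInter.2 fun i => mem_iUnion.2 ?_)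
      obtain ⟨δ, hδ, hδh⟩ := h (1 / (i + 1)) (by positivity)
      obtain ⟨k, hk⟩ := exists_nat_one_div_lt hδ
      exact ⟨k, hSC (hx 0).1, p, A, (le_max_left _ _).trans hm, (le_max_right _ _).trans hm,
        fun y hy => hδh y (hy.trans hk)⟩
  obtain ⟨d', hd'0, hd'⟩ := ENNReal.exists_pos_sum_of_countable' hd3.ne' ℕ
  have hk : ∀ i, ∃ k, volume ((S ∩ W m) \ V i m k) < d' i := fun i => by
    refine exists_index_measure_lt (fun k => (hS.inter (hWm m)).diff (hVm i m k))
      (fun k k' h => sdiff_subset_sdiff_right (hVmono i le_rfl h))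
      (hSfin _ (sdiff_subset.trans inter_subset_left)) ?_ (hd'0 i)
    rw [← sdiff_iUnion, sdiff_eq_empty.2, measure_empty]
    exact fun x hx => mem_iInter.1 hx.2 i
  choose k hk using hk
  set K' : Set E := ⋂ i, V i m (k i) with hK'
  have hK'm : MeasurableSet K' := MeasurableSet.iInter fun i => hVm i m (k i)
  have h1 : volume (S \ K') ≤ d / 3 + d / 3 := by
    have hsub : S \ K' ⊆ (S \ W m) ∪ ⋃ i, (S ∩ W m) \ V i m (k i) := by
      rintro x ⟨hx, hxK⟩
      by_cases hxW : x ∈ W m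
      · rw [hK', mem_iInter, not_forall] at hxK
        obtain ⟨i, hi⟩ := hxK
        exact Or.inr (mem_iUnion.2 ⟨i, ⟨hx, hxW⟩, hi⟩)
      · exact Or.inl ⟨hx, hxW⟩
    refine (measure_mono hsub).trans ((measure_union_le _ _).trans (add_le_add hm.le ?_))
    exact (measure_iUnion_le _).trans ((ENNReal.tsum_le_tsum fun i => (hk i).le).trans hd'.le)
  obtain ⟨K, hKS, hK, hKd⟩ := (hS.inter hK'm).exists_isCompact_sdiff_lt
    (hSfin _ inter_subset_left) hd3.ne'
  have hex : ∀ a : E, ∃ (p : E) (A : E →L[ℝ] E), a ∈ K → (‖A‖ ≤ m ∧ ∀ (i : ℕ), ∀ y,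
      dist y a < 1 / (k i + 1) → |u y - quad a (u a) p A y| ≤ 2 / (i + 1) * dist y a ^ 2) := by
    intro a
    by_cases ha : a ∈ K
    · obtain ⟨p, A, h⟩ := exists_taylor_of_mem_iInter (δ := fun i => 1 / ((k i : ℝ) + 1))
        (fun i => by positivity) (fun i => mem_iInter.1 (hKS ha).2 i)
      exact ⟨p, A, fun _ => h⟩
    · exact ⟨0, 0, fun h => absurd h ha⟩
  choose p A hpA using hex
  refine ⟨K, hKS.trans inter_subset_left, hK, ?_, p, A, m, fun a ha => (hpA a ha).1, fun ε hε => ?_⟩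
  · have hsub : S \ K ⊆ (S \ K') ∪ ((S ∩ K') \ K) := by
      rintro x ⟨hx, hxK⟩
      by_cases hxK' : x ∈ K'
      · exact Or.inr ⟨⟨hx, hxK'⟩, hxK⟩
      · exact Or.inl ⟨hx, hxK'⟩
    calc volume (S \ K) ≤ volume (S \ K') + volume ((S ∩ K') \ K) :=
          (measure_mono hsub).trans (measure_union_le _ _)
      _ < d / 3 + d / 3 + d / 3 := ENNReal.add_lt_add_of_le_of_lt (hSfin _ sdiff_subset) h1 hKd
      _ = d := ENNReal.add_thirds d
  · obtain ⟨i, hi⟩ := exists_nat_one_div_lt (half_pos hε)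
    refine ⟨1 / (k i + 1), by positivity, fun a ha y hy => ((hpA a ha).2 i y hy).trans ?_⟩
    have : 2 / ((i : ℝ) + 1) ≤ ε := by
      have e : 2 / ((i : ℝ) + 1) = 2 * (1 / (i + 1)) := by ring
      linarith
    gcongr

end Egorov

section Assembly

variable {E : Type*} [NormedAddCommGroup E] [InnerProductSpace ℝ E] [FiniteDimensional ℝ E]
  [MeasurableSpace E] [BorelSpace E]

theorem LocStrongConvex.convexOn {U : Set E} (hU : Convex ℝ U) {u : E → ℝ}
    (hu : LocStrongConvex U u) : ConvexOn ℝ U u := by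
  have h : StrongConvexOn U 0 u := strongConvexOn_of_forall_ball hU fun x hx => by
    obtain ⟨η, hη, h⟩ := hu x hx
    exact h.mono hη.le
  rwa [strongConvexOn_zero] at h

/-- An exhaustion by compact sets whose frontiers avoid prescribed compact subsets of the shells. -/
theorem exists_exhaustion_avoiding {U : Set E} {C K : ℕ → Set E} (hC : ∀ j, IsCompact (C j))
    (hCi : ∀ j, C j ⊆ interior (C (j + 1))) (hCU : ⋃ j, C j = U) (hK : ∀ j, IsCompact (K j))
    (hKC : ∀ j, K j ⊆ C (j + 1) \ C j) :
    ∃ D : ℕ → Set E, (∀ j, IsCompact (D j)) ∧ Monotone D ∧ (∀ j, D j ⊆ U) ∧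
      (∀ j, K j ⊆ interior (D (j + 1)) \ D j) ∧ ∀ x ∈ U, ∃ j, x ∈ interior (D j) := by
  have hex : ∀ j, ∃ L, IsCompact L ∧ C j ⊆ interior L ∧ L ⊆ interior (C (j + 1)) \ K j := fun j =>
    exists_compact_between (hC j) (isOpen_interior.sdiff (hK j).isClosed) fun x hx =>
      ⟨hCi j hx, fun h => (hKC j h).2 hx⟩
  choose D hD hCD hDC using hex
  refine ⟨D, hD, monotone_nat_of_le_succ fun j x hx =>
    interior_subset (hCD _ (interior_subset (hDC j hx).1)), fun j x hx => ?_, fun j x hx =>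
    ⟨hCD _ (hKC j hx).1, fun h => (hDC j h).2 hx⟩, fun x hx => ?_⟩
  · rw [← hCU]
    exact mem_iUnion.2 ⟨j + 1, interior_subset (hDC j hx).1⟩
  · rw [← hCU] at hx
    obtain ⟨j, hj⟩ := mem_iUnion.1 hx
    exact ⟨j, hCD j hj⟩

/-- A continuous positive function has a positive lower bound on each compact set. -/
theorem exists_pos_le_of_continuousOn {K : Set E} (hK : IsCompact K) {f : E → ℝ}
    (hf : ContinuousOn f K) (hpos : ∀ x ∈ K, 0 < f x) : ∃ b > 0, ∀ x ∈ K, b ≤ f x := by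
  rcases K.eq_empty_or_nonempty with rfl | hne
  · exact ⟨1, one_pos, fun x hx => hx.elim⟩
  obtain ⟨x, hx, hmin⟩ := hK.exists_isMinOn hne hf
  exact ⟨f x, hpos x hx, fun y hy => hmin hy⟩

theorem exists_pos_le_of_finite {β : ℕ → ℝ} (hβ : ∀ j, 0 < β j) (m : ℕ) :
    ∃ b > 0, ∀ j ≤ m, b ≤ β j := by
  induction m with
  | zero => exact ⟨β 0, hβ 0, fun j hj => by rw [Nat.le_zero.1 hj]⟩
  | succ m ih =>
    obtain ⟨b, hb, h⟩ := ih
    refine ⟨min b (β (m + 1)), lt_min hb (hβ _), fun j hj => ?_⟩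
    rcases Nat.le_succ_iff.1 hj with h' | rfl
    · exact (min_le_left _ _).trans (h j h')
    · exact min_le_right _ _

/-- Lusin approximation with prescribed error in each shell of an exhaustion. -/
theorem exists_lusin_approx {U : Set E} (hU : IsOpen U) {C : ℕ → Set E}
    (hC : ∀ j, IsCompact (C j)) (hCi : ∀ j, C j ⊆ interior (C (j + 1))) (hCU : ⋃ j, C j = U)
    {u : E → ℝ} (hu : LocStrongConvex U u) {ε : E → ℝ} (hε : ContinuousOn ε U)
    (hεpos : ∀ x ∈ U, 0 < ε x) {d : ℕ → ℝ≥0∞} (hd : ∀ j, d j ≠ 0) {l : ℝ} (hl : 0 < l) :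
    ∃ v : E → ℝ, LocStrongConvex U v ∧ (∀ x ∈ U, ContDiffAt ℝ 2 v x) ∧
      (∀ x ∈ U, |u x - v x| < ε x) ∧
      (∀ j, volume {x ∈ C (j + 1) \ C j | u x ≠ v x} < d j) ∧
      ∀ η, (∀ x ∈ U, StrongConvexAt η u x) → ∀ x ∈ U, StrongConvexAt (η - l) v x := by
  have hCsub : ∀ j, C j ⊆ U := fun j => hCU ▸ subset_iUnion C j
  have huc := hu.continuousOn
  choose K hKS hK hKd p A M hA hT using fun j => exists_compact_uniform_taylor (hC (j + 1))
    (huc.mono (hCsub _)) ((hC (j + 1)).measurableSet.diff (hC j).measurableSet) sdiff_subset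
    (measure_mono_null (show {x ∈ C (j + 1) \ C j | ¬ HasTaylor u x} ⊆
      {x ∈ U | ¬ HasTaylor u x} from
      fun x hx => ⟨hCsub _ hx.1.1, hx.2⟩) hu.ae_hasTaylor) (hd j)
  obtain ⟨D, hD, hDm, hDU, hKD, hDcov⟩ := exists_exhaustion_avoiding hC hCi hCU hK hKS
  choose m hm0 hm using fun j => hu.exists_modulus (hD (j + 1)) (hDU _)
  choose c hc0 hc using fun j => exists_pos_le_of_continuousOn (hD (j + 1))
    (hε.mono (hDU _)) fun x hx => hεpos x (hDU _ hx)
  choose w hw r hr b hb hrΩ hwK hwb hwc hwη using fun j => exists_foreground (hK j)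
    (isOpen_interior.sdiff (hD j).isClosed) (hKD j)
    (huc.mono ((sdiff_subset.trans interior_subset).trans (hDU (j + 1)))) (hA j) (hT j)
    (lt_min hl (half_pos (hm0 j))) (half_pos (hc0 j))
  obtain ⟨N, hN⟩ : ∃ N : ℕ → Set E, ∀ j, N j = thickening (r j) (K j) := ⟨_, fun _ => rfl⟩
  obtain ⟨Q, hQ⟩ : ∃ Q : ℕ → Set E, ∀ j, Q j = cthickening (r j / 8) (K j) := ⟨_, fun _ => rfl⟩
  have hNo : ∀ j, IsOpen (N j) := fun j => hN j ▸ isOpen_thickening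
  have hQc : ∀ j, IsClosed (Q j) := fun j => hQ j ▸ isClosed_cthickening
  have hQN : ∀ j, Q j ⊆ N j := fun j => by
    rw [hN, hQ]
    exact cthickening_subset_thickening' (hr j) (by linarith [hr j]) _
  have hKN : ∀ j, K j ⊆ N j := fun j => hN j ▸ self_subset_thickening (hr j) _
  have hNΩ : ∀ j, N j ⊆ interior (D (j + 1)) \ D j := fun j =>
    hN j ▸ (thickening_subset_cthickening _ _).trans (hrΩ j)
  have hND : ∀ j, N j ⊆ D (j + 1) := fun j x hx => interior_subset (hNΩ j hx).1
  have hNlt : ∀ i j x, x ∈ N i → x ∈ D j → i < j := fun i j x hi hj => by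
    by_contra h
    exact (hNΩ i hi).2 (hDm (not_lt.1 h) hj)
  obtain ⟨J, hJ⟩ : ∃ J : E → ℕ, J = fun x => sInf {j | x ∈ N j} := ⟨_, rfl⟩
  have hJN : ∀ j, ∀ x ∈ N j, J x = j := fun j x hx => by
    have h1 : x ∈ N (J x) := by rw [hJ]; exact Nat.sInf_mem (s := {j | x ∈ N j}) ⟨j, hx⟩
    have h2 := hNlt _ _ x h1 (hND j hx)
    have h3 := hNlt _ _ x hx (hND _ h1)
    omega
  have hJle : ∀ j, ∀ x ∈ D j, J x ≤ j := fun j x hx => by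
    by_cases h : ∃ i, x ∈ N i
    · obtain ⟨i, hi⟩ := h
      exact hJN i x hi ▸ (hNlt i j x hi hx).le
    · have : {j | x ∈ N j} = ∅ := by
        ext i; simpa using fun hi => h ⟨i, hi⟩
      rw [hJ]
      simp [this]
  obtain ⟨g, hg, hg2, hgu, hgη⟩ := exists_contDiff_approx_below hU hu
    (e := fun x => min (ε x) (b (J x) / 2)) (fun L hL hLc => by
      obtain ⟨b₁, hb₁, h₁⟩ := exists_pos_le_of_continuousOn hLc (hε.mono hL) fun x hx =>
        hεpos x (hL hx)
      obtain ⟨k, hk⟩ := hLc.elim_directed_cover (fun j => interior (D j))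
        (fun j => isOpen_interior) (fun x hx => mem_iUnion.2 (hDcov x (hL hx)))
        (Monotone.directed_le fun i j hij => interior_mono (hDm hij))
      obtain ⟨b₂, hb₂, h₂⟩ := exists_pos_le_of_finite (fun j => half_pos (hb j)) k
      exact ⟨min b₁ b₂, lt_min hb₁ hb₂, fun x hx => le_min ((min_le_left _ _).trans (h₁ x hx))
        ((min_le_right _ _).trans (h₂ _ (hJle k x (interior_subset (hk hx)))))⟩) hl
  have hKU : ∀ j, K j ⊆ U := fun j => ((hKN j).trans (hND j)).trans (hDU _)
  have hNU : ∀ j, N j ⊆ U := fun j => (hND j).trans (hDU _)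
  choose q hq0 hq using fun j => exists_pos_le_of_continuousOn (hK j)
    ((huc.sub hg.continuousOn).mono (hKU j)) fun x hx => sub_pos.2 (hgu x (hKU j hx)).2
  obtain ⟨δ, hδ⟩ : ∃ δ : ℕ → ℝ, ∀ j, δ j = min (q j) (min (b j / 2) (c j / 4)) :=
    ⟨_, fun _ => rfl⟩
  have hδ0 : ∀ j, 0 < δ j := fun j => by
    rw [hδ]
    exact lt_min (hq0 j) (lt_min (half_pos (hb j)) (by linarith [hc0 j]))
  have hδq : ∀ j, δ j ≤ q j := fun j => hδ j ▸ min_le_left _ _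
  have hδb : ∀ j, δ j ≤ b j / 2 := fun j => hδ j ▸ (min_le_right _ _).trans (min_le_left _ _)
  have hδc : ∀ j, δ j ≤ c j / 4 := fun j => hδ j ▸ (min_le_right _ _).trans (min_le_right _ _)
  have H : ∀ j, ∀ x ∈ N j \ Q j, w j x + δ j ≤ g x := fun j x hx => by
    have h1 := hwb j x ⟨hN j ▸ hx.1, fun h => hx.2 (by
      rw [hQ]; exact thickening_subset_cthickening _ _ h)⟩
    have h2 := (hgu x (hNU j hx.1)).1
    have h3 : min (ε x) (b (J x) / 2) ≤ b j / 2 := hJN j x hx.1 ▸ min_le_right _ _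
    linarith [hδb j]
  obtain ⟨v, hv⟩ : ∃ v : E → ℝ, ∀ x, v x = glue (N (J x)) (δ (J x)) g (w (J x)) x :=
    ⟨_, fun _ => rfl⟩
  have hvN : ∀ j, ∀ x ∈ N j, v x = glue (N j) (δ j) g (w j) x := fun j x hx => by
    rw [hv, hJN j x hx]
  have hlocal : ∀ x ∈ U, ∃ j, v =ᶠ[𝓝 x] glue (N j) (δ j) g (w j) := fun x hx => by
    by_cases h : ∃ j, x ∈ N j
    · obtain ⟨j, hj⟩ := h
      exact ⟨j, by filter_upwards [(hNo j).mem_nhds hj] with y hy using hvN j y hy⟩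
    · push Not at h
      obtain ⟨k, hk⟩ := hDcov x hx
      have h1 : (⋂ i ∈ Finset.range (k + 1), (Q i)ᶜ) ∈ 𝓝 x :=
        (Filter.biInter_finset_mem _).2 fun i _ =>
          (hQc i).isOpen_compl.mem_nhds fun hi => h i (hQN i hi)
      refine ⟨k, ?_⟩
      filter_upwards [h1, isOpen_interior.mem_nhds hk] with y hy hyk
      have h2 : ∀ i, i ≤ k → y ∉ Q i := fun i hi => mem_iInter₂.1 hy i (by simpa using by omega)
      rw [hv, glue_eq_left (hδ0 _) (H _) (h2 _ (hJle k y (interior_subset hyk))),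
        glue_eq_left (hδ0 _) (H _) (h2 k le_rfl)]
  have hsc : ∀ x ∈ U, ∀ η, StrongConvexAt η g x → (∀ j, x ∈ N j → StrongConvexAt η (w j) x) →
      StrongConvexAt η v x := fun x hx η h1 h2 => by
    obtain ⟨j, hj⟩ := hlocal x hx
    exact (strongConvexAt_glue (hNo j) (hQc j) (hQN j) (hδ0 j) (H j) h1 (h2 j)).congr hj.symm
  refine ⟨v, fun x hx => ?_, fun x hx => ?_, fun x hx => ?_, fun j => ?_, fun η hη x hx => ?_⟩
  · obtain ⟨η, hη, h⟩ := hg x hx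
    have hJx : 0 < m (J x) / 2 := half_pos (hm0 _)
    refine ⟨min η (m (J x) / 2), lt_min hη hJx, hsc x hx _ (h.mono (min_le_left _ _))
      fun j hj => ?_⟩
    refine (hwη j (m j) (fun y hy => hm j y (interior_subset hy.1)) x (hN j ▸ hj)).mono ?_
    rw [hJN j x hj]
    linarith [min_le_right η (m j / 2), min_le_right l (m j / 2)]
  · obtain ⟨j, hj⟩ := hlocal x hx
    exact (contDiffAt_glue (hNo j) (hQc j) (hQN j) (hδ0 j) (H j) (hg2 x hx)
      fun _ => (hw j).contDiffAt).congr_of_eventuallyEq hj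
  · have h1 := hgu x hx
    have h2 : min (ε x) (b (J x) / 2) ≤ ε x := min_le_left _ _
    have h3 : g x ≤ v x := hv x ▸ le_glue (hδ0 _) x
    rw [abs_lt]
    refine ⟨?_, by linarith⟩
    by_cases h : ∃ j, x ∈ N j
    · obtain ⟨j, hj⟩ := h
      have h4 := smax_le (hδ0 j) (g x) (w j x)
      rw [hvN j x hj, glue_of_mem hj]
      have h5 := hwc j x (hN j ▸ hj)
      have h6 := hc j x (hND j hj)
      have h7 : max (g x) (w j x) ≤ u x + c j / 2 :=
        max_le (by linarith [hc0 j]) h5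
      linarith [hδc j, hc0 j]
    · rw [hv, glue_of_notMem fun h' => h ⟨_, h'⟩]
      linarith [hεpos x hx]
  · refine lt_of_le_of_lt (measure_mono fun x hx => ?_) (hKd j)
    refine ⟨hx.1, fun hxK => hx.2 ?_⟩
    have h1 := hq j x hxK
    rw [hvN j x (hKN j hxK), glue_of_mem (hKN j hxK), smax_of_le (hδ0 j), hwK j x hxK]
    rw [hwK j x hxK]
    simp only [Pi.sub_apply] at h1
    linarith [hδq j]
  · refine hsc x hx _ (hgη η hη x hx) fun j hj => ?_
    refine (hwη j η (fun y hy => hη y (hDU _ (interior_subset hy.1))) x (hN j ▸ hj)).mono ?_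
    linarith [min_le_left l (m j / 2)]

end Assembly

section Graph

variable {n : ℕ}

theorem hausdorffMeasure_graphSet_le {D : Set (EuclideanSpace ℝ (Fin n))}
    {v : EuclideanSpace ℝ (Fin n) → ℝ} {L : NNReal} (hv : LipschitzOnWith L v D) :
    μH[(n : ℝ)] (graphSet D v) ≤ ((1 + L : NNReal) : ℝ≥0∞) ^ (n : ℝ) * μH[(n : ℝ)] D := by
  refine LipschitzOnWith.hausdorffMeasure_image_le ?_ n.cast_nonneg
  refine LipschitzOnWith.of_dist_le_mul fun x hx y hy => ?_
  have h := hv.dist_le_mul x hx y hy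
  rw [EuclideanSpace.dist_eq, Fin.sum_univ_castSucc]
  simp only [WithLp.equiv_symm_apply, Fin.snoc_castSucc, Fin.snoc_last, WithLp.equiv_apply]
  have h1 : ∑ i, dist (x i) (y i) ^ 2 = dist x y ^ 2 := by
    rw [EuclideanSpace.dist_eq, Real.sq_sqrt (Finset.sum_nonneg fun i _ => sq_nonneg _)]
  rw [h1]
  refine Real.sqrt_le_iff.2 ⟨by positivity, ?_⟩
  push_cast
  have h2 : dist (v x) (v y) ^ 2 ≤ (L * dist x y) ^ 2 := by gcongr
  have h3 : (0 : ℝ) ≤ L * dist x y ^ 2 := by positivity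
  nlinarith

/-- Graphs of convex functions close to `u` have area controlled by the volume of the domain. -/
theorem exists_hausdorffMeasure_graphSet_le {U C : Set (EuclideanSpace ℝ (Fin n))} (hU : IsOpen U)
    (hC : IsCompact C) (hCU : C ⊆ U) {u : EuclideanSpace ℝ (Fin n) → ℝ} (hu : ContinuousOn u U) :
    ∃ A : NNReal, ∀ v, ConvexOn ℝ U v → (∀ x ∈ U, |u x - v x| ≤ 1) → ∀ D ⊆ C,
      μH[(n : ℝ)] (graphSet D v) ≤ A * volume D := by
  obtain ⟨k, hk⟩ : ∃ k : NNReal, (μH[(n : ℝ)] : Measure (EuclideanSpace ℝ (Fin n))) = k • volume :=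
    ⟨_, Measure.isAddLeftInvariant_eq_smul _ _⟩
  refine hC.induction_on (p := fun C => ∃ A : NNReal, ∀ v, ConvexOn ℝ U v →
    (∀ x ∈ U, |u x - v x| ≤ 1) → ∀ D ⊆ C, μH[(n : ℝ)] (graphSet D v) ≤ A * volume D)
    ⟨0, fun v _ _ D hD => ?_⟩ ?_ ?_ fun x hx => ?_
  · rw [subset_empty_iff.1 hD]
    simp [graphSet]
  · rintro s t hst ⟨A, hA⟩
    exact ⟨A, fun v hv hvu D hD => hA v hv hvu D (hD.trans hst)⟩
  · rintro s t ⟨A, hA⟩ ⟨B, hB⟩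
    refine ⟨A + B, fun v hv hvu D hD => ?_⟩
    have h : graphSet D v = graphSet (D ∩ s) v ∪ graphSet (D ∩ t) v := by
      rw [graphSet, graphSet, graphSet, ← image_union, ← inter_union_distrib_left,
        inter_eq_left.2 hD]
    rw [h]
    refine (measure_union_le _ _).trans ((add_le_add (hA v hv hvu _ inter_subset_right)
      (hB v hv hvu _ inter_subset_right)).trans ?_)
    rw [ENNReal.coe_add, add_mul]
    gcongr <;> exact inter_subset_left
  · have hcont := hu.continuousAt (hU.mem_nhds (hCU hx))
    have h1 : ∀ᶠ y in 𝓝 x, dist (u y) (u x) < 1 := hcont.eventually (ball_mem_nhds _ one_pos)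
    obtain ⟨r, hr, hball⟩ := Metric.mem_nhds_iff.1 (inter_mem h1 (hU.mem_nhds (hCU hx)))
    obtain ⟨L, hL⟩ : ∃ L, L = (2 * (|u x| + 2) / (r / 2)).toNNReal := ⟨_, rfl⟩
    refine ⟨ball x (r - r / 2), mem_nhdsWithin_of_mem_nhds (ball_mem_nhds _ (by linarith)),
      (1 + L) ^ n * k, fun v hv hvu D hD => ?_⟩
    have hlip : LipschitzOnWith L v D := by
      rw [hL]
      refine (ConvexOn.lipschitzOnWith_of_abs_le (hv.subset (fun y hy => (hball hy).2)
        (convex_ball _ _)) (half_pos hr) fun y hy => ?_).mono hD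
      have h2 := (hball hy).1
      have h3 := abs_le.1 (hvu y (hball hy).2)
      rw [mem_ofPred_eq, Real.dist_eq, abs_lt] at h2
      rw [abs_le]
      constructor <;> linarith [neg_abs_le (u x), le_abs_self (u x)]
    refine (hausdorffMeasure_graphSet_le hlip).trans (le_of_eq ?_)
    rw [hk, Measure.smul_apply, ENNReal.smul_def, smul_eq_mul, ENNReal.rpow_natCast]
    push_cast
    rw [mul_assoc]

theorem symmDiff_graphSet_subset {U : Set (EuclideanSpace ℝ (Fin n))}
    {u v : EuclideanSpace ℝ (Fin n) → ℝ} {S : ℕ → Set (EuclideanSpace ℝ (Fin n))}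
    (hS : {x ∈ U | u x ≠ v x} ⊆ ⋃ j, S j) :
    symmDiff (graphSet U u) (graphSet U v) ⊆ ⋃ j, (graphSet (S j) u ∪ graphSet (S j) v) := by
  rintro z (⟨⟨x, hx, rfl⟩, h⟩ | ⟨⟨x, hx, rfl⟩, h⟩)
  · obtain ⟨j, hj⟩ := mem_iUnion.1 (hS ⟨hx, fun e => h ⟨x, hx, by simp only [e]⟩⟩)
    exact mem_iUnion.2 ⟨j, Or.inl ⟨x, hj, rfl⟩⟩
  · obtain ⟨j, hj⟩ := mem_iUnion.1 (hS ⟨hx, fun e => h ⟨x, hx, by simp only [e]⟩⟩)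
    exact mem_iUnion.2 ⟨j, Or.inr ⟨x, hj, rfl⟩⟩

/-- A Lusin approximation that is also close in the graph sense. -/
theorem exists_lusin_approx_graph {U : Set (EuclideanSpace ℝ (Fin n))} (hU : IsOpen U)
    (hUc : Convex ℝ U) {u : EuclideanSpace ℝ (Fin n) → ℝ} (hu : LocStrongConvex U u)
    {ε₀ : ℝ≥0∞} (hε₀ : ε₀ ≠ 0) {ε : EuclideanSpace ℝ (Fin n) → ℝ} (hε : ContinuousOn ε U)
    (hεr : ∀ x ∈ U, ε x ∈ Ioc (0 : ℝ) 1) {l : ℝ} (hl : 0 < l) :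
    ∃ v : EuclideanSpace ℝ (Fin n) → ℝ, ContDiffOn ℝ 2 v U ∧ LocStrongConvex U v ∧
      (∀ η, (∀ x ∈ U, StrongConvexAt η u x) → ∀ x ∈ U, StrongConvexAt (η - l) v x) ∧
      volume {x ∈ U | u x ≠ v x} < ε₀ ∧ (∀ x ∈ U, |u x - v x| < ε x) ∧
      μH[(n : ℝ)] (symmDiff (graphSet U u) (graphSet U v)) < ε₀ := by
  obtain ⟨C, hC0, hC, hCi, hCU⟩ := exists_exhaustion hU
  have hCsub : ∀ j, C j ⊆ U := fun j => hCU ▸ subset_iUnion C j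
  choose A hA using fun j => exists_hausdorffMeasure_graphSet_le hU (hC (j + 1)) (hCsub _)
    hu.continuousOn
  obtain ⟨d, hd0, hd⟩ := ENNReal.exists_pos_sum_of_countable' hε₀ ℕ
  have hne : ∀ j, (2 * A j + 1 : ℝ≥0∞) ≠ ∞ := fun j =>
    ENNReal.add_ne_top.2 ⟨ENNReal.mul_ne_top (by simp) (by simp), by simp⟩
  obtain ⟨v, hv, hv2, hvε, hvd, hvη⟩ := exists_lusin_approx hU hC hCi hCU hu hε
    (fun x hx => (hεr x hx).1) (d := fun j => d j / (2 * A j + 1))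
    (fun j => (ENNReal.div_pos (hd0 j).ne' (hne j)).ne') hl
  obtain ⟨S, hS⟩ : ∃ S : ℕ → Set (EuclideanSpace ℝ (Fin n)),
      ∀ j, S j = {x ∈ C (j + 1) \ C j | u x ≠ v x} := ⟨_, fun _ => rfl⟩
  have hSC : ∀ j, S j ⊆ C (j + 1) := fun j x hx => by rw [hS] at hx; exact hx.1.1
  have hcov : {x ∈ U | u x ≠ v x} ⊆ ⋃ j, S j := by
    rintro x ⟨hx, hne⟩
    rw [← hCU, mem_iUnion] at hx
    classical
    have h0 : Nat.find hx ≠ 0 := fun h => by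
      have := Nat.find_spec hx
      rw [h, hC0] at this
      exact this
    obtain ⟨j, hj⟩ := Nat.exists_eq_succ_of_ne_zero h0
    refine mem_iUnion.2 ⟨j, ?_⟩
    rw [hS]
    refine ⟨⟨?_, Nat.find_min hx (by omega)⟩, hne⟩
    have := Nat.find_spec hx
    rwa [hj] at this
  have hbd : ∀ j, (2 * A j + 1) * volume (S j) ≤ d j := fun j => by
    refine (mul_le_mul_right (hS j ▸ (hvd j).le) _).trans ?_
    exact ENNReal.mul_div_le
  refine ⟨v, fun x hx => (hv2 x hx).contDiffWithinAt, hv, hvη, ?_, hvε, ?_⟩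
  · refine (measure_mono hcov).trans_lt ((measure_iUnion_le _).trans_lt
      ((ENNReal.tsum_le_tsum fun j => ?_).trans_lt hd))
    refine le_trans ?_ (hbd j)
    rw [add_mul, one_mul]
    exact le_add_self
  · refine (measure_mono (symmDiff_graphSet_subset hcov)).trans_lt
      ((measure_iUnion_le _).trans_lt ((ENNReal.tsum_le_tsum fun j => ?_).trans_lt hd))
    refine le_trans ?_ (hbd j)
    refine (measure_union_le _ _).trans ((add_le_add
      (hA j u (hu.convexOn hUc) (fun x _ => by simp) _ (hSC j))
      (hA j v (hv.convexOn hUc) (fun x hx => (hvε x hx).le.trans (hεr x hx).2) _ (hSC j))).trans ?_)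
    rw [← add_mul, ← two_mul, add_mul _ 1]
    exact le_self_add

theorem stronglyConvexOnWith_iff {η : ℝ} {s : Set (EuclideanSpace ℝ (Fin n))}
    {u : EuclideanSpace ℝ (Fin n) → ℝ} : StronglyConvexOnWith η s u ↔ StrongConvexOn s η u :=
  strongConvexOn_iff_convex.symm

theorem locStrongConvex_iff {U : Set (EuclideanSpace ℝ (Fin n))} (hU : IsOpen U)
    {u : EuclideanSpace ℝ (Fin n) → ℝ} : LocallyStronglyConvexOn U u ↔ LocStrongConvex U u := by
  refine ⟨fun h x hx => ?_, fun h x hx => ?_⟩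
  · obtain ⟨r, hr, -, η, hη, hs⟩ := h x hx
    exact ⟨η, hη, r, hr, stronglyConvexOnWith_iff.1 hs⟩
  · obtain ⟨η, hη, r, hr, hs⟩ := h x hx
    obtain ⟨t, ht, htU⟩ := Metric.isOpen_iff.1 hU x hx
    refine ⟨min r t, lt_min hr ht, (ball_subset_ball (min_le_right _ _)).trans htU, η, hη, ?_⟩
    exact stronglyConvexOnWith_iff.2
      (hs.subset (ball_subset_ball (min_le_left _ _)) (convex_ball _ _))

end Graph

end LusinC2

/-- Main theorem: Lusin-type `C²` approximation of locally strongly convex functions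
on an open convex set, with prescribed pointwise closeness and closeness of graphs in
Hausdorff measure; moreover, for `η`-strongly convex `u` the approximation may be
taken `η̃`-strongly convex for any `η̃ ∈ (0, η)`. -/
theorem locally_strongly_convex_C2_lusin_approx {n : ℕ}
    (U : Set (EuclideanSpace ℝ (Fin n))) (hUopen : IsOpen U) (hUconv : Convex ℝ U)
    (u : EuclideanSpace ℝ (Fin n) → ℝ) (hu : LocallyStronglyConvexOn U u)
    (ε₀ : ℝ) (hε₀ : 0 < ε₀)
    (ε : EuclideanSpace ℝ (Fin n) → ℝ) (hεcont : ContinuousOn ε U)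
    (hεrange : ∀ x ∈ U, ε x ∈ Set.Ioc (0 : ℝ) 1) :
    (∃ v : EuclideanSpace ℝ (Fin n) → ℝ,
      ContDiffOn ℝ 2 v U ∧ LocallyStronglyConvexOn U v ∧
      volume {x ∈ U | u x ≠ v x} < ENNReal.ofReal ε₀ ∧
      (∀ x ∈ U, |u x - v x| < ε x) ∧
      μH[(n : ℝ)] (symmDiff (graphSet U u) (graphSet U v)) < ENNReal.ofReal ε₀) ∧
    (∀ η > (0 : ℝ), StronglyConvexOnWith η U u → ∀ η' ∈ Set.Ioo (0 : ℝ) η,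
      ∃ v : EuclideanSpace ℝ (Fin n) → ℝ,
        ContDiffOn ℝ 2 v U ∧ StronglyConvexOnWith η' U v ∧
        volume {x ∈ U | u x ≠ v x} < ENNReal.ofReal ε₀ ∧
        (∀ x ∈ U, |u x - v x| < ε x) ∧
        μH[(n : ℝ)] (symmDiff (graphSet U u) (graphSet U v)) < ENNReal.ofReal ε₀) := by
  have hloc := (LusinC2.locStrongConvex_iff hUopen).1 hu
  have hε₀' := (ENNReal.ofReal_pos.2 hε₀).ne'
  constructor
  · obtain ⟨v, h1, h2, -, h3⟩ := LusinC2.exists_lusin_approx_graph hUopen hUconv hloc hε₀' hεcont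
      hεrange one_pos
    exact ⟨v, h1, (LusinC2.locStrongConvex_iff hUopen).2 h2, h3⟩
  · intro η _ hη η' hη'
    obtain ⟨v, h1, -, h2, h3⟩ := LusinC2.exists_lusin_approx_graph hUopen hUconv hloc hε₀' hεcont
      hεrange (sub_pos.2 hη'.2)
    refine ⟨v, h1, LusinC2.stronglyConvexOnWith_iff.2 ?_, h3⟩
    refine LusinC2.strongConvexOn_of_forall_ball hUconv fun x hx => ?_
    have h := h2 η (fun y hy => LusinC2.StrongConvexOn.strongConvexAt
      (LusinC2.stronglyConvexOnWith_iff.1 hη) (hUopen.mem_nhds hy)) x hx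
    rwa [sub_sub_cancel] at h
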